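/- arXiv:1404.6022 — 2 statements merged into one kernel-verified Lean document; each statement's English description precedes it below -/
import Mathlib

section
/- (Large sieve variant, dual form.) For every positive integer k there is a constant C_k > 0 such that the following holds for all integers N ≥ 1, all reals P ≥ 1, and all complex-valued functions g_p : {1, ..., p−1} → ℂ given for each prime p ≤ P: Σ_{n=1}^{N} | Σ_{p ≤ P} Σ_{a=1}^{p−1} g_p(a) e(an/p) |^{2k} ≤ C_k · (N + P^{2k}) · ( Σ_{p ≤ P} (Σ_{a=1}^{p−1} |g_p(a)|^{2k/(2k−1)})^{2k−1} + ( Σ_{p ≤ P} Σ_{a=1}^{p−1} |g_p(a)|² )^{k} ), where the sums over p run over primes. -/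
open scoped Real

/-- The primes `p ≤ P` (for a real bound `P ≥ 0`). -/
noncomputable def primesUpTo (P : ℝ) : Finset ℕ :=
  (Finset.range (⌊P⌋₊ + 1)).filter Nat.Prime

open Finset
open scoped BigOperators ComplexConjugate

/-- The additive character `x ↦ e^{2πix}` of the real line. -/
noncomputable def unitExp (x : ℝ) : ℂ := Complex.exp (2 * π * Complex.I * x)

lemma unitExp_add (x y : ℝ) : unitExp (x + y) = unitExp x * unitExp y := by
  simp only [unitExp, ← Complex.exp_add]
  congr 1
  push_cast
  ring

lemma unitExp_zero : unitExp 0 = 1 := by simp [unitExp]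

lemma unitExp_re (x : ℝ) : (unitExp x).re = Real.cos (2 * π * x) := by
  have h : (2 * π * Complex.I * x : ℂ) = ((2 * π * x : ℝ) : ℂ) * Complex.I := by
    push_cast
    ring
  rw [unitExp, h, Complex.exp_ofReal_mul_I_re]

lemma conj_unitExp (x : ℝ) : conj (unitExp x) = unitExp (-x) := by
  simp [unitExp, ← Complex.exp_conj, map_ofNat]

lemma unitExp_sum {ι : Type*} (s : Finset ι) (f : ι → ℝ) :
    unitExp (∑ i ∈ s, f i) = ∏ i ∈ s, unitExp (f i) := by
  simp only [unitExp, ← Complex.exp_sum]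
  congr 1
  push_cast
  rw [Finset.mul_sum]

lemma unitExp_nat_mul (n : ℕ) (x : ℝ) : unitExp (n * x) = unitExp x ^ n := by
  rw [unitExp, unitExp, ← Complex.exp_nat_mul]
  congr 1
  push_cast
  ring

lemma unitExp_eq_one_iff (x : ℝ) : unitExp x = 1 ↔ ∃ m : ℤ, x = m := by
  rw [unitExp, Complex.exp_eq_one_iff]
  refine exists_congr fun m => ?_
  rw [show (2 * π * Complex.I * x : ℂ) = x * (2 * π * Complex.I) by ring,
    mul_left_inj' Complex.two_pi_I_ne_zero]
  norm_cast

/-- A complete exponential sum with a nonintegral frequency vanishes. -/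
lemma sum_unitExp_eq_zero {M : ℕ} {x : ℝ} (hM : ∃ m : ℤ, M * x = m)
    (hx : ¬ ∃ m : ℤ, x = m) : ∑ n ∈ range M, unitExp (n * x) = 0 := by
  simp only [unitExp_nat_mul]
  have h1 : unitExp x ≠ 1 := fun h => hx ((unitExp_eq_one_iff x).1 h)
  rw [geom_sum_eq h1, ← unitExp_nat_mul, (unitExp_eq_one_iff _).2 hM]
  simp

/-- The sign pattern of the factors of `z ^ k * conj z ^ k`. -/
def conjSign (k : ℕ) : Fin k ⊕ Fin k → ℤ := Sum.elim (fun _ => 1) (fun _ => -1)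

/-- Expansion of an even power of an exponential sum. -/
lemma exists_expansion_norm_pow {α : Type*} (k : ℕ) (A : Finset α) (g : α → ℂ) (θ : α → ℝ) :
    ∃ G : (Fin k ⊕ Fin k → α) → ℂ, (∀ c, ‖G c‖ = ∏ i, ‖g (c i)‖) ∧
      ∀ n : ℕ, ((‖∑ a ∈ A, g a * unitExp (n * θ a)‖ ^ (2 * k) : ℝ) : ℂ) =
        ∑ c ∈ Fintype.piFinset fun _ => A,
          G c * unitExp (n * ∑ i, conjSign k i * θ (c i)) := by
  refine ⟨fun c => ∏ i, Sum.elim (fun _ => g (c i)) (fun _ => conj (g (c i))) i, ?_, ?_⟩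
  · intro c
    rw [norm_prod]
    refine Finset.prod_congr rfl fun i _ => ?_
    rcases i with i | i <;> simp
  · intro n
    set z := ∑ a ∈ A, g a * unitExp (n * θ a) with hz
    have h1 : ((‖z‖ ^ (2 * k) : ℝ) : ℂ) =
        ∏ i : Fin k ⊕ Fin k, ∑ a ∈ A, Sum.elim (fun _ => g a) (fun _ => conj (g a)) i *
          unitExp (n * (conjSign k i * θ a)) := by
      have h2 : ∑ a ∈ A, conj (g a) * unitExp (n * (-1 * θ a)) = conj z := by
        rw [hz, map_sum]
        refine Finset.sum_congr rfl fun a _ => ?_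
        rw [map_mul, conj_unitExp]
        congr 2
        ring
      rw [Fintype.prod_sum_type]
      simp only [Sum.elim_inl, Sum.elim_inr, conjSign, Int.cast_one, Int.cast_neg, one_mul,
        Finset.prod_const, Finset.card_univ, Fintype.card_fin] at h2 ⊢
      rw [h2, ← hz, pow_mul, ← mul_pow, Complex.mul_conj, Complex.normSq_eq_norm_sq]
      push_cast
      rfl
    rw [h1, Finset.prod_univ_sum]
    refine Finset.sum_congr rfl fun c _ => ?_
    rw [Finset.prod_mul_distrib, Finset.mul_sum, unitExp_sum]

lemma prod_le_sum_prod_rpow {ι : Type*} [Fintype ι] [DecidableEq ι] {m : ℕ} (hm : 0 < m)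
    (hι : Fintype.card ι = m + 1) (h : ι → ℝ) (h0 : ∀ i, 0 ≤ h i) :
    ∏ i, h i ≤ ∑ i, (1 / (m + 1) : ℝ) *
      ∏ j : {j // j ≠ i}, h j.1 ^ ((m + 1 : ℝ) / m) := by
  have hm' : (0 : ℝ) < m := by exact_mod_cast hm
  have key := Real.geom_mean_le_arith_mean_weighted Finset.univ
    (fun _ : ι => (1 / (m + 1) : ℝ)) (fun i : ι => ∏ j : {j // j ≠ i}, h j.1 ^ ((m + 1 : ℝ) / m))
    (fun _ _ => by positivity)
    (by simp [hι]; field_simp)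
    (fun i _ => Finset.prod_nonneg fun j _ => Real.rpow_nonneg (h0 _) _)
  refine le_trans (le_of_eq ?_) key
  have h1 : ∀ i, (∏ j : {j // j ≠ i}, h j.1 ^ ((m + 1 : ℝ) / m)) ^ (1 / (m + 1) : ℝ) =
      ∏ j ∈ univ.erase i, h j ^ (1 / m : ℝ) := by
    intro i
    rw [← Real.finsetProd_rpow _ _ (fun j _ => Real.rpow_nonneg (h0 _) _)]
    rw [Finset.prod_subtype (univ.erase i) (p := fun j => j ≠ i) (by simp)]
    refine Finset.prod_congr rfl fun j _ => ?_
    rw [← Real.rpow_mul (h0 _)]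
    congr 1
    field_simp
  simp only [h1]
  rw [Finset.prod_comm' (t' := univ) (s' := fun j => univ.erase j) (by simp [eq_comm])]
  refine Finset.prod_congr rfl fun j _ => ?_
  rw [Finset.prod_const, Finset.card_erase_of_mem (mem_univ _), Finset.card_univ, hι,
    Nat.add_sub_cancel, ← Real.rpow_natCast, ← Real.rpow_mul (h0 _)]
  rw [one_div_mul_cancel hm'.ne', Real.rpow_one]

/-- The mean over a full period of an exponential with frequency in `p⁻¹ℤ`. -/
lemma expect_unitExp {M p : ℕ} (hM : 0 < M) (hp : 0 < p) (hpM : p ∣ M) (r : ℤ) :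
    𝔼 n ∈ range M, unitExp (n * (r / p)) = if (p : ℤ) ∣ r then 1 else 0 := by
  have hp' : (p : ℝ) ≠ 0 := by positivity
  split_ifs with h
  · obtain ⟨s, rfl⟩ := h
    have h1 : ∀ n : ℕ, unitExp (n * (((p * s : ℤ) : ℝ) / p)) = 1 := by
      intro n
      rw [unitExp_eq_one_iff]
      refine ⟨n * s, ?_⟩
      push_cast
      field_simp
    simp only [h1]
    exact Finset.expect_const (by simpa using hM.ne') _
  · rw [Finset.expect_eq_sum_div_card, sum_unitExp_eq_zero, zero_div]
    · obtain ⟨d, rfl⟩ := hpM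
      refine ⟨d * r, ?_⟩
      push_cast
      field_simp
    · rintro ⟨m, hm⟩
      rw [div_eq_iff hp'] at hm
      exact h ⟨m, by rw [mul_comm]; exact_mod_cast hm⟩

/-- The tuples satisfying a nondegenerate linear congruence, weighted by a product that omits one
coordinate. -/
lemma sum_filter_prod_erase_le {k p : ℕ} (i : Fin k ⊕ Fin k) (y : ℕ → ℝ) (hy : ∀ a, 0 ≤ y a) :
    ∑ c ∈ (Fintype.piFinset fun _ : Fin k ⊕ Fin k => Icc 1 (p - 1)) with
        (p : ℤ) ∣ ∑ i, conjSign k i * c i, ∏ j : {j // j ≠ i}, y (c j.1) ≤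
      (∑ a ∈ Icc 1 (p - 1), y a) ^ (2 * k - 1) := by
  have hcard : Fintype.card {j : Fin k ⊕ Fin k // j ≠ i} = 2 * k - 1 := by
    rw [Fintype.card_subtype_compl]
    simp
    omega
  have h1 : (∑ a ∈ Icc 1 (p - 1), y a) ^ (2 * k - 1) =
      ∑ d ∈ Fintype.piFinset fun _ : {j : Fin k ⊕ Fin k // j ≠ i} => Icc 1 (p - 1),
        ∏ j, y (d j) := by
    rw [← Finset.prod_univ_sum, Finset.prod_const, Finset.card_univ, hcard]
  rw [h1]
  set res : (Fin k ⊕ Fin k → ℕ) → ({j : Fin k ⊕ Fin k // j ≠ i} → ℕ) := fun c j => c j with hres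
  have hinj : Set.InjOn res ((Fintype.piFinset fun _ : Fin k ⊕ Fin k => Icc 1 (p - 1)).filter
      fun c => (p : ℤ) ∣ ∑ i, conjSign k i * c i) := by
    intro c hc c' hc' hcc
    simp only [coe_filter, Fintype.mem_piFinset, mem_Icc, Set.mem_ofPred_eq] at hc hc'
    have hne : ∀ j, j ≠ i → c j = c' j := fun j hj => congrFun hcc ⟨j, hj⟩
    have hdvd := dvd_sub hc.2 hc'.2
    rw [← Finset.sum_sub_distrib, Finset.sum_eq_single i
      (fun j _ hj => by rw [hne j hj, sub_self]) (by simp)] at hdvd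
    have hdvd' : (p : ℤ) ∣ c i - c' i := by
      rcases i with i | i
      · simpa [conjSign] using hdvd
      · rw [← dvd_neg]
        simpa [conjSign, sub_eq_neg_add, add_comm] using hdvd
    have hi : c i = c' i := by
      have h2 := hc.1 i
      have h3 := hc'.1 i
      have h4 := Int.eq_zero_of_abs_lt_dvd hdvd' (by rw [abs_lt]; omega)
      omega
    funext j
    by_cases hj : j = i
    · rw [hj, hi]
    · exact hne j hj
  calc _ = ∑ d ∈ ((Fintype.piFinset fun _ : Fin k ⊕ Fin k => Icc 1 (p - 1)).filter
        fun c => (p : ℤ) ∣ ∑ i, conjSign k i * c i).image res, ∏ j, y (d j) :=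
        (Finset.sum_image hinj).symm
    _ ≤ _ := by
        refine Finset.sum_le_sum_of_subset_of_nonneg ?_
          fun d _ _ => Finset.prod_nonneg fun j _ => hy _
        intro d hd
        obtain ⟨c, hc, rfl⟩ := Finset.mem_image.1 hd
        simp only [mem_filter, Fintype.mem_piFinset] at hc ⊢
        exact fun j => hc.1 j

/-- The Hausdorff-Young inequality on `ℤ/pℤ` for even exponents. -/
lemma expect_norm_pow_le {k M p : ℕ} (hk : 0 < k) (hM : 0 < M) (hp : 0 < p) (hpM : p ∣ M)
    (g : ℕ → ℂ) :
    𝔼 n ∈ range M, ‖∑ a ∈ Icc 1 (p - 1), g a * unitExp (n * (a / p))‖ ^ (2 * k) ≤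
      (∑ a ∈ Icc 1 (p - 1), ‖g a‖ ^ ((2 * k : ℝ) / (2 * k - 1))) ^ (2 * k - 1) := by
  obtain ⟨G, hG, hexp⟩ := exists_expansion_norm_pow k (Icc 1 (p - 1)) g fun a => a / p
  set S := Fintype.piFinset fun _ : Fin k ⊕ Fin k => Icc 1 (p - 1) with hS
  have hfreq : ∀ c : Fin k ⊕ Fin k → ℕ, ∑ i, (conjSign k i : ℝ) * ((c i : ℝ) / p) =
      ((∑ i, conjSign k i * c i : ℤ) : ℝ) / p := by
    intro c
    push_cast
    rw [Finset.sum_div]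
    exact Finset.sum_congr rfl fun i _ => by ring
  have h1 : ((𝔼 n ∈ range M, ‖∑ a ∈ Icc 1 (p - 1), g a * unitExp (n * (a / p))‖ ^ (2 * k) : ℝ)
      : ℂ) = ∑ c ∈ S with (p : ℤ) ∣ ∑ i, conjSign k i * c i, G c := by
    rw [Complex.ofReal_expect]
    simp only [hexp, hfreq]
    rw [Finset.expect_sum_comm, Finset.sum_filter]
    refine Finset.sum_congr rfl fun c _ => ?_
    rw [← Finset.mul_expect, expect_unitExp hM hp hpM]
    simp
  set y : ℕ → ℝ := fun a => ‖g a‖ ^ ((2 * k : ℝ) / (2 * k - 1)) with hy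
  have hy0 : ∀ a, 0 ≤ y a := fun a => Real.rpow_nonneg (norm_nonneg _) _
  have hk1 : ((2 * k - 1 : ℕ) : ℝ) = 2 * k - 1 := by
    rw [Nat.cast_sub (by omega)]
    push_cast
    rfl
  have hcast : ((2 * k - 1 : ℕ) : ℝ) + 1 = 2 * k := by rw [hk1]; ring
  have h2 : ∀ c : Fin k ⊕ Fin k → ℕ, ‖G c‖ ≤
      ∑ i, (1 / (2 * k) : ℝ) * ∏ j : {j // j ≠ i}, y (c j.1) := by
    intro c
    have := prod_le_sum_prod_rpow (ι := Fin k ⊕ Fin k) (m := 2 * k - 1) (by omega)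
      (by simp; omega) (fun i => ‖g (c i)‖) (fun i => norm_nonneg _)
    rw [hcast, hk1] at this
    rw [hG]
    exact this
  have h3 : ∀ x : ℝ, 0 ≤ x → x = ‖(x : ℂ)‖ := fun x hx => by
    rw [Complex.norm_real, Real.norm_of_nonneg hx]
  rw [h3 _ (Finset.expect_nonneg fun n _ => by positivity), h1]
  calc _ ≤ ∑ c ∈ S with (p : ℤ) ∣ ∑ i, conjSign k i * c i, ‖G c‖ := norm_sum_le _ _
    _ ≤ ∑ c ∈ S with (p : ℤ) ∣ ∑ i, conjSign k i * c i,
        ∑ i, (1 / (2 * k) : ℝ) * ∏ j : {j // j ≠ i}, y (c j.1) :=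
        Finset.sum_le_sum fun c _ => h2 c
    _ = ∑ i, (1 / (2 * k) : ℝ) * ∑ c ∈ S with (p : ℤ) ∣ ∑ i, conjSign k i * c i,
        ∏ j : {j // j ≠ i}, y (c j.1) := by
        rw [Finset.sum_comm]
        simp only [Finset.mul_sum]
    _ ≤ ∑ _i : Fin k ⊕ Fin k, (1 / (2 * k) : ℝ) *
        (∑ a ∈ Icc 1 (p - 1), y a) ^ (2 * k - 1) := by
        gcongr with i
        exact sum_filter_prod_erase_le i y hy0
    _ = _ := by
        have : (k : ℝ) ≠ 0 := by positivity
        simp only [sum_const, card_univ, Fintype.card_sum, Fintype.card_fin, nsmul_eq_mul]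
        push_cast
        field_simp
        ring

/-- A function on `{1, …, N}` is dominated by its mean over a long period `M` when it has no
small nonzero frequencies. -/
lemma sum_Icc_le_of_frequency_gap {N M J : ℕ} (hJ : 0 < J) (hM : 6 * N * J ≤ M) (hNM : N < M)
    (F : ℕ → ℝ) (hF : ∀ n, 0 ≤ F n)
    (hgap : ∀ l : ℤ, l ≠ 0 → |l| < J →
      ∑ n ∈ range M, unitExp (n * (l / M)) * (F n : ℂ) = 0) :
    ∑ n ∈ Icc 1 N, F n ≤ 4 / J * ∑ n ∈ range M, F n := by
  have hM0 : (0 : ℝ) < M := by exact_mod_cast (by omega : 0 < M)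
  have hJ0 : (0 : ℝ) < J := by exact_mod_cast hJ
  set w : ℕ → ℝ := fun n => ‖∑ j ∈ range J, unitExp (n * (j / M))‖ ^ 2 with hw
  have hwc : ∀ n, (w n : ℂ) = ∑ j ∈ range J, ∑ j' ∈ range J,
      unitExp (n * (((j - j' : ℤ) : ℝ) / M)) := by
    intro n
    rw [hw]
    simp only
    rw [← Complex.normSq_eq_norm_sq, ← Complex.mul_conj, map_sum, Finset.sum_mul_sum]
    refine Finset.sum_congr rfl fun j _ => Finset.sum_congr rfl fun j' _ => ?_
    rw [conj_unitExp, ← unitExp_add]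
    congr 1
    push_cast
    ring
  have hsum : ∑ n ∈ range M, w n * F n = J * ∑ n ∈ range M, F n := by
    have : ((∑ n ∈ range M, w n * F n : ℝ) : ℂ) = ((J * ∑ n ∈ range M, F n : ℝ) : ℂ) := by
      rw [Complex.ofReal_sum]
      simp only [Complex.ofReal_mul, hwc, Finset.sum_mul]
      rw [Finset.sum_comm]
      rw [Finset.sum_congr rfl fun j _ => Finset.sum_comm]
      have h1 : ∀ j ∈ range J, ∑ j' ∈ range J, ∑ n ∈ range M,
          unitExp (n * (((j - j' : ℤ) : ℝ) / M)) * (F n : ℂ) = ∑ n ∈ range M, (F n : ℂ) := by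
        intro j hj
        rw [Finset.sum_eq_single_of_mem j hj]
        · simp [unitExp_zero]
        · intro j' hj' hne
          rw [mem_range] at hj hj'
          exact hgap _ (by omega) (by rw [abs_lt]; omega)
      rw [Finset.sum_congr rfl h1]
      simp
    exact_mod_cast this
  have hlow : ∀ n ∈ Icc 1 N, (J : ℝ) ^ 2 / 4 ≤ w n := by
    intro n hn
    rw [mem_Icc] at hn
    have h1 : (J : ℝ) / 2 ≤ ‖∑ j ∈ range J, unitExp (n * (j / M))‖ := by
      refine le_trans ?_ (Complex.re_le_norm _)
      rw [Complex.re_sum]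
      have h2 : ∀ j ∈ range J, (1 / 2 : ℝ) ≤ (unitExp (n * (j / M))).re := by
        intro j hj
        rw [mem_range] at hj
        rw [unitExp_re, ← Real.cos_pi_div_three]
        have h3 : (n : ℝ) * (j / M) ≤ 1 / 6 := by
          rw [← mul_div_assoc, div_le_iff₀ hM0]
          have : 6 * (n * j) ≤ M := by
            calc 6 * (n * j) ≤ 6 * (N * J) := by gcongr; exact hn.2
              _ ≤ M := by rw [← mul_assoc]; exact hM
          have : (6 * (n * j) : ℝ) ≤ M := by exact_mod_cast this
          linarith
        apply Real.cos_le_cos_of_nonneg_of_le_pi (by positivity) (by linarith [Real.pi_pos])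
        nlinarith [Real.pi_pos]
      have := Finset.card_nsmul_le_sum _ _ _ h2
      simp only [card_range, nsmul_eq_mul] at this
      linarith
    calc (J : ℝ) ^ 2 / 4 = (J / 2) ^ 2 := by ring
      _ ≤ w n := pow_le_pow_left₀ (by positivity) h1 2
  have h5 : (J : ℝ) ^ 2 / 4 * ∑ n ∈ Icc 1 N, F n ≤ J * ∑ n ∈ range M, F n := by
    rw [← hsum, Finset.mul_sum]
    calc _ ≤ ∑ n ∈ Icc 1 N, w n * F n :=
          Finset.sum_le_sum fun n hn => mul_le_mul_of_nonneg_right (hlow n hn) (hF n)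
      _ ≤ _ := Finset.sum_le_sum_of_subset_of_nonneg
          (fun n hn => by rw [mem_Icc] at hn; rw [mem_range]; omega)
          fun n _ _ => mul_nonneg (by positivity) (hF n)
  have h6 : ∑ n ∈ Icc 1 N, F n = 4 / (J : ℝ) ^ 2 * ((J : ℝ) ^ 2 / 4 * ∑ n ∈ Icc 1 N, F n) := by
    field_simp
  rw [h6]
  calc _ ≤ 4 / (J : ℝ) ^ 2 * (J * ∑ n ∈ range M, F n) := by gcongr
    _ = _ := by field_simp

lemma add_pow_le_taylor (m : ℕ) {a b t : ℝ} (hb : b ^ 2 ≤ a) (ht : t ^ 2 ≤ 9 * a * b ^ 2)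
    (h3 : t ≤ 3 * a) (h0 : 0 ≤ a + t) :
    (a + t) ^ (m + 1) ≤ a ^ (m + 1) + (m + 1) * a ^ m * t + 9 * m * 4 ^ m * (a ^ m * b ^ 2) := by
  have ha : 0 ≤ a := (sq_nonneg b).trans hb
  induction m with
  | zero => simp
  | succ m ih =>
    have hm : (m + 1 : ℝ) ≤ 4 ^ (m + 1) := by
      have : m + 1 ≤ 4 ^ (m + 1) := (Nat.lt_pow_self (by norm_num)).le
      exact_mod_cast this
    have hX : 0 ≤ a ^ (m + 1) * b ^ 2 := by positivity
    have hs : (m + 1 : ℝ) * a ^ m * t ^ 2 ≤ 9 * 4 ^ (m + 1) * (a ^ (m + 1) * b ^ 2) := by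
      calc (m + 1 : ℝ) * a ^ m * t ^ 2 ≤ (m + 1 : ℝ) * a ^ m * (9 * a * b ^ 2) := by gcongr
        _ = (m + 1 : ℝ) * (9 * (a ^ (m + 1) * b ^ 2)) := by ring
        _ ≤ 4 ^ (m + 1) * (9 * (a ^ (m + 1) * b ^ 2)) := by gcongr
        _ = _ := by ring
    have hr : 9 * m * 4 ^ m * (a ^ m * b ^ 2) * (a + t) ≤
        9 * m * 4 ^ (m + 1) * (a ^ (m + 1) * b ^ 2) := by
      calc _ ≤ 9 * m * 4 ^ m * (a ^ m * b ^ 2) * (4 * a) := by gcongr; linarith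
        _ = _ := by ring
    calc (a + t) ^ (m + 1 + 1) = (a + t) ^ (m + 1) * (a + t) := pow_succ _ _
      _ ≤ (a ^ (m + 1) + (m + 1) * a ^ m * t + 9 * m * 4 ^ m * (a ^ m * b ^ 2)) * (a + t) := by
          gcongr
      _ = a ^ (m + 1 + 1) + (m + 1 + 1) * a ^ (m + 1) * t + (m + 1) * a ^ m * t ^ 2 +
          9 * m * 4 ^ m * (a ^ m * b ^ 2) * (a + t) := by ring
      _ ≤ a ^ (m + 1 + 1) + (m + 1 + 1) * a ^ (m + 1) * t +
          9 * 4 ^ (m + 1) * (a ^ (m + 1) * b ^ 2) +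
          9 * m * 4 ^ (m + 1) * (a ^ (m + 1) * b ^ 2) := by gcongr
      _ = _ := by push_cast; ring

lemma norm_add_pow_le_taylor (m : ℕ) : ∃ C : ℝ, 0 ≤ C ∧ ∀ z w : ℂ,
    ‖z + w‖ ^ (2 * (m + 1)) ≤ ‖z‖ ^ (2 * (m + 1)) +
      2 * (m + 1) * ‖z‖ ^ (2 * m) * (z.re * w.re + z.im * w.im) +
      C * (‖z‖ ^ (2 * m) * ‖w‖ ^ 2 + ‖w‖ ^ (2 * (m + 1))) := by
  refine ⟨4 ^ (m + 1) + 2 * (m + 1) + 9 * m * 4 ^ m + (m + 1), by positivity, fun z w => ?_⟩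
  set a := ‖z‖ ^ 2 with ha
  set b := ‖w‖ with hb
  set r := z.re * w.re + z.im * w.im with hr
  have hb0 : 0 ≤ b := norm_nonneg _
  have ha0 : 0 ≤ a := by positivity
  have hsq : ‖z + w‖ ^ 2 = a + (2 * r + b ^ 2) := by
    rw [ha, hb, hr, ← Complex.normSq_eq_norm_sq, ← Complex.normSq_eq_norm_sq,
      ← Complex.normSq_eq_norm_sq, Complex.normSq_apply, Complex.normSq_apply,
      Complex.normSq_apply, Complex.add_re, Complex.add_im]
    ring
  have hcs : r ^ 2 ≤ a * b ^ 2 := by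
    rw [ha, hb, hr, ← Complex.normSq_eq_norm_sq, ← Complex.normSq_eq_norm_sq,
      Complex.normSq_apply, Complex.normSq_apply]
    nlinarith [sq_nonneg (z.re * w.im - z.im * w.re)]
  have hrabs : |r| ≤ ‖z‖ * b := by
    apply abs_le_of_sq_le_sq _ (by positivity)
    rw [mul_pow]
    exact hcs
  obtain ⟨hr1, hr2⟩ := abs_le.1 hrabs
  simp only [pow_mul, ← ha, hsq]
  have hY : 0 ≤ a ^ m * b ^ 2 := by positivity
  have hZ : 0 ≤ (b ^ 2) ^ (m + 1) := by positivity
  rcases le_or_gt (b ^ 2) a with h | h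
  · have hbz : b ≤ ‖z‖ := by
      rw [ha] at h
      exact le_of_sq_le_sq h (norm_nonneg _)
    have hzb : ‖z‖ * b ≤ a := by rw [ha, sq]; gcongr
    have hbzb : b ^ 2 ≤ ‖z‖ * b := by rw [sq]; gcongr
    have ht : (2 * r + b ^ 2) ^ 2 ≤ 9 * a * b ^ 2 := by
      rw [show 9 * a * b ^ 2 = (3 * (‖z‖ * b)) ^ 2 by rw [ha]; ring]
      apply sq_le_sq'
      · nlinarith [sq_nonneg b]
      · linarith
    have := add_pow_le_taylor m h ht (by linarith) (by rw [← hsq]; positivity)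
    refine this.trans ?_
    have e : (a ^ (m + 1) + (m + 1) * a ^ m * (2 * r + b ^ 2) + 9 * m * 4 ^ m * (a ^ m * b ^ 2)) =
      a ^ (m + 1) + 2 * (m + 1) * a ^ m * r + (9 * m * 4 ^ m + (m + 1)) * (a ^ m * b ^ 2) := by
      ring
    rw [e]
    have h1 : (9 * m * 4 ^ m + (m + 1) : ℝ) ≤
        4 ^ (m + 1) + 2 * (m + 1) + 9 * m * 4 ^ m + (m + 1) := by
      have : (0 : ℝ) ≤ 4 ^ (m + 1) + 2 * (m + 1) := by positivity
      linarith
    gcongr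
    linarith
  · have hzb : ‖z‖ ≤ b := by
      rw [ha] at h
      exact (lt_of_pow_lt_pow_left₀ 2 hb0 h).le
    have h1 : (a + (2 * r + b ^ 2)) ^ (m + 1) ≤ 4 ^ (m + 1) * (b ^ 2) ^ (m + 1) := by
      rw [← mul_pow]
      apply pow_le_pow_left₀ (by rw [← hsq]; positivity)
      nlinarith
    have hr3 : -(b ^ 2) ≤ r := by nlinarith
    have h2 : -((b ^ 2) ^ (m + 1)) ≤ a ^ m * r := by
      have h4 : a ^ m ≤ (b ^ 2) ^ m := pow_le_pow_left₀ ha0 h.le m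
      calc -((b ^ 2) ^ (m + 1)) = -((b ^ 2) ^ m * b ^ 2) := by ring
        _ ≤ -(a ^ m * b ^ 2) := by gcongr
        _ = a ^ m * (-(b ^ 2)) := by ring
        _ ≤ _ := by gcongr
    have h3 : -(2 * (m + 1) * (b ^ 2) ^ (m + 1)) ≤ 2 * (m + 1) * a ^ m * r := by
      have := mul_le_mul_of_nonneg_left h2 (by positivity : (0 : ℝ) ≤ 2 * (m + 1))
      linarith
    have h5 : (4 ^ (m + 1) + 2 * (m + 1) : ℝ) * (b ^ 2) ^ (m + 1) ≤
        (4 ^ (m + 1) + 2 * (m + 1) + 9 * m * 4 ^ m + (m + 1)) *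
          (a ^ m * b ^ 2 + (b ^ 2) ^ (m + 1)) := by
      apply mul_le_mul _ (by linarith) hZ (by positivity)
      have : (0 : ℝ) ≤ 9 * m * 4 ^ m + (m + 1) := by positivity
      linarith
    have h6 : 0 ≤ a ^ (m + 1) := by positivity
    linarith

lemma sum_range_mul_of_periodic {a : ℕ} {f : ℕ → ℝ} (hf : Function.Periodic f a) (c : ℕ) :
    ∑ n ∈ range (a * c), f n = c * ∑ n ∈ range a, f n := by
  induction c with
  | zero => simp
  | succ c ih =>
    rw [Nat.mul_succ, Finset.sum_range_add, ih]
    have : ∀ n, f (a * c + n) = f n := fun n => by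
      rw [add_comm, mul_comm]
      exact hf.nat_mul c n
    simp only [this]
    push_cast
    ring

lemma sum_range_mul_of_periodic_of_coprime {a b : ℕ} (ha : 0 < a) (hb : 0 < b)
    (hab : a.Coprime b) {f g : ℕ → ℝ} (hf : Function.Periodic f a) (hg : Function.Periodic g b) :
    ∑ n ∈ range (a * b), f n * g n = (∑ n ∈ range a, f n) * ∑ n ∈ range b, g n := by
  rw [Finset.sum_mul_sum, ← Finset.sum_product']
  have hmap : ∀ n ∈ range (a * b), (n % a, n % b) ∈ range a ×ˢ range b := fun n _ => by
    simp [Nat.mod_lt, ha, hb]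
  have hinj : ∀ n ∈ range (a * b), ∀ n' ∈ range (a * b),
      (n % a, n % b) = (n' % a, n' % b) → n = n' := by
    intro n hn n' hn' h
    rw [Prod.mk.injEq] at h
    rw [mem_range] at hn hn'
    exact Nat.ModEq.eq_of_lt_of_lt ((Nat.modEq_and_modEq_iff_modEq_mul hab).1 h) hn hn'
  refine Finset.sum_bij (fun n _ => (n % a, n % b)) hmap
    (fun n hn n' hn' h => hinj n hn n' hn' h) ?_ ?_
  · intro x hx
    obtain ⟨n, hn, h⟩ := Finset.surj_on_of_inj_on_of_card_le (fun n _ => (n % a, n % b)) hmap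
      (fun n n' hn hn' h => hinj n hn n' hn' h) (by simp) x hx
    exact ⟨n, hn, h.symm⟩
  · intro n _
    simp only [hf.map_mod_nat, hg.map_mod_nat]

/-- Functions with coprime periods are independent. -/
lemma expect_mul_of_periodic {M a b : ℕ} (hM : 0 < M) (hab : a.Coprime b) (habM : a * b ∣ M)
    {f g : ℕ → ℝ} (hf : Function.Periodic f a) (hg : Function.Periodic g b) :
    𝔼 n ∈ range M, f n * g n = (𝔼 n ∈ range M, f n) * 𝔼 n ∈ range M, g n := by
  obtain ⟨c, rfl⟩ := habM
  have ha : 0 < a := Nat.pos_of_ne_zero (by rintro rfl; simp at hM)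
  have hb : 0 < b := Nat.pos_of_ne_zero (by rintro rfl; simp at hM)
  have hc : 0 < c := Nat.pos_of_ne_zero (by rintro rfl; simp at hM)
  have hfg : Function.Periodic (fun n => f n * g n) (a * b) := by
    intro n
    have h1 : f (n + a * b) = f n := by
      rw [mul_comm a b]
      exact hf.nat_mul b n
    have h2 : g (n + a * b) = g n := hg.nat_mul a n
    simp only [h1, h2]
  simp only [Finset.expect_eq_sum_div_card, card_range]
  rw [sum_range_mul_of_periodic hfg, sum_range_mul_of_periodic_of_coprime ha hb hab hf hg,
    show ∑ n ∈ range (a * b * c), f n = ((b * c : ℕ) : ℝ) * ∑ n ∈ range a, f n by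
      rw [mul_assoc, sum_range_mul_of_periodic hf],
    show ∑ n ∈ range (a * b * c), g n = ((a * c : ℕ) : ℝ) * ∑ n ∈ range b, g n by
      rw [mul_comm a b, mul_assoc, sum_range_mul_of_periodic hg]]
  push_cast
  field_simp

/-- The functions `X p`, `p ∈ s`, have mean zero over `{0, …, M - 1}`, and each of them is
independent of every partial sum of the others. -/
structure CenteredIndep (M : ℕ) (s : Finset ℕ) (X : ℕ → ℕ → ℂ) : Prop where
  pos : 0 < M
  re_eq_zero : ∀ p ∈ s, 𝔼 n ∈ range M, (X p n).re = 0
  im_eq_zero : ∀ p ∈ s, 𝔼 n ∈ range M, (X p n).im = 0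
  indep : ∀ t ⊆ s, ∀ p ∈ s, p ∉ t → ∀ u v : ℂ → ℝ,
    𝔼 n ∈ range M, u (∑ q ∈ t, X q n) * v (X p n) =
      (𝔼 n ∈ range M, u (∑ q ∈ t, X q n)) * 𝔼 n ∈ range M, v (X p n)

lemma CenteredIndep.mono {M : ℕ} {s t : Finset ℕ} {X : ℕ → ℕ → ℂ} (h : CenteredIndep M s X)
    (hts : t ⊆ s) : CenteredIndep M t X where
  pos := h.pos
  re_eq_zero p hp := h.re_eq_zero p (hts hp)
  im_eq_zero p hp := h.im_eq_zero p (hts hp)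
  indep r hr p hp := h.indep r (hr.trans hts) p (hts hp)

lemma expect_norm_sum_pow_succ_le (m : ℕ) : ∃ C : ℝ, 0 ≤ C ∧
    ∀ (M : ℕ) (s : Finset ℕ) (X : ℕ → ℕ → ℂ), CenteredIndep M s X → ∀ K : ℝ,
      (∀ t ⊆ s, 𝔼 n ∈ range M, ‖∑ p ∈ t, X p n‖ ^ (2 * m) ≤ K) →
      𝔼 n ∈ range M, ‖∑ p ∈ s, X p n‖ ^ (2 * (m + 1)) ≤
        C * ∑ p ∈ s, (K * 𝔼 n ∈ range M, ‖X p n‖ ^ 2 +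
          𝔼 n ∈ range M, ‖X p n‖ ^ (2 * (m + 1))) := by
  obtain ⟨C, hC, hineq⟩ := norm_add_pow_le_taylor m
  refine ⟨C, hC, fun M s X => ?_⟩
  induction s using Finset.induction_on with
  | empty => intro _ K _; simp
  | insert p s hps ih =>
    intro h K hK
    have hsub : s ⊆ insert p s := Finset.subset_insert p s
    have ih' := ih (h.mono hsub) K fun t ht => hK t (ht.trans hsub)
    have hp : p ∈ insert p s := Finset.mem_insert_self p s
    have hre := h.indep s hsub p hp hps (fun z => ‖z‖ ^ (2 * m) * z.re) Complex.re
    have him := h.indep s hsub p hp hps (fun z => ‖z‖ ^ (2 * m) * z.im) Complex.im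
    have hsq := h.indep s hsub p hp hps (fun z => ‖z‖ ^ (2 * m)) (fun z => ‖z‖ ^ 2)
    rw [h.re_eq_zero p hp, mul_zero] at hre
    rw [h.im_eq_zero p hp, mul_zero] at him
    rw [Finset.sum_insert hps]
    have hV : 0 ≤ 𝔼 n ∈ range M, ‖X p n‖ ^ 2 := Finset.expect_nonneg fun n _ => by positivity
    calc 𝔼 n ∈ range M, ‖∑ q ∈ insert p s, X q n‖ ^ (2 * (m + 1))
        ≤ 𝔼 n ∈ range M, (‖∑ q ∈ s, X q n‖ ^ (2 * (m + 1)) +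
          2 * (m + 1) * (‖∑ q ∈ s, X q n‖ ^ (2 * m) * (∑ q ∈ s, X q n).re * (X p n).re +
            ‖∑ q ∈ s, X q n‖ ^ (2 * m) * (∑ q ∈ s, X q n).im * (X p n).im) +
          C * (‖∑ q ∈ s, X q n‖ ^ (2 * m) * ‖X p n‖ ^ 2 + ‖X p n‖ ^ (2 * (m + 1)))) := by
          refine Finset.expect_le_expect fun n _ => ?_
          rw [Finset.sum_insert hps, add_comm (X p n)]
          refine (hineq _ _).trans (le_of_eq ?_)
          ring
      _ = 𝔼 n ∈ range M, ‖∑ q ∈ s, X q n‖ ^ (2 * (m + 1)) +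
          C * ((𝔼 n ∈ range M, ‖∑ q ∈ s, X q n‖ ^ (2 * m)) * 𝔼 n ∈ range M, ‖X p n‖ ^ 2 +
            𝔼 n ∈ range M, ‖X p n‖ ^ (2 * (m + 1))) := by
          rw [Finset.expect_add_distrib, Finset.expect_add_distrib, ← Finset.mul_expect,
            ← Finset.mul_expect, Finset.expect_add_distrib, Finset.expect_add_distrib, hre, him,
            hsq]
          ring
      _ ≤ _ := by
          have := mul_le_mul_of_nonneg_right (hK s hsub) hV
          have := mul_le_mul_of_nonneg_left this hC
          linarith

lemma pow_mul_le_pow_add_mul_pow (m : ℕ) {x V : ℝ} (hx : 0 ≤ x) (hV : 0 ≤ V) :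
    x ^ (m + 1) * V ≤ x ^ (m + 2) + x * V ^ (m + 1) := by
  rcases le_total V x with h | h
  · have : x ^ (m + 1) * V ≤ x ^ (m + 1) * x := by gcongr
    have : 0 ≤ x * V ^ (m + 1) := by positivity
    rw [pow_succ x (m + 1)]
    linarith
  · have : x * x ^ m * V ≤ x * V ^ m * V := by gcongr
    have : 0 ≤ x ^ (m + 2) := by positivity
    rw [pow_succ' x m, pow_succ V m, ← mul_assoc]
    linarith

/-- Rosenthal's inequality for even exponents. -/
lemma expect_norm_sum_pow_le (m : ℕ) : ∃ C : ℝ, 0 ≤ C ∧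
    ∀ (M : ℕ) (s : Finset ℕ) (X : ℕ → ℕ → ℂ), CenteredIndep M s X →
      𝔼 n ∈ range M, ‖∑ p ∈ s, X p n‖ ^ (2 * (m + 1)) ≤
        C * (∑ p ∈ s, 𝔼 n ∈ range M, ‖X p n‖ ^ (2 * (m + 1)) +
          (∑ p ∈ s, 𝔼 n ∈ range M, ‖X p n‖ ^ 2) ^ (m + 1)) := by
  induction m with
  | zero =>
    obtain ⟨C, hC, h⟩ := expect_norm_sum_pow_succ_le 0
    refine ⟨C, hC, fun M s X hX => (h M s X hX 1 fun t _ => ?_).trans (le_of_eq ?_)⟩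
    · have : (range M).Nonempty := by simpa using hX.pos.ne'
      simp [Finset.expect_const this]
    · simp [Finset.sum_add_distrib]
  | succ m ih =>
    obtain ⟨C, hC, h⟩ := ih
    obtain ⟨C₁, hC₁, h₁⟩ := expect_norm_sum_pow_succ_le (m + 1)
    refine ⟨C₁ * (2 * C + 1), by positivity, fun M s X hX => ?_⟩
    set V := ∑ p ∈ s, 𝔼 n ∈ range M, ‖X p n‖ ^ 2 with hVdef
    set A := ∑ p ∈ s, 𝔼 n ∈ range M, ‖X p n‖ ^ (2 * (m + 1)) with hA
    set A' := ∑ p ∈ s, 𝔼 n ∈ range M, ‖X p n‖ ^ (2 * (m + 1 + 1)) with hA'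
    have he : ∀ (j p : ℕ), 0 ≤ 𝔼 n ∈ range M, ‖X p n‖ ^ j :=
      fun j p => Finset.expect_nonneg fun n _ => by positivity
    have hV : 0 ≤ V := Finset.sum_nonneg fun p _ => he 2 p
    have hA'0 : 0 ≤ A' := Finset.sum_nonneg fun p _ => he _ p
    have hAV : A * V ≤ A' + V ^ (m + 2) := by
      rw [hA, Finset.sum_mul, pow_succ' V (m + 1), hA', hVdef, Finset.sum_mul, ← hVdef,
        ← Finset.sum_add_distrib]
      refine Finset.sum_le_sum fun p _ => ?_
      rw [Finset.expect_mul, Finset.expect_mul, ← Finset.expect_add_distrib]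
      refine Finset.expect_le_expect fun n _ => ?_
      rw [pow_mul, pow_mul]
      exact pow_mul_le_pow_add_mul_pow m (by positivity) hV
    have hK := h₁ M s X hX (C * (A + V ^ (m + 1))) fun t ht => by
      refine (h M t X (hX.mono ht)).trans ?_
      have hAt : ∑ p ∈ t, 𝔼 n ∈ range M, ‖X p n‖ ^ (2 * (m + 1)) ≤ A :=
        Finset.sum_le_sum_of_subset_of_nonneg ht fun p _ _ => he _ p
      have hVt : ∑ p ∈ t, 𝔼 n ∈ range M, ‖X p n‖ ^ 2 ≤ V :=
        Finset.sum_le_sum_of_subset_of_nonneg ht fun p _ _ => he _ p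
      have hVt0 : 0 ≤ ∑ p ∈ t, 𝔼 n ∈ range M, ‖X p n‖ ^ 2 := Finset.sum_nonneg fun p _ => he _ p
      gcongr
    refine hK.trans ?_
    rw [Finset.sum_add_distrib, ← Finset.mul_sum, ← hVdef, ← hA', mul_assoc C₁]
    have h2 := mul_le_mul_of_nonneg_left hAV hC
    have h3 : 0 ≤ C * A' := by positivity
    have h4 : 0 ≤ V ^ (m + 2) := by positivity
    refine mul_le_mul_of_nonneg_left ?_ hC₁
    have h5 : C * (A + V ^ (m + 1)) * V = C * (A * V) + C * V ^ (m + 2) := by ring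
    rw [h5]
    linarith

lemma periodic_sum_unitExp {p : ℕ} (hp : 0 < p) (A : Finset ℕ) (c : ℕ → ℂ) :
    Function.Periodic (fun n : ℕ => ∑ a ∈ A, c a * unitExp (n * (a / p))) p := by
  have hp' : (p : ℝ) ≠ 0 := by positivity
  intro n
  refine Finset.sum_congr rfl fun a _ => ?_
  have h : unitExp a = 1 := (unitExp_eq_one_iff _).2 ⟨a, by simp⟩
  rw [show ((n + p : ℕ) : ℝ) * (a / p) = n * (a / p) + a by push_cast; field_simp, unitExp_add, h,
    mul_one]

lemma centeredIndep_sum_unitExp {M : ℕ} {s : Finset ℕ} (hM : 0 < M)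
    (hs : ∀ p ∈ s, p.Prime) (hsM : ∏ p ∈ s, p ∣ M) (g : ℕ → ℕ → ℂ) :
    CenteredIndep M s fun p n => ∑ a ∈ Icc 1 (p - 1), g p a * unitExp (n * (a / p)) := by
  have hmean : ∀ p ∈ s,
      𝔼 n ∈ range M, ∑ a ∈ Icc 1 (p - 1), g p a * unitExp (n * (a / p)) = 0 := by
    intro p hp
    rw [Finset.expect_sum_comm]
    refine Finset.sum_eq_zero fun a ha => ?_
    have := expect_unitExp hM (hs p hp).pos ((Finset.dvd_prod_of_mem _ hp).trans hsM) a
    rw [Int.cast_natCast] at this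
    rw [← Finset.mul_expect, this, if_neg, mul_zero]
    rw [Int.natCast_dvd_natCast]
    rw [mem_Icc] at ha
    exact fun h => absurd (Nat.le_of_dvd (by omega) h) (by omega)
  refine ⟨hM, fun p hp => ?_, fun p hp => ?_, ?_⟩
  · have := congrArg Complex.re (hmean p hp)
    simpa [Finset.expect_eq_sum_div_card, ← Complex.ofReal_natCast, hM.ne'] using this
  · have := congrArg Complex.im (hmean p hp)
    simpa [Finset.expect_eq_sum_div_card, ← Complex.ofReal_natCast, hM.ne'] using this
  · intro t ht p hp hpt u v
    have hcop : (∏ q ∈ t, q).Coprime p := Nat.Coprime.prod_left fun q hq =>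
      (Nat.coprime_primes (hs q (ht hq)) (hs p hp)).2 fun h => hpt (h ▸ hq)
    have hdvd : (∏ q ∈ t, q) * p ∣ M := by
      rw [mul_comm, ← Finset.prod_insert (f := fun q => q) hpt]
      exact (Finset.prod_dvd_prod_of_subset _ _ _ (Finset.insert_subset hp ht)).trans hsM
    refine expect_mul_of_periodic
      (f := fun n => u (∑ q ∈ t, ∑ a ∈ Icc 1 (q - 1), g q a * unitExp (n * (a / q))))
      (g := fun n => v (∑ a ∈ Icc 1 (p - 1), g p a * unitExp (n * (a / p)))) hM hcop hdvd ?_ ?_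
    · intro n
      refine congrArg u (Finset.sum_congr rfl fun q hq => ?_)
      obtain ⟨d, hd⟩ := Finset.dvd_prod_of_mem (fun q => q) hq
      rw [hd, mul_comm q d]
      exact (periodic_sum_unitExp (hs q (ht hq)).pos _ (g q)).nat_mul d n
    · intro n
      exact congrArg v (periodic_sum_unitExp (hs p hp).pos _ (g p) n)

lemma sum_unitExp_mul_norm_pow_eq_zero {k B Q D M : ℕ} {s : Finset ℕ}
    (hs : ∀ p ∈ s, 0 < p ∧ p ≤ B) (hsQ : ∀ c : Fin k ⊕ Fin k → ℕ, (∀ i, c i ∈ s) → ∏ i, c i ∣ Q)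
    (hQ : 0 < Q) (hD : B ^ (2 * k) ≤ D) (hD0 : 0 < D) (hM : M = 6 * D * Q) (g : ℕ → ℕ → ℂ)
    {l : ℤ} (hl : l ≠ 0) (hlQ : |l| < Q) :
    ∑ n ∈ range M, unitExp (n * (l / M)) *
      ((‖∑ p ∈ s, ∑ a ∈ Icc 1 (p - 1), g p a * unitExp (n * (a / p))‖ ^ (2 * k) : ℝ) : ℂ) = 0 := by
  obtain ⟨G, -, hexp⟩ := exists_expansion_norm_pow k (s.sigma fun p => Icc 1 (p - 1))
    (fun x => g x.1 x.2) fun x => x.2 / x.1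
  simp only [Finset.sum_sigma] at hexp
  simp only [hexp]
  rw [Finset.sum_congr rfl fun n _ => Finset.mul_sum _ _ _, Finset.sum_comm]
  refine Finset.sum_eq_zero fun c hc => ?_
  simp only [Fintype.mem_piFinset, mem_sigma] at hc
  set q : ℕ := ∏ i, (c i).1 with hq
  have hq0 : 0 < q := Finset.prod_pos fun i _ => (hs _ (hc i).1).1
  have hqQ : q ∣ Q := hsQ (fun i => (c i).1) fun i => (hc i).1
  have hqD : q ≤ D := by
    refine le_trans ?_ hD
    calc q ≤ ∏ _i : Fin k ⊕ Fin k, B :=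
          Finset.prod_le_prod' fun i _ => (hs _ (hc i).1).2
      _ = B ^ (2 * k) := by simp [two_mul]
  have hint : ∃ r : ℤ, (q : ℝ) * ∑ i, conjSign k i * (((c i).2 : ℝ) / (c i).1) = r := by
    have h1 : ∀ i, ∃ d : ℕ, q = (c i).1 * d := fun i =>
      Finset.dvd_prod_of_mem (fun i => (c i).1) (mem_univ i)
    choose d hd using h1
    refine ⟨∑ i, conjSign k i * ((c i).2 * d i), ?_⟩
    rw [Finset.mul_sum]
    push_cast
    refine Finset.sum_congr rfl fun i _ => ?_
    have : ((c i).1 : ℝ) ≠ 0 := by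
      have := (hs _ (hc i).1).1
      positivity
    rw [hd i]
    push_cast
    field_simp
  set θ : ℝ := ∑ i, conjSign k i * (((c i).2 : ℝ) / (c i).1) with hθ
  obtain ⟨r, hr⟩ := hint
  have hM0 : (0 : ℝ) < M := by rw [hM]; positivity
  have h2 : ∑ n ∈ range M, unitExp (n * (l / M + θ)) = 0 := by
    apply sum_unitExp_eq_zero
    · obtain ⟨e, he⟩ := hqQ
      refine ⟨l + 6 * D * e * r, ?_⟩
      have : (M : ℝ) * θ = 6 * D * e * (q * θ) := by rw [hM, he]; push_cast; ring
      rw [mul_add, this, hr, mul_div_cancel₀ _ hM0.ne']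
      push_cast
      ring
    · rintro ⟨x, hx⟩
      have h3 : (q : ℝ) * l = M * (q * x - r) := by
        rw [← hx, ← hr]
        field_simp
        ring
      have h4 : (q : ℤ) * l = M * (q * x - r) := by exact_mod_cast h3
      have h5 : |(q : ℤ) * l| < M := by
        rw [abs_mul, Nat.abs_cast, hM]
        push_cast
        have h7 : (q : ℤ) * |l| ≤ D * |l| := by gcongr
        have h8 : (D : ℤ) * |l| < D * Q := by gcongr
        have h9 : (0 : ℤ) < D * Q := by positivity
        linarith
      have h6 := Int.eq_zero_of_abs_lt_dvd ⟨_, h4⟩ h5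
      rcases mul_eq_zero.1 h6 with h | h
      · omega
      · exact hl h
  calc _ = ∑ n ∈ range M, G c * unitExp (n * (l / M + θ)) := by
        refine Finset.sum_congr rfl fun n _ => ?_
        rw [mul_add, unitExp_add]
        exact mul_left_comm _ _ _
    _ = 0 := by rw [← Finset.mul_sum, h2, mul_zero]

theorem large_sieve_variant_dual (k : ℕ) (hk : 0 < k) :
    ∃ C : ℝ, C > 0 ∧ ∀ N : ℕ, 1 ≤ N → ∀ P : ℝ, 1 ≤ P →
      ∀ g : ℕ → ℕ → ℂ,
        ∑ n ∈ Finset.Icc 1 N,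
            ‖∑ p ∈ primesUpTo P, ∑ a ∈ Finset.Icc 1 (p - 1),
                g p a * Complex.exp (2 * π * Complex.I * ((a : ℝ) * n / p))‖ ^ (2 * k) ≤
          C * ((N : ℝ) + P ^ (2 * k)) *
            ((∑ p ∈ primesUpTo P,
                (∑ a ∈ Finset.Icc 1 (p - 1),
                    ‖g p a‖ ^ ((2 * k : ℝ) / (2 * k - 1))) ^ (2 * k - 1)) +
              (∑ p ∈ primesUpTo P, ∑ a ∈ Finset.Icc 1 (p - 1), ‖g p a‖ ^ 2) ^ k) := by
  obtain ⟨C, hC, hros⟩ := expect_norm_sum_pow_le (k - 1)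
  simp only [Nat.sub_add_cancel hk] at hros
  refine ⟨24 * (C + 1), by positivity, fun N hN P hP g => ?_⟩
  set s := primesUpTo P with hs
  have hsp : ∀ p ∈ s, p.Prime := fun p hp => (Finset.mem_filter.1 hp).2
  have hsB : ∀ p ∈ s, p ≤ ⌊P⌋₊ := fun p hp =>
    Nat.lt_succ_iff.1 (Finset.mem_range.1 (Finset.mem_filter.1 hp).1)
  set B := ⌊P⌋₊ with hB
  set R := ∏ p ∈ s, p with hR
  have hR0 : 0 < R := Finset.prod_pos fun p hp => (hsp p hp).pos
  set Q := R ^ (2 * k) with hQ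
  have hQ0 : 0 < Q := by positivity
  have hRQ : R ∣ Q := dvd_pow_self R (by omega)
  set D := N + B ^ (2 * k) with hD
  set M := 6 * D * Q with hM
  have hD0 : 0 < D := by omega
  have hM0 : 0 < M := by positivity
  have hRM : R ∣ M := hRQ.mul_left _
  set X : ℕ → ℕ → ℂ := fun p n => ∑ a ∈ Icc 1 (p - 1), g p a * unitExp (n * (a / p)) with hX
  have hexp : ∀ p a n : ℕ, Complex.exp (2 * π * Complex.I * (((a : ℝ) : ℂ) * n / p)) =
      unitExp (n * (a / p)) := by
    intro p a n
    rw [unitExp]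
    congr 1
    push_cast
    ring
  simp only [hexp]
  have hDQ : N ≤ D * Q := (Nat.le_add_right N _).trans (Nat.le_mul_of_pos_right D hQ0)
  have hDQ0 : 0 < D * Q := by positivity
  have hMDQ : M = 6 * (D * Q) := by rw [hM, mul_assoc]
  have hsieve := sum_Icc_le_of_frequency_gap (N := N) (M := M) hQ0
    (by rw [hM]; gcongr; omega) (by omega)
    (fun n => ‖∑ p ∈ s, X p n‖ ^ (2 * k)) (fun n => by positivity)
    fun l hl hlQ => sum_unitExp_mul_norm_pow_eq_zero
      (fun p hp => ⟨(hsp p hp).pos, hsB p hp⟩)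
      (fun c hc => by
        calc ∏ i, c i ∣ ∏ _i : Fin k ⊕ Fin k, R :=
              Finset.prod_dvd_prod_of_dvd _ _ fun i _ => Finset.dvd_prod_of_mem _ (hc i)
          _ = Q := by simp [hQ, two_mul])
      hQ0 (by omega) hD0 hM g hl hlQ
  have hmean := hros M s X (centeredIndep_sum_unitExp hM0 hsp hRM g)
  have hdvd : ∀ p ∈ s, p ∣ M := fun p hp => (Finset.dvd_prod_of_mem _ hp).trans hRM
  set U := ∑ p ∈ s, (∑ a ∈ Icc 1 (p - 1), ‖g p a‖ ^ ((2 * k : ℝ) / (2 * k - 1))) ^ (2 * k - 1)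
    with hU
  set V := ∑ p ∈ s, ∑ a ∈ Icc 1 (p - 1), ‖g p a‖ ^ 2 with hV
  have hUle : ∑ p ∈ s, 𝔼 n ∈ range M, ‖X p n‖ ^ (2 * k) ≤ U :=
    Finset.sum_le_sum fun p hp => expect_norm_pow_le hk hM0 (hsp p hp).pos (hdvd p hp) (g p)
  have hVle : ∑ p ∈ s, 𝔼 n ∈ range M, ‖X p n‖ ^ 2 ≤ V := by
    refine Finset.sum_le_sum fun p hp => ?_
    have := expect_norm_pow_le one_pos hM0 (hsp p hp).pos (hdvd p hp) (g p)
    norm_num at this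
    exact this
  have hV0 : 0 ≤ ∑ p ∈ s, 𝔼 n ∈ range M, ‖X p n‖ ^ 2 :=
    Finset.sum_nonneg fun p _ => Finset.expect_nonneg fun n _ => by positivity
  have hU0 : 0 ≤ U := Finset.sum_nonneg fun p _ => by positivity
  have hVnn : 0 ≤ V := hV0.trans hVle
  have hDP : (D : ℝ) ≤ N + P ^ (2 * k) := by
    rw [hD]
    push_cast
    gcongr
    exact Nat.floor_le (by linarith)
  have hE : 𝔼 n ∈ range M, ‖∑ p ∈ s, X p n‖ ^ (2 * k) ≤ (C + 1) * (U + V ^ k) := by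
    refine hmean.trans ?_
    gcongr
    linarith
  calc _ ≤ 4 / (Q : ℝ) * ∑ n ∈ range M, ‖∑ p ∈ s, X p n‖ ^ (2 * k) := hsieve
    _ = 24 * D * 𝔼 n ∈ range M, ‖∑ p ∈ s, X p n‖ ^ (2 * k) := by
        rw [Finset.expect_eq_sum_div_card, card_range, hM]
        have : (Q : ℝ) ≠ 0 := by positivity
        have : (D : ℝ) ≠ 0 := by positivity
        push_cast
        field_simp
        ring
    _ ≤ 24 * (N + P ^ (2 * k)) * ((C + 1) * (U + V ^ k)) := by gcongr
    _ = _ := by ring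
end

section
/- (Sieving arithmetic progressions, with exceptional primes.) There exist constants c > 0, C > 0 and an integer N₀ such that the following holds for every N ≥ N₀ and every real α ∈ [1/3, 1/2]. Let A ⊆ [N] be a subset and let 𝒫 be a set of primes p ≤ N^α such that Σ_{p ≤ N^α, p ∉ 𝒫} (log p / p) < c · log N. If for each prime p ∈ 𝒫 the set A mod p is contained in an arithmetic progression S_p ⊆ ℤ/pℤ of length at most αp, then |A| ≤ C · N^{α − c}. -/
/-- `A` reduced modulo `p`. -/
def modImage (A : Finset ℕ) (p : ℕ) : Finset (ZMod p) :=
  A.image (fun a => (Nat.cast a : ZMod p))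

/-- `S` is contained in an arithmetic progression in `ZMod p` of length at most `t`. -/
def InAP {p : ℕ} (S : Finset (ZMod p)) (t : ℝ) : Prop :=
  ∃ (L : ℕ) (x d : ZMod p), d ≠ 0 ∧ (L : ℝ) ≤ t ∧
    S ⊆ (Finset.range L).image (fun j => x + (Nat.cast j : ZMod p) * d)

namespace SieveAP

open Finset

theorem sum_log_div_mul_pred_le (n : ℕ) (hn : 1 ≤ n) :
    ∑ k ∈ Finset.Icc 2 n, Real.log k / (k * (k - 1)) ≤ 2 - (Real.log n + 2) / n := by
  induction n, hn using Nat.le_induction with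
  | base => simp
  | succ m hm ih =>
    rw [Finset.sum_Icc_succ_top (by omega)]
    have hm0 : (0 : ℝ) < m := by exact_mod_cast hm
    have hlog : Real.log (m + 1) - Real.log m ≤ 1 / m := by
      rw [← Real.log_div (by positivity) (by positivity)]
      have := Real.log_le_sub_one_of_pos (x := ((m : ℝ) + 1) / m) (by positivity)
      have h2 : ((m : ℝ) + 1) / m - 1 = 1 / m := by field_simp; ring
      linarith
    have h1m : (1 : ℝ) / m ≤ 1 := by
      rw [div_le_one hm0]; exact_mod_cast hm
    push_cast
    have key : Real.log (m + 1) / ((m + 1) * (m + 1 - 1 : ℝ)) ≤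
        (Real.log m + 2) / m - (Real.log (m + 1) + 2) / (m + 1) := by
      have e : (Real.log m + 2) / m - (Real.log (m + 1) + 2) / (m + 1) =
          (Real.log m * (m + 1) + 2 - Real.log (m + 1) * m) / ((m + 1) * m) := by
        field_simp; ring
      rw [e, show ((m : ℝ) + 1 - 1) = m by ring]
      apply div_le_div_of_nonneg_right _ (by positivity)
      have : (m + 1) * (Real.log (m + 1) - Real.log m) ≤ (m + 1) * (1 / m : ℝ) :=
        mul_le_mul_of_nonneg_left hlog (by positivity)
      have h3 : ((m : ℝ) + 1) * (1 / m) = 1 + 1 / m := by field_simp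
      nlinarith
    linarith

theorem log_factorial_eq (n : ℕ) :
    Real.log (n.factorial : ℝ) =
      ∑ p ∈ (range (n + 1)).filter Nat.Prime, (n.factorial.factorization p : ℝ) * Real.log p := by
  have h := Nat.prod_factorization_pow_eq_self (Nat.factorial_ne_zero n)
  conv_lhs => rw [← h]
  rw [Finsupp.prod_of_support_subset (s := (range (n + 1)).filter Nat.Prime)]
  · push_cast
    rw [Real.log_prod]
    · simp [Real.log_pow]
    · intro p hp
      have := (Finset.mem_filter.1 hp).2.pos
      positivity
  · intro p hp
    have hp' := Nat.support_factorization _ ▸ hp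
    have hpp := Nat.prime_of_mem_primeFactors hp'
    have := Nat.dvd_of_mem_primeFactors hp'
    simp only [mem_filter, mem_range]
    exact ⟨Nat.lt_succ_of_le ((Nat.Prime.dvd_factorial hpp).1 this), hpp⟩
  · intros; simp

theorem theta_sum_le (P : Finset ℕ) (Q : ℝ) (hQ : 0 ≤ Q)
    (hP : ∀ p ∈ P, p.Prime ∧ (p : ℝ) ≤ Q) : ∑ p ∈ P, Real.log p ≤ Real.log 4 * Q := by
  refine le_trans ?_ (Chebyshev.theta_le_log4_mul_x hQ)
  rw [Chebyshev.theta_eq_sum_Icc]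
  apply Finset.sum_le_sum_of_subset_of_nonneg
  · intro p hp
    simp only [mem_filter, mem_Icc, zero_le, true_and]
    exact ⟨Nat.le_floor (hP p hp).2, (hP p hp).1⟩
  · intro p hp _
    exact Real.log_natCast_nonneg p

theorem sum_log_div_prime_le (n : ℕ) (hn : 1 ≤ n) :
    ∑ p ∈ (range (n + 1)).filter Nat.Prime, Real.log p / p ≤ Real.log n + Real.log 4 := by
  have hn0 : (0 : ℝ) < n := by exact_mod_cast hn
  have h1 : ∑ p ∈ (range (n + 1)).filter Nat.Prime, ((n : ℝ) / p - 1) * Real.log p ≤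
      n * Real.log n := by
    calc _ ≤ Real.log (n.factorial : ℝ) := by
          rw [log_factorial_eq]
          apply Finset.sum_le_sum
          intro p hp
          rw [mem_filter] at hp
          apply mul_le_mul_of_nonneg_right _ (Real.log_natCast_nonneg p)
          have hdiv : n / p ≤ n.factorial.factorization p := by
            rw [← hp.2.pow_dvd_iff_le_factorization (Nat.factorial_ne_zero n)]
            calc p ^ (n / p) ∣ p ^ (n / p) * (n / p).factorial := dvd_mul_right _ _
              _ ∣ (p * (n / p)).factorial := by
                  generalize n / p = k
                  induction k with
                  | zero => simp
                  | succ k ih =>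
                    have h1 : (p * k).factorial * (p * (k + 1)) ∣ (p * (k + 1)).factorial := by
                      have hpos := hp.2.pos
                      have : p * (k + 1) = (p * (k + 1) - 1) + 1 := by
                        have : 0 < p * (k + 1) := by positivity
                        omega
                      rw [this, Nat.factorial_succ, ← this, mul_comm]
                      apply mul_dvd_mul_left
                      apply Nat.factorial_dvd_factorial
                      have : p * (k + 1) = p * k + p := by ring
                      omega
                    refine dvd_trans ?_ h1
                    rw [Nat.factorial_succ, show p ^ (k + 1) * ((k + 1) * k.factorial) =
                      (p ^ k * k.factorial) * (p * (k + 1)) by ring]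
                    exact mul_dvd_mul_right ih _
              _ ∣ n.factorial := Nat.factorial_dvd_factorial (Nat.mul_div_le n p)
          have : (n : ℝ) / p - 1 ≤ (n / p : ℕ) := by
            have := Nat.lt_floor_add_one ((n : ℝ) / p)
            rw [Nat.floor_div_eq_div] at this
            linarith
          refine this.trans ?_
          exact_mod_cast hdiv
      _ ≤ Real.log ((n : ℝ) ^ n) := by
          apply Real.log_le_log (by positivity)
          exact_mod_cast Nat.factorial_le_pow n
      _ = _ := by rw [Real.log_pow]
  have h2 := theta_sum_le ((range (n + 1)).filter Nat.Prime) n hn0.le (by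
    intro p hp
    rw [mem_filter, mem_range] at hp
    exact ⟨hp.2, by exact_mod_cast Nat.lt_succ_iff.1 hp.1⟩)
  have h3 : ∑ p ∈ (range (n + 1)).filter Nat.Prime, ((n : ℝ) / p - 1) * Real.log p =
      n * ∑ p ∈ (range (n + 1)).filter Nat.Prime, Real.log p / p -
        ∑ p ∈ (range (n + 1)).filter Nat.Prime, Real.log p := by
    rw [Finset.mul_sum, ← Finset.sum_sub_distrib]
    apply Finset.sum_congr rfl
    intros; ring
  rw [h3] at h1
  have : (n : ℝ) * ∑ p ∈ (range (n + 1)).filter Nat.Prime, Real.log p / p ≤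
      n * (Real.log n + Real.log 4) := by linarith
  exact le_of_mul_le_mul_left this hn0

theorem le_sum_log_div_prime (n : ℕ) (hn : 1 ≤ n) :
    Real.log n - 3 ≤ ∑ p ∈ (range (n + 1)).filter Nat.Prime, Real.log p / p := by
  have hn0 : (0 : ℝ) < n := by exact_mod_cast hn
  have h1 : n * Real.log n - n ≤ Real.log (n.factorial : ℝ) := by
    have := Real.pow_div_factorial_le_exp (n : ℝ) hn0.le n
    have h2 := Real.log_le_log (by positivity) this
    rw [Real.log_exp, Real.log_div (by positivity) (by positivity), Real.log_pow] at h2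
    linarith
  have h2 : Real.log (n.factorial : ℝ) ≤
      n * (∑ p ∈ (range (n + 1)).filter Nat.Prime, Real.log p / p +
        ∑ p ∈ (range (n + 1)).filter Nat.Prime, Real.log p / (p * (p - 1))) := by
    rw [log_factorial_eq, ← Finset.sum_add_distrib, Finset.mul_sum]
    apply Finset.sum_le_sum
    intro p hp
    rw [mem_filter] at hp
    have hp1 : (1 : ℝ) < p := by exact_mod_cast hp.2.one_lt
    have := Fact.mk hp.2
    have h3 := sub_one_mul_padicValNat_factorial_lt_of_ne_zero (p := p) (n := n) (by omega)
    have h4 : ((p : ℝ) - 1) * (n.factorial.factorization p : ℝ) ≤ n := by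
      have h5 : (p - 1) * n.factorial.factorization p ≤ n := by
        rw [Nat.factorization_def _ hp.2]; exact h3.le
      have : (((p - 1) * n.factorial.factorization p : ℕ) : ℝ) ≤ n := by exact_mod_cast h5
      rwa [Nat.cast_mul, Nat.cast_sub hp.2.one_lt.le, Nat.cast_one] at this
    have h6 : (n : ℝ) * (Real.log p / p + Real.log p / (p * (p - 1))) =
        n / (p - 1) * Real.log p := by
      have : (p : ℝ) - 1 ≠ 0 := by linarith
      field_simp; ring
    rw [h6]
    apply mul_le_mul_of_nonneg_right _ (Real.log_natCast_nonneg p)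
    rw [le_div_iff₀ (by linarith)]
    linarith
  have h3 : ∑ p ∈ (range (n + 1)).filter Nat.Prime, Real.log p / (p * (p - 1)) ≤ 2 := by
    calc _ ≤ ∑ k ∈ Finset.Icc 2 n, Real.log k / (k * (k - 1)) := by
          apply Finset.sum_le_sum_of_subset_of_nonneg
          · intro p hp
            rw [mem_filter, mem_range] at hp
            rw [mem_Icc]
            exact ⟨hp.2.two_le, by omega⟩
          · intro k hk _
            rw [mem_Icc] at hk
            have : (2 : ℝ) ≤ k := by exact_mod_cast hk.1
            have h4 : (0 : ℝ) ≤ k - 1 := by linarith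
            have h5 := Real.log_natCast_nonneg k
            positivity
      _ ≤ 2 - (Real.log n + 2) / n := sum_log_div_mul_pred_le n hn
      _ ≤ 2 := by
          have := Real.log_natCast_nonneg n
          have : 0 ≤ (Real.log n + 2) / n := by positivity
          linarith
  have h4 : n * (Real.log n - 3) ≤
      n * ∑ p ∈ (range (n + 1)).filter Nat.Prime, Real.log p / p := by
    have : (n : ℝ) * ∑ p ∈ (range (n + 1)).filter Nat.Prime, Real.log p / (p * (p - 1)) ≤ n * 2 :=
      mul_le_mul_of_nonneg_left h3 hn0.le
    linarith
  exact le_of_mul_le_mul_left h4 hn0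

theorem sum_log_prime_dvd_le (P : Finset ℕ) (hP : ∀ p ∈ P, p.Prime) (m : ℕ) (hm : m ≠ 0) :
    ∑ p ∈ P with p ∣ m, Real.log p ≤ Real.log m := by
  have hd : ∏ p ∈ P with p ∣ m, p ∣ m := by
    apply Finset.prod_primes_dvd
    · intro p hp; exact (hP p (mem_filter.1 hp).1).prime
    · intro p hp; exact (mem_filter.1 hp).2
  rw [← Real.log_prod]
  · apply Real.log_le_log
    · apply Finset.prod_pos
      intro p hp
      exact_mod_cast (hP p (mem_filter.1 hp).1).pos
    · rw [← Nat.cast_prod]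
      exact_mod_cast Nat.le_of_dvd (Nat.pos_of_ne_zero hm) hd
  · intro p hp
    exact_mod_cast (hP p (mem_filter.1 hp).1).ne_zero

/-- Gallagher's larger sieve, in a weighted form. -/
theorem larger_sieve {κ : Type*} [DecidableEq κ] {N : ℕ} {A P : Finset ℕ}
    (hA : A ⊆ Icc 1 N) {Q : ℝ} (hQ : 0 ≤ Q) (hP : ∀ p ∈ P, p.Prime ∧ (p : ℝ) ≤ Q)
    (j : ℕ → ℕ → κ) (I : ℕ → Finset κ)
    (hj : ∀ p ∈ P, ∀ a ∈ A, ∀ b ∈ A, j p a = j p b → a ≡ b [MOD p])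
    (hI : ∀ p ∈ P, ∀ a ∈ A, j p a ∈ I p)
    {ρ : ℕ → ℝ} (h0 : ∀ a ∈ A, 0 ≤ ρ a) (h1 : ∀ a ∈ A, ρ a ≤ 1) (hR : Q ≤ ∑ a ∈ A, ρ a) :
    ∑ p ∈ P, Real.log p * ∑ x ∈ I p, (∑ a ∈ A with j p a = x, ρ a) ^ 2 ≤
      (∑ a ∈ A, ρ a) ^ 2 * (Real.log N + 2) := by
  classical
  set R := ∑ a ∈ A, ρ a with hRdef
  have hR0 : 0 ≤ R := Finset.sum_nonneg h0
  have e1 : ∀ p ∈ P, ∑ x ∈ I p, (∑ a ∈ A with j p a = x, ρ a) ^ 2 =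
      ∑ a ∈ A, ∑ b ∈ A, if j p a = j p b then ρ a * ρ b else 0 := by
    intro p hp
    calc ∑ x ∈ I p, (∑ a ∈ A with j p a = x, ρ a) ^ 2
        = ∑ x ∈ I p, ∑ a ∈ A with j p a = x, ∑ b ∈ A, if j p a = j p b then ρ a * ρ b else 0 := by
          apply Finset.sum_congr rfl
          intro x _
          rw [sq, Finset.sum_mul]
          apply Finset.sum_congr rfl
          intro a ha
          rw [Finset.mul_sum, Finset.sum_filter]
          apply Finset.sum_congr rfl
          intro b _
          rw [(mem_filter.1 ha).2]
          simp only [eq_comm]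
      _ = _ := Finset.sum_fiberwise_of_maps_to (hI p hp) _
  have e2 : ∑ p ∈ P, Real.log p * ∑ x ∈ I p, (∑ a ∈ A with j p a = x, ρ a) ^ 2 =
      ∑ a ∈ A, ∑ b ∈ A, (ρ a * ρ b) * ∑ p ∈ P with j p a = j p b, Real.log p := by
    calc _ = ∑ p ∈ P, ∑ a ∈ A, ∑ b ∈ A,
          (ρ a * ρ b) * (if j p a = j p b then Real.log p else 0) := by
          apply Finset.sum_congr rfl
          intro p hp
          rw [e1 p hp, Finset.mul_sum]
          apply Finset.sum_congr rfl; intro a _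
          rw [Finset.mul_sum]
          apply Finset.sum_congr rfl; intro b _
          split_ifs <;> ring
      _ = _ := by
          rw [Finset.sum_comm]
          apply Finset.sum_congr rfl; intro a _
          rw [Finset.sum_comm]
          apply Finset.sum_congr rfl; intro b _
          rw [← Finset.mul_sum, Finset.sum_filter]
  rw [e2]
  have key : ∀ a ∈ A, ∀ b ∈ A, (ρ a * ρ b) * ∑ p ∈ P with j p a = j p b, Real.log p ≤
      (ρ a * ρ b) * Real.log N + if a = b then ρ a * (Real.log 4 * Q) else 0 := by
    intro a ha b hb
    have haN := mem_Icc.1 (hA ha)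
    have hbN := mem_Icc.1 (hA hb)
    have hab : 0 ≤ ρ a * ρ b := mul_nonneg (h0 a ha) (h0 b hb)
    have hl4 : 0 ≤ Real.log 4 := Real.log_nonneg (by norm_num)
    split_ifs with h
    · subst h
      have t1 : ∑ p ∈ P with j p a = j p a, Real.log p ≤ Real.log 4 * Q :=
        theta_sum_le _ Q hQ (fun p hp => hP p (mem_filter.1 hp).1)
      have t2 : ρ a * ρ a * ∑ p ∈ P with j p a = j p a, Real.log p ≤ ρ a * ρ a * (Real.log 4 * Q) :=
        mul_le_mul_of_nonneg_left t1 hab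
      have t3 : ρ a * ρ a ≤ ρ a := mul_le_of_le_one_right (h0 a ha) (h1 a ha)
      have t4 : ρ a * ρ a * (Real.log 4 * Q) ≤ ρ a * (Real.log 4 * Q) :=
        mul_le_mul_of_nonneg_right t3 (by positivity)
      have t5 := mul_nonneg hab (Real.log_natCast_nonneg N)
      linarith
    · rw [add_zero]
      apply mul_le_mul_of_nonneg_left _ hab
      set m := (a - b) + (b - a) with hm
      have hm0 : m ≠ 0 := by omega
      have hmN : m ≤ N := by omega
      calc ∑ p ∈ P with j p a = j p b, Real.log p ≤ ∑ p ∈ P with p ∣ m, Real.log p := by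
            apply Finset.sum_le_sum_of_subset_of_nonneg
            · intro p hp
              rw [mem_filter] at hp ⊢
              refine ⟨hp.1, ?_⟩
              have := hj p hp.1 a ha b hb hp.2
              rcases le_total a b with hle | hle
              · rw [hm, Nat.sub_eq_zero_of_le hle, zero_add]
                exact (Nat.modEq_iff_dvd' hle).1 this
              · rw [hm, Nat.sub_eq_zero_of_le hle, add_zero]
                exact (Nat.modEq_iff_dvd' hle).1 this.symm
            · intro p _ _; exact Real.log_natCast_nonneg p
        _ ≤ Real.log m := sum_log_prime_dvd_le P (fun p hp => (hP p hp).1) m hm0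
        _ ≤ Real.log N := Real.log_le_log (by positivity) (by exact_mod_cast hmN)
  calc _ ≤ ∑ a ∈ A, ∑ b ∈ A, ((ρ a * ρ b) * Real.log N +
        if a = b then ρ a * (Real.log 4 * Q) else 0) :=
        Finset.sum_le_sum fun a ha => Finset.sum_le_sum fun b hb => key a ha b hb
    _ = R ^ 2 * Real.log N + R * (Real.log 4 * Q) := by
        simp_rw [Finset.sum_add_distrib]
        congr 1
        · rw [sq, hRdef, Finset.sum_mul_sum, Finset.sum_mul]
          simp_rw [Finset.sum_mul]
        · rw [hRdef, Finset.sum_mul]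
          apply Finset.sum_congr rfl
          intro a ha
          simp [ha]
    _ ≤ R ^ 2 * (Real.log N + 2) := by
        have : Real.log 4 ≤ 2 := by
          have : Real.log 4 = 2 * Real.log 2 := by
            rw [show (4 : ℝ) = 2 ^ 2 by norm_num, Real.log_pow]; norm_num
          have := Real.log_two_lt_d9
          linarith
        have h5 : Real.log 4 * Q ≤ 2 * R := by
          have := mul_le_mul_of_nonneg_right this hQ
          linarith
        nlinarith [mul_le_mul_of_nonneg_left h5 hR0]

/-- On every dense enough weighted part of `A`, the index maps `j p` are, on average over `p ∈ P`
with weights `w`, almost equidistributed in `I p`. The error is `E` relative to the total weight,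
up to an additive error `T` which is only relevant for sparse parts. -/
def Equidist {ι κ : Type*} (P : Finset ℕ) (w : ℕ → ℝ) (A : Finset ι) (I : ℕ → Finset κ)
    (j : ℕ → ι → κ) (E T : ℝ) : Prop :=
  ∀ ρ : ι → ℝ, (∀ a ∈ A, 0 ≤ ρ a ∧ ρ a ≤ 1) →
    ∀ g : ℕ → κ → ℝ, (∀ p ∈ P, ∀ x ∈ I p, 0 ≤ g p x ∧ g p x ≤ 1) →
      ∑ a ∈ A, ρ a * ∑ p ∈ P, w p * g p (j p a) ≤
        (∑ a ∈ A, ρ a) * (∑ p ∈ P, w p * ((#(I p) : ℝ)⁻¹ * ∑ x ∈ I p, g p x) + E) + T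

theorem Equidist.prod {ι κ ι' κ' : Type*} {P : Finset ℕ} {w : ℕ → ℝ} {A : Finset ι}
    {I : ℕ → Finset κ} {j : ℕ → ι → κ} {E T : ℝ} {B : Finset ι'} {I' : ℕ → Finset κ'}
    {j' : ℕ → ι' → κ'} {E' T' : ℝ} (h : Equidist P w A I j E T)
    (h' : Equidist P w B I' j' E' T') (hj : ∀ p ∈ P, ∀ a ∈ A, j p a ∈ I p) :
    Equidist P w (A ×ˢ B) (fun p => I p ×ˢ I' p) (fun p c => (j p c.1, j' p c.2)) (E + E')
      (T * #B + T' * #A) := by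
  intro ρ hρ g hg
  set ρ₁ : ι → ℝ := fun a => ∑ b ∈ B, ρ (a, b) with hρ₁
  set g₁ : ℕ → κ → ℝ := fun p x => (#(I' p) : ℝ)⁻¹ * ∑ y ∈ I' p, g p (x, y) with hg₁
  have hρ' : ∀ a ∈ A, ∀ b ∈ B, 0 ≤ ρ (a, b) ∧ ρ (a, b) ≤ 1 := fun a ha b hb =>
    hρ _ (mem_product.2 ⟨ha, hb⟩)
  have hg' : ∀ p ∈ P, ∀ x ∈ I p, ∀ y ∈ I' p, 0 ≤ g p (x, y) ∧ g p (x, y) ≤ 1 :=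
    fun p hp x hx y hy => hg p hp _ (mem_product.2 ⟨hx, hy⟩)
  have step1 : ∀ a ∈ A, ∑ b ∈ B, ρ (a, b) * ∑ p ∈ P, w p * g p (j p a, j' p b) ≤
      ρ₁ a * (∑ p ∈ P, w p * g₁ p (j p a) + E') + T' := by
    intro a ha
    exact h' (fun b => ρ (a, b)) (hρ' a ha) (fun p y => g p (j p a, y))
      (fun p hp y hy => hg' p hp _ (hj p hp a ha) y hy)
  have hρ₁0 : ∀ a ∈ A, 0 ≤ ρ₁ a := fun a ha => Finset.sum_nonneg fun b hb => (hρ' a ha b hb).1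
  have hρ₁1 : ∀ a ∈ A, ρ₁ a ≤ #B := fun a ha => by
    have := Finset.sum_le_sum fun b hb => (hρ' a ha b hb).2
    simpa using this
  have hg₁' : ∀ p ∈ P, ∀ x ∈ I p, 0 ≤ g₁ p x ∧ g₁ p x ≤ 1 := by
    intro p hp x hx
    constructor
    · exact mul_nonneg (by positivity) (Finset.sum_nonneg fun y hy => (hg' p hp x hx y hy).1)
    · have h1 : ∑ y ∈ I' p, g p (x, y) ≤ #(I' p) := by
        have := Finset.sum_le_sum fun y hy => (hg' p hp x hx y hy).2
        simpa using this
      rcases Nat.eq_zero_or_pos #(I' p) with h0 | h0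
      · simp [hg₁, h0]
      · have : (0 : ℝ) < #(I' p) := by exact_mod_cast h0
        simp only [hg₁]
        rw [inv_mul_le_iff₀ this]
        linarith
  have step2 := h (fun a => ρ₁ a / #B) (fun a ha => ⟨div_nonneg (hρ₁0 a ha) (by positivity),
    div_le_one_of_le₀ (hρ₁1 a ha) (by positivity)⟩) g₁ hg₁'
  have hB : ∀ a ∈ A, (#B : ℝ) * (ρ₁ a / #B) = ρ₁ a := by
    intro a ha
    apply mul_div_cancel_of_imp'
    intro h0
    have := hρ₁0 a ha
    have := hρ₁1 a ha
    linarith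
  have step3 := mul_le_mul_of_nonneg_left step2 (Nat.cast_nonneg (α := ℝ) #B)
  rw [mul_add, ← mul_assoc, Finset.mul_sum, Finset.mul_sum, Finset.sum_congr rfl hB] at step3
  have e3 : ∑ a ∈ A, (#B : ℝ) * (ρ₁ a / #B * ∑ p ∈ P, w p * g₁ p (j p a)) =
      ∑ a ∈ A, ρ₁ a * ∑ p ∈ P, w p * g₁ p (j p a) := by
    apply Finset.sum_congr rfl
    intro a ha
    rw [← mul_assoc, hB a ha]
  rw [e3] at step3
  have eR : ∑ c ∈ A ×ˢ B, ρ c = ∑ a ∈ A, ρ₁ a := by rw [Finset.sum_product]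
  have eG : ∀ p, ((#(I p ×ˢ I' p) : ℝ)⁻¹ * ∑ x ∈ I p ×ˢ I' p, g p x) =
      (#(I p) : ℝ)⁻¹ * ∑ x ∈ I p, g₁ p x := by
    intro p
    rw [Finset.card_product, Finset.sum_product, Nat.cast_mul, mul_inv, mul_assoc]
    congr 1
    rw [Finset.mul_sum]
  rw [Finset.sum_product, eR]
  simp_rw [eG]
  have step4 := Finset.sum_le_sum step1
  simp_rw [mul_add, Finset.sum_add_distrib, ← Finset.sum_mul] at step4
  simp only [sum_const, nsmul_eq_mul] at step4
  linarith

theorem Equidist.of_larger_sieve {N : ℕ} {A P P' : Finset ℕ}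
    (hA : A ⊆ Icc 1 N) {Q α : ℝ} (hQ : 0 < Q) (hP : ∀ p ∈ P, p.Prime ∧ (p : ℝ) ≤ Q)
    (hα : 0 ≤ α) (hP' : P' ⊆ P)
    {j : ℕ → ℕ → ℕ} {L : ℕ → ℕ}
    (hj : ∀ p ∈ P, ∀ a ∈ A, ∀ b ∈ A, j p a = j p b → a ≡ b [MOD p])
    (hL : ∀ p ∈ P, ∀ a ∈ A, j p a < L p)
    (hL0 : ∀ p ∈ P, 0 < L p ∧ (L p : ℝ) ≤ α * p) {E T : ℝ} (hE0 : 0 ≤ E)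
    (hE : (∑ p ∈ P, Real.log p / p) * (α * (Real.log N + 2) - ∑ p ∈ P, Real.log p / p) ≤ E ^ 2)
    (hT : Q * ∑ p ∈ P, Real.log p / p ≤ T) :
    Equidist P' (fun p => Real.log p / p) A (fun p => range (L p)) j E T := by
  intro ρ hρ g hg
  set w : ℕ → ℝ := fun p => Real.log p / p with hw
  set W := ∑ p ∈ P, Real.log p / p with hW
  set R := ∑ a ∈ A, ρ a with hR
  have hw0 : ∀ p, 0 ≤ w p := fun p => div_nonneg (Real.log_natCast_nonneg p) (by positivity)
  have hW0 : 0 ≤ W := Finset.sum_nonneg fun p _ => hw0 p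
  have hWW : ∑ p ∈ P', w p ≤ W := Finset.sum_le_sum_of_subset_of_nonneg hP' fun p _ _ => hw0 p
  have hR0 : 0 ≤ R := Finset.sum_nonneg fun a ha => (hρ a ha).1
  have hjI : ∀ p ∈ P, ∀ a ∈ A, j p a ∈ range (L p) := fun p hp a ha => mem_range.2 (hL p hp a ha)
  have havg : 0 ≤ ∑ p ∈ P', w p * ((#(range (L p)) : ℝ)⁻¹ * ∑ x ∈ range (L p), g p x) := by
    apply Finset.sum_nonneg
    intro p hp
    apply mul_nonneg (hw0 p)
    exact mul_nonneg (by positivity) (Finset.sum_nonneg fun x hx => (hg p hp x hx).1)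
  rcases lt_or_ge R Q with hRQ | hRQ
  · have h1 : ∑ a ∈ A, ρ a * ∑ p ∈ P', w p * g p (j p a) ≤ R * W := by
      rw [hR, Finset.sum_mul]
      apply Finset.sum_le_sum
      intro a ha
      apply mul_le_mul_of_nonneg_left _ (hρ a ha).1
      refine le_trans (Finset.sum_le_sum fun p hp => ?_) hWW
      exact mul_le_of_le_one_right (hw0 p) (hg p hp _ (hjI p (hP' hp) a ha)).2
    have h2 : R * W ≤ Q * W := mul_le_mul_of_nonneg_right hRQ.le hW0
    have h3 := mul_nonneg hR0 (add_nonneg havg hE0)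
    linarith
  have hRpos : 0 < R := hQ.trans_le hRQ
  set u : ℕ → ℕ → ℝ := fun p x => (∑ a ∈ A with j p a = x, ρ a) / R with hu
  set e : ℕ → ℝ := fun p => ∑ x ∈ range (L p), (u p x - (L p : ℝ)⁻¹) * g p x with he
  have husum : ∀ p ∈ P, ∑ x ∈ range (L p), u p x = 1 := by
    intro p hp
    rw [← Finset.sum_div, Finset.sum_fiberwise_of_maps_to (hjI p hp), ← hR, div_self hRpos.ne']
  have hU : ∀ p ∈ P, ∑ x ∈ range (L p), (u p x - (L p : ℝ)⁻¹) ^ 2 =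
      ∑ x ∈ range (L p), u p x ^ 2 - (L p : ℝ)⁻¹ := by
    intro p hp
    have hLp : (L p : ℝ) ≠ 0 := by exact_mod_cast (hL0 p hp).1.ne'
    have : ∀ x ∈ range (L p), (u p x - (L p : ℝ)⁻¹) ^ 2 =
        u p x ^ 2 - 2 * (L p : ℝ)⁻¹ * u p x + (L p : ℝ)⁻¹ ^ 2 := by intros; ring
    rw [Finset.sum_congr rfl this, Finset.sum_add_distrib, Finset.sum_sub_distrib,
      ← Finset.mul_sum, husum p hp]
    simp only [sum_const, card_range, nsmul_eq_mul]
    field_simp; ring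
  have he2 : ∀ p ∈ P', e p ^ 2 ≤ L p * ∑ x ∈ range (L p), u p x ^ 2 - 1 := by
    intro p hp
    have hLp : (L p : ℝ) ≠ 0 := by exact_mod_cast (hL0 p (hP' hp)).1.ne'
    have h1 := Finset.sum_mul_sq_le_sq_mul_sq (range (L p)) (fun x => u p x - (L p : ℝ)⁻¹) (g p)
    have h2 : ∑ x ∈ range (L p), g p x ^ 2 ≤ L p := by
      have : ∀ x ∈ range (L p), g p x ^ 2 ≤ 1 := fun x hx =>
        pow_le_one₀ (hg p hp x hx).1 (hg p hp x hx).2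
      simpa using Finset.sum_le_sum this
    have h3 : 0 ≤ ∑ x ∈ range (L p), (u p x - (L p : ℝ)⁻¹) ^ 2 :=
      Finset.sum_nonneg fun _ _ => sq_nonneg _
    calc e p ^ 2 ≤ _ := h1
      _ ≤ (∑ x ∈ range (L p), (u p x - (L p : ℝ)⁻¹) ^ 2) * L p := mul_le_mul_of_nonneg_left h2 h3
      _ = _ := by rw [hU p (hP' hp)]; field_simp
  have hpos : ∀ p ∈ P, 0 ≤ L p * ∑ x ∈ range (L p), u p x ^ 2 - 1 := by
    intro p hp
    have hLp : (L p : ℝ) ≠ 0 := by exact_mod_cast (hL0 p hp).1.ne'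
    have h3 : 0 ≤ L p * ∑ x ∈ range (L p), (u p x - (L p : ℝ)⁻¹) ^ 2 :=
      mul_nonneg (by positivity) (Finset.sum_nonneg fun _ _ => sq_nonneg _)
    rw [hU p hp, mul_sub, mul_inv_cancel₀ hLp] at h3
    exact h3
  have hLS := larger_sieve hA hQ.le hP j (fun p => range (L p)) hj hjI (fun a ha => (hρ a ha).1)
    (fun a ha => (hρ a ha).2) hRQ
  have hLS' : ∑ p ∈ P, Real.log p * ∑ x ∈ range (L p), u p x ^ 2 ≤ Real.log N + 2 := by
    have : ∑ p ∈ P, Real.log p * ∑ x ∈ range (L p), u p x ^ 2 =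
        (∑ p ∈ P, Real.log p * ∑ x ∈ range (L p), (∑ a ∈ A with j p a = x, ρ a) ^ 2) / R ^ 2 := by
      simp only [hu, div_pow]
      rw [Finset.sum_div]
      apply Finset.sum_congr rfl
      intro p _
      rw [← Finset.sum_div, mul_div_assoc]
    rw [this, div_le_iff₀ (by positivity)]
    linarith
  have hsum : ∑ p ∈ P', w p * e p ^ 2 ≤ α * (Real.log N + 2) - W := by
    calc ∑ p ∈ P', w p * e p ^ 2
        ≤ ∑ p ∈ P', w p * (L p * ∑ x ∈ range (L p), u p x ^ 2 - 1) :=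
          Finset.sum_le_sum fun p hp => mul_le_mul_of_nonneg_left (he2 p hp) (hw0 p)
      _ ≤ ∑ p ∈ P, w p * (L p * ∑ x ∈ range (L p), u p x ^ 2 - 1) :=
          Finset.sum_le_sum_of_subset_of_nonneg hP' fun p hp _ => mul_nonneg (hw0 p) (hpos p hp)
      _ ≤ ∑ p ∈ P, (α * (Real.log p * ∑ x ∈ range (L p), u p x ^ 2) - w p) := by
          apply Finset.sum_le_sum
          intro p hp
          have hp0 : (0 : ℝ) < p := by exact_mod_cast (hP p hp).1.pos
          have h1 : w p * L p ≤ α * Real.log p := by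
            simp only [hw]
            rw [div_mul_eq_mul_div, div_le_iff₀ hp0]
            have := mul_le_mul_of_nonneg_left (hL0 p hp).2 (Real.log_natCast_nonneg p)
            linarith
          have h2 : 0 ≤ ∑ x ∈ range (L p), u p x ^ 2 := Finset.sum_nonneg fun _ _ => sq_nonneg _
          have := mul_le_mul_of_nonneg_right h1 h2
          linarith
      _ = α * (∑ p ∈ P, Real.log p * ∑ x ∈ range (L p), u p x ^ 2) - W := by
          rw [Finset.sum_sub_distrib, ← Finset.mul_sum]
      _ ≤ _ := by
          have := mul_le_mul_of_nonneg_left hLS' hα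
          linarith
  have hfin : ∑ p ∈ P', w p * e p ≤ E := by
    apply le_of_sq_le_sq _ hE0
    have hcs : (∑ p ∈ P', w p * e p) ^ 2 ≤ (∑ p ∈ P', w p) * ∑ p ∈ P', w p * e p ^ 2 := by
      apply Finset.sum_sq_le_sum_mul_sum_of_sq_le_mul
      · intro p _; exact hw0 p
      · intro p _; exact mul_nonneg (hw0 p) (sq_nonneg _)
      · intro p _; exact le_of_eq (by ring)
    calc _ ≤ _ := hcs
      _ ≤ W * ∑ p ∈ P', w p * e p ^ 2 := mul_le_mul_of_nonneg_right hWW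
          (Finset.sum_nonneg fun p _ => mul_nonneg (hw0 p) (sq_nonneg _))
      _ ≤ W * (α * (Real.log N + 2) - W) := mul_le_mul_of_nonneg_left hsum hW0
      _ ≤ _ := hE
  have hmain : ∑ a ∈ A, ρ a * ∑ p ∈ P', w p * g p (j p a) =
      R * (∑ p ∈ P', w p * ((#(range (L p)) : ℝ)⁻¹ * ∑ x ∈ range (L p), g p x) +
        ∑ p ∈ P', w p * e p) := by
    calc _ = ∑ p ∈ P', w p * ∑ a ∈ A, ρ a * g p (j p a) := by
          simp_rw [Finset.mul_sum]
          rw [Finset.sum_comm]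
          apply Finset.sum_congr rfl; intro p _
          apply Finset.sum_congr rfl; intro a _
          ring
      _ = ∑ p ∈ P', w p * (R * ∑ x ∈ range (L p), u p x * g p x) := by
          apply Finset.sum_congr rfl; intro p hp
          congr 1
          rw [← Finset.sum_fiberwise_of_maps_to (hjI p (hP' hp)), Finset.mul_sum]
          apply Finset.sum_congr rfl; intro x _
          simp only [hu]
          rw [← mul_assoc, mul_div_cancel₀ _ hRpos.ne', Finset.sum_mul]
          apply Finset.sum_congr rfl; intro a ha
          rw [(mem_filter.1 ha).2]
      _ = _ := by
          rw [← Finset.sum_add_distrib, Finset.mul_sum]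
          apply Finset.sum_congr rfl; intro p _
          simp only [he, sub_mul, Finset.sum_sub_distrib, ← Finset.mul_sum, card_range]
          ring
  rw [hmain]
  have h4 := mul_le_mul_of_nonneg_left hfin hR0
  have h5 : 0 ≤ Q * W := mul_nonneg hQ.le hW0
  rw [mul_add, mul_add]
  linarith

/-- For every `p ∈ P` an affine map modulo `p` sends `A` into `{0, …, L p - 1}`, where
`L p ≤ α * p` and `2 * L p ≤ p`; the images are recorded as natural numbers `j p a`. -/
structure Coords (A P : Finset ℕ) (α : ℝ) (L : ℕ → ℕ) (j : ℕ → ℕ → ℕ) : Prop where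
  prime : ∀ p ∈ P, p.Prime
  lt : ∀ p ∈ P, ∀ a ∈ A, j p a < L p
  pos : ∀ p ∈ P, 0 < L p
  le : ∀ p ∈ P, (L p : ℝ) ≤ α * p
  two_mul_le : ∀ p ∈ P, 2 * L p ≤ p
  affine : ∀ p ∈ P, ∃ s t : ZMod p, IsUnit s ∧ ∀ a ∈ A, (j p a : ZMod p) = s * a + t

namespace Coords
variable {A P : Finset ℕ} {α : ℝ} {L : ℕ → ℕ} {j : ℕ → ℕ → ℕ}

theorem mono (h : Coords A P α L j) {P' : Finset ℕ} (hP : P' ⊆ P) : Coords A P' α L j :=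
  ⟨fun p hp => h.prime p (hP hp), fun p hp => h.lt p (hP hp), fun p hp => h.pos p (hP hp),
    fun p hp => h.le p (hP hp), fun p hp => h.two_mul_le p (hP hp),
    fun p hp => h.affine p (hP hp)⟩

theorem modEq (h : Coords A P α L j) {p : ℕ} (hp : p ∈ P) {a b : ℕ} (ha : a ∈ A) (hb : b ∈ A)
    (hab : j p a = j p b) : a ≡ b [MOD p] := by
  obtain ⟨s, t, hs, hst⟩ := h.affine p hp
  rw [← ZMod.natCast_eq_natCast_iff]
  have h1 := hst a ha
  rw [hab, hst b hb] at h1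
  exact (hs.mul_left_cancel (add_right_cancel h1)).symm

theorem add_eq_add (h : Coords A P α L j) {p : ℕ} (hp : p ∈ P) {a b c d : ℕ} (ha : a ∈ A)
    (hb : b ∈ A) (hc : c ∈ A) (hd : d ∈ A) (habcd : a + b = c + d) :
    j p a + j p b = j p c + j p d := by
  obtain ⟨s, t, hs, hst⟩ := h.affine p hp
  have h2 := h.two_mul_le p hp
  have h3 := h.lt p hp a ha
  have h4 := h.lt p hp b hb
  have h5 := h.lt p hp c hc
  have h6 := h.lt p hp d hd
  have key : ((j p a + j p b : ℕ) : ZMod p) = ((j p c + j p d : ℕ) : ZMod p) := by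
    push_cast
    rw [hst a ha, hst b hb, hst c hc, hst d hd]
    have : ((a + b : ℕ) : ZMod p) = ((c + d : ℕ) : ZMod p) := by rw [habcd]
    push_cast at this
    linear_combination s * this
  rw [ZMod.natCast_eq_natCast_iff] at key
  exact key.eq_of_lt_of_lt (by omega) (by omega)

end Coords

theorem sum_range_dist_add (f : ℕ → ℝ) (n : ℕ) :
    ∑ x ∈ range n, ∑ y ∈ range n, f (x - y + (y - x)) + n * f 0 =
      2 * ∑ k ∈ range n, ((n : ℝ) - k) * f k := by
  induction n with
  | zero => simp
  | succ n ih =>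
    have h1 : ∑ x ∈ range n, f (x - n + (n - x)) = ∑ k ∈ range n, f (k + 1) := by
      rw [← Finset.sum_range_reflect]
      apply Finset.sum_congr rfl
      intro x hx
      have := mem_range.1 hx
      congr 1; omega
    have h2 : ∑ y ∈ range n, f (n - y + (y - n)) = ∑ k ∈ range n, f (k + 1) := by
      rw [← h1]
      apply Finset.sum_congr rfl
      intro x hx
      congr 1; omega
    have h3 := Finset.sum_range_succ' f n
    have h4 := Finset.sum_range_succ f n
    simp_rw [Finset.sum_range_succ]
    rw [Finset.sum_add_distrib, h1, h2]
    have h5 : ∑ k ∈ range n, (((n + 1 : ℕ) : ℝ) - k) * f k =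
        ∑ k ∈ range n, ((n : ℝ) - k) * f k + ∑ k ∈ range n, f k := by
      rw [← Finset.sum_add_distrib]
      apply Finset.sum_congr rfl
      intro k _; push_cast; ring
    rw [h5]
    have h6 : n - n + (n - n) = 0 := by omega
    rw [h6]
    push_cast
    linarith

/-- The average over pairs of a truncation of `τ * n / (n - |x - y|)`. -/
theorem le_sum_sum_div_max {n : ℕ} {τ : ℝ} (hτ : 0 < τ) (hτ1 : τ < 1) (hn : 1 ≤ τ * n) :
    (n : ℝ) ^ 2 * (2 * τ - 3 * τ ^ 2) ≤ ∑ x ∈ range n, ∑ y ∈ range n,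
      τ * n / max ((n : ℝ) - (x - y + (y - x) : ℕ)) (τ * n) := by
  have hn0 : (0 : ℝ) < n := by
    rcases Nat.eq_zero_or_pos n with h | h
    · simp [h] at hn; linarith
    · exact_mod_cast h
  have h0 := sum_range_dist_add (fun k => τ * n / max ((n : ℝ) - k) (τ * n)) n
  simp only [Nat.cast_zero, sub_zero] at h0
  have hmax : max (n : ℝ) (τ * n) = n := max_eq_left (by nlinarith)
  rw [hmax] at h0
  have h1 : (1 - τ) * n * (τ * n) ≤
      ∑ k ∈ range n, ((n : ℝ) - k) * (τ * n / max ((n : ℝ) - k) (τ * n)) := by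
    have hsub : range (⌊(1 - τ) * n⌋₊ + 1) ⊆ range n := by
      apply range_subset_range.2
      have : ⌊(1 - τ) * n⌋₊ < n := by
        rw [Nat.floor_lt (by nlinarith)]
        nlinarith
      omega
    calc (1 - τ) * n * (τ * n) ≤ (⌊(1 - τ) * n⌋₊ + 1 : ℕ) * (τ * n) := by
          apply mul_le_mul_of_nonneg_right _ (by linarith)
          push_cast
          exact (Nat.lt_floor_add_one _).le
      _ = ∑ k ∈ range (⌊(1 - τ) * n⌋₊ + 1), τ * n := by
          rw [Finset.sum_const, card_range, nsmul_eq_mul]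
      _ ≤ ∑ k ∈ range (⌊(1 - τ) * n⌋₊ + 1),
            ((n : ℝ) - k) * (τ * n / max ((n : ℝ) - k) (τ * n)) := by
          apply Finset.sum_le_sum
          intro k hk
          have hk1 : k ≤ ⌊(1 - τ) * n⌋₊ := by have := mem_range.1 hk; omega
          have hk2 : (k : ℝ) ≤ (1 - τ) * n :=
            le_trans (by exact_mod_cast hk1) (Nat.floor_le (by nlinarith))
          rw [max_eq_left (by linarith), mul_div_cancel₀]
          nlinarith
      _ ≤ _ := by
          apply Finset.sum_le_sum_of_subset_of_nonneg hsub
          intro k hk _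
          have : (k : ℝ) ≤ n := by exact_mod_cast (mem_range.1 hk).le
          apply mul_nonneg (by linarith)
          apply div_nonneg (by linarith)
          exact le_trans (by linarith) (le_max_right _ _)
  have h2 : (n : ℝ) * (τ * n / n) = τ * n := by field_simp
  rw [h2] at h0
  nlinarith

theorem sum_log_div_sub_le {N : ℕ} {A P : Finset ℕ} {α : ℝ} {L : ℕ → ℕ} {j : ℕ → ℕ → ℕ}
    (hA : A ⊆ Icc 1 N) {Q : ℝ} (hQ : 0 ≤ Q) (hPQ : ∀ p ∈ P, (p : ℝ) ≤ Q)
    (hc : Coords A P α L j) {a₁ a₂ : ℕ} (h₁ : a₁ ∈ A) (h₂ : a₂ ∈ A)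
    (hpop : Q < #{y ∈ A ×ˢ A | y.1 + a₂ = a₁ + y.2}) :
    ∑ p ∈ P, Real.log p / ((L p : ℝ) - (j p a₁ - j p a₂ + (j p a₂ - j p a₁) : ℕ)) ≤
      Real.log N + 2 := by
  classical
  set D := A.filter fun a => ∃ b ∈ A, a + a₂ = a₁ + b with hD
  have hDA : D ⊆ A := filter_subset _ _
  have hcard : #{y ∈ A ×ˢ A | y.1 + a₂ = a₁ + y.2} ≤ #D := by
    apply Finset.card_le_card_of_injOn Prod.fst
    · rintro ⟨a, b⟩ hy
      simp only [coe_filter, mem_product, Set.mem_ofPred_eq] at hy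
      simp only [hD, coe_filter, Set.mem_ofPred_eq]
      exact ⟨hy.1.1, b, hy.1.2, hy.2⟩
    · rintro ⟨a, b⟩ hy ⟨a', b'⟩ hy' hab
      simp only [coe_filter, mem_product, Set.mem_ofPred_eq] at hy hy' hab
      ext <;> simp only <;> omega
  have hDQ : Q < #D := lt_of_lt_of_le hpop (by exact_mod_cast hcard)
  have hD0 : (0 : ℝ) < #D := lt_of_le_of_lt hQ hDQ
  have hI : ∀ p ∈ P, ∀ a ∈ D,
      j p a ∈ Ico (j p a₁ - j p a₂) (L p - (j p a₂ - j p a₁)) := by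
    intro p hp a ha
    obtain ⟨haA, b, hb, hab⟩ := mem_filter.1 ha
    have h := hc.add_eq_add hp haA h₂ h₁ hb hab
    have h3 := hc.lt p hp a haA
    have h4 := hc.lt p hp b hb
    rw [mem_Ico]; omega
  have hls := larger_sieve (ρ := fun _ => 1) (hDA.trans hA) hQ
    (fun p hp => ⟨hc.prime p hp, hPQ p hp⟩) j
    (fun p => Ico (j p a₁ - j p a₂) (L p - (j p a₂ - j p a₁)))
    (fun p hp a ha b hb => hc.modEq hp (hDA ha) (hDA hb)) hI (fun _ _ => zero_le_one)
    (fun _ _ => le_rfl) (by simpa using hDQ.le)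
  have hterm : ∀ p ∈ P, (#D : ℝ) ^ 2 *
      (Real.log p / ((L p : ℝ) - (j p a₁ - j p a₂ + (j p a₂ - j p a₁) : ℕ))) ≤
      Real.log p * ∑ x ∈ Ico (j p a₁ - j p a₂) (L p - (j p a₂ - j p a₁)),
        (∑ a ∈ D with j p a = x, (1 : ℝ)) ^ 2 := by
    intro p hp
    have h3 := hc.lt p hp a₁ h₁
    have h4 := hc.lt p hp a₂ h₂
    have hcs := sq_sum_le_card_mul_sum_sq (α := ℝ)
      (s := Ico (j p a₁ - j p a₂) (L p - (j p a₂ - j p a₁)))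
      (f := fun x => ∑ a ∈ D with j p a = x, (1 : ℝ))
    rw [Finset.sum_fiberwise_of_maps_to (hI p hp), Nat.card_Ico] at hcs
    have hlen : ((L p - (j p a₂ - j p a₁) - (j p a₁ - j p a₂) : ℕ) : ℝ) =
        (L p : ℝ) - (j p a₁ - j p a₂ + (j p a₂ - j p a₁) : ℕ) := by
      rw [← Nat.cast_sub (by omega)]
      congr 1; omega
    have hpos : (0 : ℝ) < (L p : ℝ) - (j p a₁ - j p a₂ + (j p a₂ - j p a₁) : ℕ) := by
      rw [sub_pos]; exact_mod_cast (by omega)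
    rw [hlen] at hcs
    have hlog : 0 ≤ Real.log p := Real.log_natCast_nonneg p
    rw [mul_div_assoc', div_le_iff₀ hpos]
    simp only [sum_const, nsmul_eq_mul, mul_one] at hcs ⊢
    nlinarith
  have hfin := (Finset.sum_le_sum hterm).trans hls
  rw [← Finset.mul_sum] at hfin
  simp only [sum_const, nsmul_eq_mul, mul_one] at hfin
  exact le_of_mul_le_mul_left hfin (by positivity)

/-- Few pairs in `A` have a difference that occurs more than `Q` times. -/
theorem card_popular_mul_le {N : ℕ} {A P : Finset ℕ} {α : ℝ} {L : ℕ → ℕ} {j : ℕ → ℕ → ℕ}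
    (hA : A ⊆ Icc 1 N) {Q : ℝ} (hQ : 0 ≤ Q) (hPQ : ∀ p ∈ P, (p : ℝ) ≤ Q)
    (hc : Coords A P α L j) {E T τ : ℝ}
    (hE : Equidist P (fun p => Real.log p / p) A (fun p => range (L p)) j E T)
    (hα : 0 ≤ α) (hτ : 0 < τ) (hτ1 : τ < 1) (hL : ∀ p ∈ P, 1 ≤ τ * L p) :
    (#{x ∈ A ×ˢ A | Q < #{y ∈ A ×ˢ A | y.1 + x.2 = x.1 + y.2}} : ℝ) *
      ((∑ p ∈ P, Real.log p / p) * (2 * τ - 3 * τ ^ 2) - τ * α * (Real.log N + 2) - 2 * E) ≤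
      2 * T * #A := by
  classical
  set B := {x ∈ A ×ˢ A | Q < #{y ∈ A ×ˢ A | y.1 + x.2 = x.1 + y.2}} with hB
  set G : ℕ → ℕ × ℕ → ℝ := fun p x =>
    τ * L p / max ((L p : ℝ) - (x.1 - x.2 + (x.2 - x.1) : ℕ)) (τ * L p) with hG
  have hLpos : ∀ p ∈ P, (0 : ℝ) < τ * L p := fun p hp => lt_of_lt_of_le one_pos (hL p hp)
  have hG01 : ∀ p ∈ P, ∀ x, 0 ≤ G p x ∧ G p x ≤ 1 := by
    intro p hp x
    have hm : 0 < max ((L p : ℝ) - (x.1 - x.2 + (x.2 - x.1) : ℕ)) (τ * L p) :=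
      lt_max_of_lt_right (hLpos p hp)
    exact ⟨div_nonneg (hLpos p hp).le hm.le, (div_le_one hm).2 (le_max_right _ _)⟩
  have hprod := hE.prod hE (fun p hp a ha => mem_range.2 (hc.lt p hp a ha))
  have h := hprod (fun x => if x ∈ B then 1 else 0)
    (fun a _ => by split_ifs <;> norm_num) (fun p x => 1 - G p x)
    (fun p hp x _ => ⟨by linarith [(hG01 p hp x).2], by linarith [(hG01 p hp x).1]⟩)
  have hBA : B ⊆ A ×ˢ A := filter_subset _ _
  have hsum1 : ∑ x ∈ A ×ˢ A, (if x ∈ B then (1 : ℝ) else 0) = #B := by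
    rw [← Finset.sum_filter, filter_mem_eq_inter, inter_eq_right.2 hBA]; simp
  rw [hsum1] at h
  have hlow : (#B : ℝ) * (∑ p ∈ P, Real.log p / p - τ * α * (Real.log N + 2)) ≤
      ∑ x ∈ A ×ˢ A, (if x ∈ B then (1 : ℝ) else 0) *
        ∑ p ∈ P, Real.log p / p * (1 - G p (j p x.1, j p x.2)) := by
    simp_rw [ite_mul, one_mul, zero_mul]
    rw [← Finset.sum_filter, filter_mem_eq_inter, inter_eq_right.2 hBA, ← nsmul_eq_mul]
    apply Finset.card_nsmul_le_sum
    rintro ⟨a₁, a₂⟩ hx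
    obtain ⟨hx1, hx2⟩ := mem_filter.1 hx
    obtain ⟨h₁, h₂⟩ := mem_product.1 hx1
    have h3 := sum_log_div_sub_le hA hQ hPQ hc h₁ h₂ hx2
    simp_rw [mul_sub, mul_one]
    rw [Finset.sum_sub_distrib]
    apply sub_le_sub_left
    calc _ ≤ ∑ p ∈ P, τ * α *
          (Real.log p / ((L p : ℝ) - (j p a₁ - j p a₂ + (j p a₂ - j p a₁) : ℕ))) := by
          apply Finset.sum_le_sum
          intro p hp
          simp only [hG]
          have h6 := hc.lt p hp a₁ h₁
          have h7 := hc.lt p hp a₂ h₂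
          have hpos : (0 : ℝ) < (L p : ℝ) - (j p a₁ - j p a₂ + (j p a₂ - j p a₁) : ℕ) := by
            rw [sub_pos]; exact_mod_cast (by omega)
          have hp0 : (0 : ℝ) < p := by exact_mod_cast (hc.prime p hp).pos
          have hlog : 0 ≤ Real.log p := Real.log_natCast_nonneg p
          have h8 := hc.le p hp
          calc _ ≤ Real.log p / p * (τ * (α * p) /
                ((L p : ℝ) - (j p a₁ - j p a₂ + (j p a₂ - j p a₁) : ℕ))) := by
                apply mul_le_mul_of_nonneg_left _ (by positivity)
                apply div_le_div₀ (by positivity) _ hpos (le_max_left _ _)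
                exact mul_le_mul_of_nonneg_left h8 hτ.le
            _ = _ := by field_simp
      _ ≤ _ := by
          rw [← Finset.mul_sum]
          exact mul_le_mul_of_nonneg_left h3 (by positivity)
  have havg : ∑ p ∈ P, Real.log p / p * ((#(range (L p) ×ˢ range (L p)) : ℝ)⁻¹ *
      ∑ x ∈ range (L p) ×ˢ range (L p), (1 - G p x)) ≤
      (∑ p ∈ P, Real.log p / p) * (1 - (2 * τ - 3 * τ ^ 2)) := by
    rw [Finset.sum_mul]
    apply Finset.sum_le_sum
    intro p hp
    have hlog : 0 ≤ Real.log p := Real.log_natCast_nonneg p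
    apply mul_le_mul_of_nonneg_left _ (by positivity)
    have h9 := le_sum_sum_div_max hτ hτ1 (hL p hp)
    have hLp : (0 : ℝ) < L p := by exact_mod_cast hc.pos p hp
    rw [Finset.sum_sub_distrib, Finset.sum_product (f := fun x => G p x)]
    simp only [sum_const, nsmul_eq_mul, mul_one, card_product, card_range, Nat.cast_mul]
    rw [inv_mul_le_iff₀ (by positivity)]
    simp only [hG]
    nlinarith
  have hB0 : (0 : ℝ) ≤ #B := Nat.cast_nonneg _
  have h10 := mul_le_mul_of_nonneg_left havg hB0
  rw [mul_add] at h
  nlinarith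

/-- Modulo `p`, a positive proportion of the combinations `x₁ - x₂ - x₃ + x₄` of elements of
an interval of length `L` avoid a given translate of its difference set. -/
theorem le_card_quadruples {p L : ℕ} (hL : 1000 ≤ L) (hpL : p ≤ 3 * L + 3) (h5 : 5 * L ≤ 2 * p)
    (c : ZMod p) :
    L ^ 4 ≤ 20000 * #{x ∈ (range L ×ˢ range L) ×ˢ (range L ×ˢ range L) |
      ¬ ∃ a ∈ range L, ∃ b ∈ range L, c + (x.1.1 - x.1.2 - x.2.1 + x.2.2) = (a - b : ZMod p)} := by
  classical
  have : NeZero p := ⟨by omega⟩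
  set J : Finset ℤ := Ico (-(p / 2 : ℕ) : ℤ) (p - (p / 2 : ℕ)) with hJ
  set V : Finset ℤ := {v ∈ J | ¬ ∃ a ∈ range L, ∃ b ∈ range L, c + (v : ZMod p) = (a - b : ZMod p)}
    with hV
  set U : Finset ℤ := {v ∈ J | ∃ a ∈ range L, ∃ b ∈ range L, c + (v : ZMod p) = (a - b : ZMod p)}
    with hU
  have hJc : #J = p := by rw [hJ, Int.card_Ico]; omega
  have hUc : #U ≤ 2 * L := by
    calc #U = #(U.image fun v : ℤ => c + (v : ZMod p)) := by
          rw [Finset.card_image_of_injOn]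
          intro v hv v' hv' h
          have h1 : (v : ZMod p) = v' := add_left_cancel h
          rw [ZMod.intCast_eq_intCast_iff_dvd_sub] at h1
          have hv1 := mem_Ico.1 (mem_filter.1 hv).1
          have hv2 := mem_Ico.1 (mem_filter.1 hv').1
          have := Int.eq_zero_of_abs_lt_dvd h1 (by rw [abs_lt]; constructor <;> omega)
          omega
      _ ≤ #((Ioo (-(L : ℤ)) L).image fun v : ℤ => (v : ZMod p)) := by
          apply card_le_card
          intro x hx
          obtain ⟨v, hv, rfl⟩ := mem_image.1 hx
          obtain ⟨a, ha, b, hb, h⟩ := (mem_filter.1 hv).2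
          rw [mem_range] at ha hb
          refine mem_image.2 ⟨(a : ℤ) - b, mem_Ioo.2 ⟨by omega, by omega⟩, ?_⟩
          simp only [h]; push_cast; rfl
      _ ≤ #(Ioo (-(L : ℤ)) L) := card_image_le
      _ ≤ 2 * L := by rw [Int.card_Ioo]; omega
  have hVc : L ≤ 2 * #V := by
    have : #U + #V = #J := Finset.card_filter_add_card_filter_not _
    omega
  set m := L / 20 with hm
  have hmL : L ≤ 21 * m := by omega
  have hinj : #(V ×ˢ (range m ×ˢ (range m ×ˢ range m))) ≤
      #{x ∈ (range L ×ˢ range L) ×ˢ (range L ×ˢ range L) |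
      ¬ ∃ a ∈ range L, ∃ b ∈ range L,
        c + (x.1.1 - x.1.2 - x.2.1 + x.2.2) = (a - b : ZMod p)} := by
    apply Finset.card_le_card_of_injOn fun y : ℤ × (ℕ × (ℕ × ℕ)) =>
      ((y.1.toNat / 2 + m + y.2.2.2, (-y.1).toNat / 2 + m + y.2.1),
        ((-y.1).toNat - (-y.1).toNat / 2 + m + y.2.2.1,
          y.1.toNat - y.1.toNat / 2 + m + y.2.1 + y.2.2.1 - y.2.2.2))
    · rintro ⟨v, a, b, e⟩ hy
      simp only [coe_product, Set.mem_prod, mem_coe, mem_range] at hy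
      obtain ⟨hv, ha, hb, he⟩ := hy
      obtain ⟨hvJ, hvn⟩ := mem_filter.1 hv
      have hv1 := mem_Ico.1 hvJ
      have hcast : ∀ x₁ x₂ x₃ x₄ : ℕ, (x₁ : ℤ) - x₂ - x₃ + x₄ = v →
          (x₁ - x₂ - x₃ + x₄ : ZMod p) = v := by
        intro x₁ x₂ x₃ x₄ h
        rw [← h]; push_cast; rfl
      simp only [coe_filter, mem_product, mem_range, Set.mem_ofPred_eq]
      refine ⟨⟨⟨by omega, by omega⟩, by omega, by omega⟩, ?_⟩
      rw [hcast _ _ _ _ (by omega)]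
      simpa using hvn
    · rintro ⟨v, a, b, e⟩ hy ⟨v', a', b', e'⟩ hy' h
      simp only [coe_product, Set.mem_prod, mem_coe, mem_range] at hy hy'
      obtain ⟨-, ha, hb, he⟩ := hy
      obtain ⟨-, ha', hb', he'⟩ := hy'
      simp only [Prod.mk.injEq] at h
      obtain ⟨⟨h1, h2⟩, h3, h4⟩ := h
      have hv : v = v' := by omega
      subst hv
      simp only [Prod.mk.injEq, true_and]
      omega
  simp only [card_product, card_range] at hinj
  have h3 : L ^ 3 ≤ 9261 * (m * (m * m)) := by
    calc L ^ 3 ≤ (21 * m) ^ 3 := Nat.pow_le_pow_left hmL 3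
      _ = _ := by ring
  calc L ^ 4 = L * L ^ 3 := by ring
    _ ≤ (2 * #V) * (9261 * (m * (m * m))) := Nat.mul_le_mul hVc h3
    _ = 18522 * (#V * (m * (m * m))) := by ring
    _ ≤ 20000 * _ := Nat.mul_le_mul (by norm_num) hinj

theorem card_quadruples_mul_le {A P : Finset ℕ} {α : ℝ} {L : ℕ → ℕ} {j : ℕ → ℕ → ℕ}
    (hc : Coords A P α L j) {E T : ℝ}
    (hE : Equidist P (fun p => Real.log p / p) A (fun p => range (L p)) j E T)
    (hL : ∀ p ∈ P, 1000 ≤ L p ∧ p ≤ 3 * L p + 3 ∧ 5 * L p ≤ 2 * p) (z : ℤ) :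
    (#{x ∈ (A ×ˢ A) ×ˢ (A ×ˢ A) | ∃ a ∈ A, ∃ b ∈ A,
        z + (x.1.1 - x.1.2 - x.2.1 + x.2.2) = (a - b : ℤ)} : ℝ) *
      ((∑ p ∈ P, Real.log p / p) / 20000 - 4 * E) ≤ 4 * T * (#A : ℝ) ^ 3 := by
  classical
  set X := {x ∈ (A ×ˢ A) ×ˢ (A ×ˢ A) | ∃ a ∈ A, ∃ b ∈ A,
        z + (x.1.1 - x.1.2 - x.2.1 + x.2.2) = (a - b : ℤ)} with hX
  choose! s t hst using hc.affine
  have hj : ∀ p ∈ P, ∀ a ∈ A, j p a ∈ range (L p) := fun p hp a ha => mem_range.2 (hc.lt p hp a ha)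
  have hprod := hE.prod hE hj
  have hprod2 := hprod.prod hprod (fun p hp x hx => by
    rw [mem_product] at hx ⊢
    exact ⟨hj p hp _ hx.1, hj p hp _ hx.2⟩)
  have h := hprod2 (fun x => if x ∈ X then 1 else 0)
    (fun a _ => by split_ifs <;> norm_num)
    (fun p x => if ∃ a ∈ range (L p), ∃ b ∈ range (L p),
      s p * z + (x.1.1 - x.1.2 - x.2.1 + x.2.2) = (a - b : ZMod p) then 1 else 0)
    (fun p hp x _ => by split_ifs <;> norm_num)
  have hXA : X ⊆ (A ×ˢ A) ×ˢ (A ×ˢ A) := filter_subset _ _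
  have hsum1 : ∑ x ∈ (A ×ˢ A) ×ˢ (A ×ˢ A), (if x ∈ X then (1 : ℝ) else 0) = #X := by
    rw [← Finset.sum_filter, filter_mem_eq_inter, inter_eq_right.2 hXA]; simp
  rw [hsum1] at h
  simp_rw [ite_mul, one_mul, zero_mul] at h
  rw [← Finset.sum_filter, filter_mem_eq_inter, inter_eq_right.2 hXA] at h
  have hlow : ∀ x ∈ X, (∑ p ∈ P, Real.log p / p * if ∃ a ∈ range (L p), ∃ b ∈ range (L p),
      s p * z + ((j p x.1.1 : ZMod p) - j p x.1.2 - j p x.2.1 + j p x.2.2) = (a - b : ZMod p)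
      then 1 else 0) = ∑ p ∈ P, Real.log p / p := by
    intro x hx
    apply Finset.sum_congr rfl
    intro p hp
    obtain ⟨hx1, a, ha, b, hb, hab⟩ := mem_filter.1 hx
    simp only [mem_product] at hx1
    obtain ⟨⟨h1, h2⟩, h3, h4⟩ := hx1
    rw [if_pos, mul_one]
    refine ⟨j p a, hj p hp a ha, j p b, hj p hp b hb, ?_⟩
    have h5 := (hst p hp).2
    rw [h5 _ h1, h5 _ h2, h5 _ h3, h5 _ h4, h5 a ha, h5 b hb]
    have h6 : ((z + (x.1.1 - x.1.2 - x.2.1 + x.2.2) : ℤ) : ZMod p) = ((a - b : ℤ) : ZMod p) := by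
      rw [hab]
    push_cast at h6
    linear_combination s p * h6
  rw [Finset.sum_congr rfl hlow, Finset.sum_const, nsmul_eq_mul] at h
  have havg : ∑ p ∈ P, Real.log p / p *
      ((#((range (L p) ×ˢ range (L p)) ×ˢ (range (L p) ×ˢ range (L p))) : ℝ)⁻¹ *
      ∑ x ∈ (range (L p) ×ˢ range (L p)) ×ˢ (range (L p) ×ˢ range (L p)),
        if ∃ a ∈ range (L p), ∃ b ∈ range (L p),
          s p * z + ((x.1.1 : ZMod p) - x.1.2 - x.2.1 + x.2.2) = (a - b : ZMod p)
        then 1 else 0) ≤ (∑ p ∈ P, Real.log p / p) * (1 - 1 / 20000) := by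
    rw [Finset.sum_mul]
    apply Finset.sum_le_sum
    intro p hp
    have hlog : 0 ≤ Real.log p := Real.log_natCast_nonneg p
    apply mul_le_mul_of_nonneg_left _ (by positivity)
    obtain ⟨h1, h2, h3⟩ := hL p hp
    have h4 := le_card_quadruples h1 h2 h3 (s p * z)
    have h5 := Finset.card_filter_add_card_filter_not
      (s := (range (L p) ×ˢ range (L p)) ×ˢ (range (L p) ×ˢ range (L p)))
      (fun x => ∃ a ∈ range (L p), ∃ b ∈ range (L p),
        s p * z + ((x.1.1 : ZMod p) - x.1.2 - x.2.1 + x.2.2) = (a - b : ZMod p))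
    rw [Finset.sum_boole, inv_mul_le_iff₀ (by
      simp only [card_product, card_range]; have : 0 < L p := by omega
      positivity)]
    have h6 : #((range (L p) ×ˢ range (L p)) ×ˢ (range (L p) ×ˢ range (L p))) = L p ^ 4 := by
      simp only [card_product, card_range]; ring
    rw [h6] at h5 ⊢
    have h7 := congrArg (Nat.cast (R := ℝ)) h5
    have h8 := (Nat.cast_le (α := ℝ)).2 h4
    push_cast at h7 h8 ⊢
    linarith
  have hX0 : (0 : ℝ) ≤ #X := Nat.cast_nonneg _
  have h10 := mul_le_mul_of_nonneg_left havg hX0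
  rw [mul_add] at h
  rw [card_product A A, Nat.cast_mul] at h
  linarith

/-- The additive character `x ↦ exp (2 π i x)` of `ℝ`. -/
noncomputable def e (x : ℝ) : ℂ := Complex.exp ((2 * Real.pi * x : ℝ) * Complex.I)

theorem e_add (x y : ℝ) : e (x + y) = e x * e y := by
  rw [e, e, e, ← Complex.exp_add]; congr 1; push_cast; ring

theorem norm_e (x : ℝ) : ‖e x‖ = 1 := Complex.norm_exp_ofReal_mul_I _

theorem star_e (x : ℝ) : (starRingEnd ℂ) (e x) = e (-x) := by
  rw [e, e, ← Complex.exp_conj]; congr 1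
  simp only [map_mul, Complex.conj_ofReal, Complex.conj_I, mul_neg, Complex.ofReal_neg, neg_mul]

theorem norm_e_sub_e_le (x y : ℝ) : ‖e x - e y‖ ≤ 2 * Real.pi * |x - y| := by
  have h : e x - e y = e y * (Complex.exp (Complex.I * (2 * Real.pi * (x - y) : ℝ)) - 1) := by
    rw [mul_sub, mul_one, e, e, ← Complex.exp_add]; congr 2; push_cast; ring
  rw [h, norm_mul, norm_e, one_mul]
  refine Real.norm_exp_I_mul_ofReal_sub_one_le.trans_eq ?_
  rw [Real.norm_eq_abs, abs_mul, abs_of_pos Real.two_pi_pos]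

theorem stdAddChar_intCast_mul {M : ℕ} [NeZero M] (n k : ℤ) :
    ZMod.stdAddChar ((n : ZMod M) * (k : ZMod M)) = e (n * (k / M)) := by
  rw [← Int.cast_mul, ZMod.stdAddChar_coe, e]; congr 1; push_cast; ring

/-- The fourth moment of an exponential sum over `ℤ / M` counts additive quadruples. -/
theorem sum_norm_pow_four {ι : Type*} (S : Finset ι) {M : ℕ} [NeZero M] (d : ι → ZMod M) :
    ∑ k : ZMod M, ‖∑ t ∈ S, ZMod.stdAddChar (d t * k)‖ ^ 4 =
      M * #{x ∈ (S ×ˢ S) ×ˢ (S ×ˢ S) | d x.1.1 + d x.1.2 = d x.2.1 + d x.2.2} := by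
  have hneg : ∀ x : ZMod M, (starRingEnd ℂ) (ZMod.stdAddChar x) = ZMod.stdAddChar (-x) := by
    intro x
    rw [AddChar.map_neg_eq_conj]
  have h4 : ∀ k : ZMod M, ((‖∑ t ∈ S, ZMod.stdAddChar (d t * k)‖ ^ 4 : ℝ) : ℂ) =
      ∑ x ∈ (S ×ˢ S) ×ˢ (S ×ˢ S),
        ZMod.stdAddChar (k * (d x.1.1 + d x.1.2 - d x.2.1 - d x.2.2)) := by
    intro k
    set G := ∑ t ∈ S, ZMod.stdAddChar (d t * k) with hG
    have : ((‖G‖ ^ 4 : ℝ) : ℂ) = (G * G) * ((starRingEnd ℂ) G * (starRingEnd ℂ) G) := by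
      have h1 := Complex.mul_conj' G
      push_cast
      calc (‖G‖ : ℂ) ^ 4 = ((‖G‖ : ℂ) ^ 2) * ((‖G‖ : ℂ) ^ 2) := by ring
        _ = _ := by rw [← h1]; ring
    rw [this, hG, map_sum, Finset.sum_mul_sum, Finset.sum_mul_sum, ← Finset.sum_product',
      ← Finset.sum_product', Finset.sum_mul_sum, ← Finset.sum_product']
    apply Finset.sum_congr rfl
    intro x _
    rw [hneg, hneg, ← AddChar.map_add_eq_mul, ← AddChar.map_add_eq_mul, ← AddChar.map_add_eq_mul]
    congr 1; ring
  have h : ((∑ k : ZMod M, ‖∑ t ∈ S, ZMod.stdAddChar (d t * k)‖ ^ 4 : ℝ) : ℂ) =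
      ((M * #{x ∈ (S ×ˢ S) ×ˢ (S ×ˢ S) | d x.1.1 + d x.1.2 = d x.2.1 + d x.2.2} : ℝ) : ℂ) := by
    rw [Complex.ofReal_sum, Finset.sum_congr rfl fun k _ => h4 k, Finset.sum_comm]
    simp_rw [AddChar.sum_mulShift _ (ZMod.isPrimitive_stdAddChar M), ZMod.card]
    have h5 : ∀ x : (ι × ι) × (ι × ι), d x.1.1 + d x.1.2 - d x.2.1 - d x.2.2 = 0 ↔
        d x.1.1 + d x.1.2 = d x.2.1 + d x.2.2 := by
      intro x; rw [sub_sub, sub_eq_zero]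
    simp_rw [h5]
    rw [← Nat.cast_sum, ← Finset.sum_filter, Finset.sum_const, smul_eq_mul, mul_comm]
    push_cast; rfl
  exact_mod_cast h

/-- Duality form of the large sieve: if `‖∑ a ∈ A, e (a * θ p)‖` is large for all `p ∈ W`, then the
exponential sum is often large at the differences `θ p - θ q`. -/
theorem le_sum_norm_sq_sub (A W : Finset ℕ) (θ : ℕ → ℝ)
    (hθ : ∀ p ∈ W, (#A : ℝ) / 3 ≤ ‖∑ a ∈ A, e (a * θ p)‖) :
    (#W : ℝ) ^ 2 * (#A : ℝ) ^ 2 / 81 ≤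
      ∑ p ∈ W, ∑ q ∈ W, ‖∑ a ∈ A, e (a * (θ p - θ q))‖ ^ 2 := by
  set F : ℝ → ℂ := fun x => ∑ a ∈ A, e (a * x) with hF
  choose c hc using fun p => Complex.exists_norm_eq_mul_self (F (θ p))
  set S : ℕ → ℂ := fun a => ∑ p ∈ W, c p * e (a * θ p) with hS
  set X := ∑ p ∈ W, ∑ q ∈ W, ‖F (θ p - θ q)‖ with hX
  have hX0 : 0 ≤ X := Finset.sum_nonneg fun p _ => Finset.sum_nonneg fun q _ => norm_nonneg _
  have h1 : (#W : ℝ) * ((#A : ℝ) / 3) ≤ ∑ a ∈ A, ‖S a‖ := by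
    calc (#W : ℝ) * ((#A : ℝ) / 3) ≤ ∑ p ∈ W, ‖F (θ p)‖ := by
          rw [← nsmul_eq_mul]; exact Finset.card_nsmul_le_sum _ _ _ hθ
      _ = ‖∑ a ∈ A, S a‖ := by
          have : ((∑ p ∈ W, ‖F (θ p)‖ : ℝ) : ℂ) = ∑ a ∈ A, S a := by
            rw [Complex.ofReal_sum, hS, Finset.sum_comm]
            apply Finset.sum_congr rfl
            intro p _
            rw [(hc p).2, hF, Finset.mul_sum]
          rw [← this, Complex.norm_real, Real.norm_of_nonneg]
          exact Finset.sum_nonneg fun p _ => norm_nonneg _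
      _ ≤ _ := norm_sum_le _ _
  have h2 : ∑ a ∈ A, ‖S a‖ ^ 2 ≤ X := by
    have h3 : ((∑ a ∈ A, ‖S a‖ ^ 2 : ℝ) : ℂ) =
        ∑ p ∈ W, ∑ q ∈ W, c p * (starRingEnd ℂ) (c q) * F (θ p - θ q) := by
      have h4 : ∀ a ∈ A, ((‖S a‖ ^ 2 : ℝ) : ℂ) = ∑ p ∈ W, ∑ q ∈ W,
          c p * (starRingEnd ℂ) (c q) * e (a * (θ p - θ q)) := by
        intro a _
        push_cast
        rw [← Complex.mul_conj', hS]
        simp only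
        rw [map_sum, Finset.sum_mul_sum]
        apply Finset.sum_congr rfl; intro p _
        apply Finset.sum_congr rfl; intro q _
        rw [map_mul, star_e, mul_sub, sub_eq_add_neg, e_add]
        ring
      rw [Complex.ofReal_sum, Finset.sum_congr rfl h4, Finset.sum_comm]
      apply Finset.sum_congr rfl; intro p _
      rw [Finset.sum_comm]
      apply Finset.sum_congr rfl; intro q _
      rw [hF, Finset.mul_sum]
    have h5 : ∑ a ∈ A, ‖S a‖ ^ 2 = ‖((∑ a ∈ A, ‖S a‖ ^ 2 : ℝ) : ℂ)‖ := by
      rw [Complex.norm_real, Real.norm_of_nonneg]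
      exact Finset.sum_nonneg fun p _ => sq_nonneg _
    rw [h5, h3]
    refine (norm_sum_le _ _).trans (Finset.sum_le_sum fun p _ => ?_)
    refine (norm_sum_le _ _).trans (Finset.sum_le_sum fun q _ => ?_)
    rw [norm_mul, norm_mul, RCLike.norm_conj, (hc p).1, (hc q).1, one_mul, one_mul]
  have h6 : (∑ a ∈ A, ‖S a‖) ^ 2 ≤ #A * ∑ a ∈ A, ‖S a‖ ^ 2 := sq_sum_le_card_mul_sum_sq
  have h7 : X ^ 2 ≤ (#W : ℝ) ^ 2 * ∑ p ∈ W, ∑ q ∈ W, ‖F (θ p - θ q)‖ ^ 2 := by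
    have h8 := sq_sum_le_card_mul_sum_sq (s := W ×ˢ W)
      (f := fun x : ℕ × ℕ => ‖F (θ x.1 - θ x.2)‖)
    rw [Finset.sum_product, Finset.sum_product, card_product] at h8
    push_cast at h8
    rw [pow_two (#W : ℝ)]
    exact h8
  set Y := ∑ p ∈ W, ∑ q ∈ W, ‖F (θ p - θ q)‖ ^ 2 with hY
  have hY0 : 0 ≤ Y := Finset.sum_nonneg fun p _ => Finset.sum_nonneg fun q _ => sq_nonneg _
  rcases Nat.eq_zero_or_pos #A with hA | hA
  · rw [hA]; simpa using hY0
  rcases Nat.eq_zero_or_pos #W with hW | hW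
  · rw [hW]; simpa using hY0
  have hA' : (0 : ℝ) < #A := by exact_mod_cast hA
  have hW' : (0 : ℝ) < #W := by exact_mod_cast hW
  have h9 : (#W : ℝ) ^ 2 * #A / 9 ≤ X := by
    have h10 := pow_le_pow_left₀ (by positivity) h1 2
    have h11 : (#A : ℝ) * ((#W : ℝ) ^ 2 * #A / 9) ≤ #A * X := by
      calc _ = (#W * ((#A : ℝ) / 3)) ^ 2 := by ring
        _ ≤ _ := h10.trans (h6.trans (mul_le_mul_of_nonneg_left h2 hA'.le))
    exact le_of_mul_le_mul_left h11 hA'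
  have h12 := pow_le_pow_left₀ (by positivity) h9 2
  have h13 : (#W : ℝ) ^ 2 * ((#W : ℝ) ^ 2 * (#A : ℝ) ^ 2 / 81) ≤ (#W : ℝ) ^ 2 * Y := by
    calc _ = ((#W : ℝ) ^ 2 * #A / 9) ^ 2 := by ring
      _ ≤ _ := h12.trans h7
  exact le_of_mul_le_mul_left h13 (by positivity)

theorem e_re (x : ℝ) : (e x).re = Real.cos (2 * Real.pi * x) := Complex.exp_ofReal_mul_I_re _

theorem e_im (x : ℝ) : (e x).im = Real.sin (2 * Real.pi * x) := Complex.exp_ofReal_mul_I_im _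

theorem Coords.exists_large_coeff {A P : Finset ℕ} {α : ℝ} {L : ℕ → ℕ} {j : ℕ → ℕ → ℕ}
    (hc : Coords A P α L j) {p : ℕ} (hp : p ∈ P) (hp2 : p ≠ 2) :
    ∃ r : ℕ, ¬ p ∣ r ∧ (#A : ℝ) / 3 ≤ ‖∑ a ∈ A, e (a * ((r : ℝ) / p))‖ := by
  have hpr := hc.prime p hp
  have : Fact p.Prime := ⟨hpr⟩
  have hp0 : (0 : ℝ) < p := by exact_mod_cast hpr.pos
  obtain ⟨s, t, hs, hst⟩ := hc.affine p hp
  have key : ∀ k : ℕ, ¬ p ∣ k → (#A : ℝ) / 3 ≤ ‖∑ a ∈ A, e (j p a * ((k : ℝ) / p))‖ →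
      ∃ r : ℕ, ¬ p ∣ r ∧ (#A : ℝ) / 3 ≤ ‖∑ a ∈ A, e (a * ((r : ℝ) / p))‖ := by
    intro k hk h
    refine ⟨(k * s).val, ?_, h.trans_eq ?_⟩
    · rw [← ZMod.natCast_eq_zero_iff, ZMod.natCast_zmod_val, mul_eq_zero, not_or,
        ZMod.natCast_eq_zero_iff]
      exact ⟨hk, hs.ne_zero⟩
    · have h1 : ∀ a ∈ A, e (j p a * ((k : ℝ) / p)) =
          ZMod.stdAddChar (t * (k : ZMod p)) * e (a * (((k * s).val : ℝ) / p)) := by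
        intro a ha
        have h2 := stdAddChar_intCast_mul (M := p) (j p a) k
        have h3 := stdAddChar_intCast_mul (M := p) a (k * s).val
        simp only [Int.cast_natCast, ZMod.natCast_zmod_val] at h2 h3
        rw [← h2, ← h3, ← AddChar.map_add_eq_mul, hst a ha]
        congr 1; ring
      rw [Finset.sum_congr rfl h1, ← Finset.mul_sum, norm_mul, AddChar.norm_apply, one_mul]
  have hsin : ∀ a ∈ A, 0 ≤ Real.sin (2 * Real.pi * (j p a * (1 / p))) := by
    intro a ha
    have h1 := hc.lt p hp a ha
    have h2 := hc.two_mul_le p hp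
    have h3 : (2 * j p a : ℝ) ≤ p := by exact_mod_cast (by omega)
    have h4 : 2 * Real.pi * (j p a * (1 / p)) = Real.pi * (2 * j p a / p) := by ring
    rw [h4]
    apply Real.sin_nonneg_of_nonneg_of_le_pi (by positivity)
    have : (2 * j p a / p : ℝ) ≤ 1 := (div_le_one hp0).2 h3
    nlinarith [Real.pi_pos]
  by_cases h : (#A : ℝ) / 3 ≤ ∑ a ∈ A, Real.sin (2 * Real.pi * (j p a * (1 / p)))
  · apply key 1 (fun hd => hpr.one_lt.ne' (Nat.dvd_one.1 hd))
    refine h.trans (le_trans (le_of_eq ?_) (Complex.im_le_norm _))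
    rw [Complex.im_sum]
    apply Finset.sum_congr rfl
    intro a _
    rw [e_im, Nat.cast_one]
  · apply key 2
    · intro hd
      exact hp2 ((Nat.prime_dvd_prime_iff_eq hpr Nat.prime_two).1 hd)
    · refine le_trans ?_ (Complex.re_le_norm _)
      rw [Complex.re_sum]
      have h1 : ∀ a ∈ A, 1 - 2 * Real.sin (2 * Real.pi * (j p a * (1 / p))) ≤
          (e (j p a * ((2 : ℕ) / p))).re := by
        intro a ha
        have h3 : 2 * Real.pi * (j p a * ((2 : ℕ) / p) : ℝ) =
            2 * (2 * Real.pi * (j p a * (1 / p))) := by push_cast; ring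
        rw [e_re, h3, Real.cos_two_mul, Real.cos_sq']
        have h4 := Real.sin_le_one (2 * Real.pi * (j p a * (1 / p)))
        nlinarith [hsin a ha]
      refine le_trans ?_ (Finset.sum_le_sum h1)
      rw [Finset.sum_sub_distrib, ← Finset.mul_sum]
      simp only [sum_const, nsmul_eq_mul, mul_one]
      linarith

theorem eq_of_abs_frac_lt {r : ℕ → ℕ} {N : ℕ} {p q p' q' : ℕ} (hp : p.Prime) (hq : q.Prime)
    (hp' : p'.Prime) (hq' : q'.Prime) (hpr : ¬ p ∣ r p) (hqr : ¬ q ∣ r q) (hqr' : ¬ q' ∣ r q')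
    (hqN : q ^ 4 ≤ N) (hqN' : q' ^ 4 ≤ N) (hlt : p < q) (hlt' : p' < q') {n : ℤ}
    (h : |((r p : ℝ) / p - (r q : ℝ) / q) - ((r p' : ℝ) / p' - (r q' : ℝ) / q') - n| * N < 1) :
    p = p' ∧ q = q' := by
  have hprod : p * q * p' * q' ≤ N := by
    rcases le_total q q' with hqq | hqq
    · calc p * q * p' * q' ≤ q' * q' * q' * q' := by gcongr; omega
        _ = q' ^ 4 := by ring
        _ ≤ N := hqN'
    · calc p * q * p' * q' ≤ q * q * q * q := by gcongr; omega
        _ = q ^ 4 := by ring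
        _ ≤ N := hqN
  have hp0 : (0 : ℝ) < p := by exact_mod_cast hp.pos
  have hq0 : (0 : ℝ) < q := by exact_mod_cast hq.pos
  have hp0' : (0 : ℝ) < p' := by exact_mod_cast hp'.pos
  have hq0' : (0 : ℝ) < q' := by exact_mod_cast hq'.pos
  have hZ : (r p * q * p' * q' - r q * p * p' * q' - r p' * p * q * q' + r q' * p * q * p'
      - n * (p * q * p' * q') : ℤ) = 0 := by
    rw [← Int.abs_lt_one_iff]
    have h1 : (|(r p * q * p' * q' - r q * p * p' * q' - r p' * p * q * q' + r q' * p * q * p'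
      - n * (p * q * p' * q') : ℤ)| : ℝ) < 1 := by
      refine lt_of_le_of_lt ?_ h
      have h2 : ((r p * q * p' * q' - r q * p * p' * q' - r p' * p * q * q' + r q' * p * q * p'
          - n * (p * q * p' * q') : ℤ) : ℝ) =
          (((r p : ℝ) / p - (r q : ℝ) / q) - ((r p' : ℝ) / p' - (r q' : ℝ) / q') - n) *
            (p * q * p' * q' : ℕ) := by
        push_cast; field_simp; ring
      rw [h2, abs_mul, Nat.abs_cast]
      exact mul_le_mul_of_nonneg_left (by exact_mod_cast hprod) (abs_nonneg _)
    exact_mod_cast h1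
  have hcop : ∀ {x y : ℕ}, x.Prime → y.Prime → x ≠ y → ¬ x ∣ y := fun hx hy hxy hd =>
    hxy ((Nat.prime_dvd_prime_iff_eq hx hy).1 hd)
  have hmul : ∀ {x a b c d : ℕ}, x.Prime → ¬ x ∣ a → ¬ x ∣ b → ¬ x ∣ c → ¬ x ∣ d →
      ¬ (x : ℤ) ∣ a * b * c * d := by
    intro x a b c d hx ha hb hc hd h
    have h1 : x ∣ a * b * c * d := by exact_mod_cast h
    rw [hx.dvd_mul, hx.dvd_mul, hx.dvd_mul] at h1
    tauto
  have hqq : q = q' := by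
    rcases lt_trichotomy q q' with hlt2 | heq | hlt2
    · exfalso
      apply hmul hq' hqr' (hcop hq' hp (by omega)) (hcop hq' hq (by omega))
        (hcop hq' hp' (by omega))
      exact ⟨-(r p * q * p' - r q * p * p' - r p' * p * q - n * (p * q * p')), by
        linear_combination hZ⟩
    · exact heq
    · exfalso
      apply hmul hq hqr (hcop hq hp (by omega)) (hcop hq hp' (by omega)) (hcop hq hq' (by omega))
      exact ⟨r p * p' * q' - r p' * p * q' + r q' * p * p' - n * (p * p' * q'), by
        linear_combination -hZ⟩
  refine ⟨?_, hqq⟩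
  subst hqq
  by_contra hpp
  apply hmul hp hpr (hcop hp hq (by omega)) (hcop hp hp' (by omega)) (hcop hp hq (by omega))
  exact ⟨r q * p' * q + r p' * q * q - r q * q * p' + n * (q * p' * q), by
    linear_combination hZ⟩

theorem two_mul_sum_lt_add_sum_diag (W : Finset ℕ) (H : ℕ → ℕ → ℝ)
    (hH : ∀ p q, H p q = H q p) :
    ∑ p ∈ W, ∑ q ∈ W, H p q =
      2 * ∑ x ∈ W ×ˢ W with x.1 < x.2, H x.1 x.2 + ∑ p ∈ W, H p p := by
  have h1 : ∀ p q, H p q =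
      (if p < q then H p q else 0) + (if q < p then H q p else 0) + if p = q then H p q else 0 := by
    intro p q
    rcases lt_trichotomy p q with h | h | h
    · simp [h, h.ne, h.not_gt]
    · simp [h]
    · simp [h, h.ne', h.not_gt, hH p q]
  have h2 : ∑ p ∈ W, ∑ q ∈ W, H p q = ∑ p ∈ W, ∑ q ∈ W, (if p < q then H p q else 0) +
      ∑ p ∈ W, ∑ q ∈ W, (if q < p then H q p else 0) +
      ∑ p ∈ W, ∑ q ∈ W, if p = q then H p q else 0 := by
    rw [← Finset.sum_add_distrib, ← Finset.sum_add_distrib]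
    apply Finset.sum_congr rfl; intro p _
    rw [← Finset.sum_add_distrib, ← Finset.sum_add_distrib]
    exact Finset.sum_congr rfl fun q _ => h1 p q
  have h3 : ∑ p ∈ W, ∑ q ∈ W, (if q < p then H q p else 0) =
      ∑ p ∈ W, ∑ q ∈ W, (if p < q then H p q else 0) := Finset.sum_comm
  have h4 : ∑ p ∈ W, ∑ q ∈ W, (if p = q then H p q else 0) = ∑ p ∈ W, H p p := by
    apply Finset.sum_congr rfl; intro p hp
    rw [Finset.sum_ite_eq]; simp [hp]
  rw [h2, h3, h4, Finset.sum_filter, Finset.sum_product]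
  ring

/-- Large Fourier coefficients at fractions with many prime denominators force a large additive
energy of the difference map, even on most of `A ×ˢ A`. -/
theorem le_energy {N : ℕ} {A W : Finset ℕ} {r : ℕ → ℕ} (hN : 0 < N) (hA : A ⊆ Icc 1 N)
    (hW : ∀ p ∈ W, p.Prime ∧ p ^ 4 ≤ N ∧ ¬ p ∣ r p ∧
      (#A : ℝ) / 3 ≤ ‖∑ a ∈ A, e (a * ((r p : ℝ) / p))‖)
    (hWc : 10000 ≤ #W) {B : Finset (ℕ × ℕ)} (hB : B ⊆ A ×ˢ A) (hBc : 400 * #B ≤ #A ^ 2) :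
    (#W : ℝ) ^ 2 * (#A : ℝ) ^ 8 ≤ 2 * 10 ^ 12 * N *
      #{x ∈ (((A ×ˢ A) \ B) ×ˢ ((A ×ˢ A) \ B)) ×ˢ (((A ×ˢ A) \ B) ×ˢ ((A ×ˢ A) \ B)) |
        ((x.1.1.1 : ℤ) - x.1.1.2) + (x.1.2.1 - x.1.2.2) =
        (x.2.1.1 - x.2.1.2) + (x.2.2.1 - x.2.2.2)} := by
  set S := (A ×ˢ A) \ B with hS
  set θ : ℕ → ℝ := fun p => (r p : ℝ) / p with hθ
  set F : ℝ → ℂ := fun x => ∑ a ∈ A, e (a * x) with hF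
  set G : ℝ → ℂ := fun x => ∑ t ∈ S, e (((t.1 : ℤ) - t.2 : ℤ) * x) with hG
  set M := 4000 * N with hM
  have hM0 : M ≠ 0 := by omega
  have : NeZero M := ⟨hM0⟩
  have hMr : (0 : ℝ) < M := by exact_mod_cast Nat.pos_of_ne_zero hM0
  have hNr : (0 : ℝ) < N := by exact_mod_cast hN
  have hSc : #S ≤ #A ^ 2 := by
    calc #S ≤ #(A ×ˢ A) := card_le_card sdiff_subset
      _ = #A ^ 2 := by rw [card_product, sq]
  have hAN : ∀ a ∈ A, a ≤ N := fun a ha => (mem_Icc.1 (hA ha)).2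
  set Q : Finset (ℕ × ℕ) := {x ∈ W ×ˢ W | x.1 < x.2} with hQ
  set k : ℕ × ℕ → ℤ := fun x => round (M * (θ x.1 - θ x.2)) with hk
  have hk_err : ∀ x, |(θ x.1 - θ x.2) - (k x : ℝ) / M| ≤ 1 / (2 * M) := by
    intro x
    have h1 := abs_sub_round (M * (θ x.1 - θ x.2))
    have h2 : (θ x.1 - θ x.2) - (k x : ℝ) / M =
        (M * (θ x.1 - θ x.2) - round (M * (θ x.1 - θ x.2)) : ℝ) / M := by
      simp only [hk]; field_simp
    rw [h2, abs_div, abs_of_pos hMr, div_le_div_iff₀ hMr (by positivity)]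
    nlinarith
  have hFG : ∀ x, ‖F x‖ ^ 2 ≤ ‖G x‖ + #B := by
    intro x
    have h1 : ((‖F x‖ ^ 2 : ℝ) : ℂ) = ∑ t ∈ A ×ˢ A, e (((t.1 : ℤ) - t.2 : ℤ) * x) := by
      push_cast
      rw [← Complex.mul_conj', hF]
      simp only
      rw [map_sum, Finset.sum_mul_sum, ← Finset.sum_product']
      apply Finset.sum_congr rfl; intro t _
      rw [star_e, ← e_add]; congr 1; ring
    have h2 : ‖F x‖ ^ 2 = ‖((‖F x‖ ^ 2 : ℝ) : ℂ)‖ := by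
      rw [Complex.norm_real, Real.norm_of_nonneg (sq_nonneg _)]
    rw [h2, h1, ← Finset.sum_sdiff hB]
    refine (norm_add_le _ _).trans (add_le_add_right ((norm_sum_le _ _).trans ?_) _)
    simp [norm_e]
  have hGk : ∀ x, ‖G (θ x.1 - θ x.2)‖ ≤ ‖G ((k x : ℝ) / M)‖ + (#A : ℝ) ^ 2 / 1000 := by
    intro x
    have h1 : ‖G (θ x.1 - θ x.2) - G ((k x : ℝ) / M)‖ ≤ (#A : ℝ) ^ 2 / 1000 := by
      simp only [hG]
      rw [← Finset.sum_sub_distrib]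
      refine (norm_sum_le_of_le (f := fun t : ℕ × ℕ => _) S (n := fun _ => (1 / 1000 : ℝ))
        fun t ht => ?_).trans ?_
      · refine (norm_e_sub_e_le _ _).trans ?_
        obtain ⟨h1, h2⟩ := mem_product.1 (mem_sdiff.1 ht).1
        have h3 := hAN _ h1
        have h4 := hAN _ h2
        have h5 : |(((t.1 : ℤ) - t.2 : ℤ) : ℝ)| ≤ N := by
          rw [← Int.cast_abs]
          have : |(t.1 : ℤ) - t.2| ≤ N := by rw [abs_le]; constructor <;> omega
          exact_mod_cast this
        rw [← mul_sub, abs_mul]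
        have h6 := mul_le_mul h5 (hk_err x) (abs_nonneg _) hNr.le
        have h7 : (N : ℝ) * (1 / (2 * M)) = 1 / 8000 := by
          rw [hM]; push_cast; field_simp; norm_num
        rw [h7] at h6
        have := Real.pi_lt_four
        have := Real.pi_pos
        nlinarith
      · rw [Finset.sum_const, nsmul_eq_mul]
        have : (#S : ℝ) ≤ (#A : ℝ) ^ 2 := by exact_mod_cast hSc
        linarith
    linarith [norm_le_insert' (G (θ x.1 - θ x.2)) (G ((k x : ℝ) / M))]
  have hFneg : ∀ x, ‖F (-x)‖ = ‖F x‖ := by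
    intro x
    have : F (-x) = (starRingEnd ℂ) (F x) := by
      simp only [hF, map_sum, star_e, mul_neg]
    rw [this, RCLike.norm_conj]
  have hsum := le_sum_norm_sq_sub A W θ fun p hp => (hW p hp).2.2.2
  rw [two_mul_sum_lt_add_sum_diag W (fun p q => ‖∑ a ∈ A, e (a * (θ p - θ q))‖ ^ 2)
    (fun p q => by rw [← neg_sub (θ q) (θ p)]; exact congrArg (· ^ 2) (hFneg _))] at hsum
  have hdiag : ∑ p ∈ W, ‖∑ a ∈ A, e (a * (θ p - θ p))‖ ^ 2 ≤ #W * (#A : ℝ) ^ 2 := by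
    rw [← nsmul_eq_mul]
    refine Finset.sum_le_card_nsmul _ _ _ fun p _ => pow_le_pow_left₀ (norm_nonneg _) ?_ 2
    refine (norm_sum_le _ _).trans ?_
    simp [norm_e]
  have hQc : 2 * (#Q : ℝ) ≤ (#W : ℝ) ^ 2 := by
    have h1 := two_mul_sum_lt_add_sum_diag W (fun _ _ => 1) (fun _ _ => rfl)
    simp only [sum_const, nsmul_eq_mul, mul_one] at h1
    nlinarith [(Nat.cast_nonneg #W : (0 : ℝ) ≤ _)]
  have hBc' : 400 * (#B : ℝ) ≤ (#A : ℝ) ^ 2 := by exact_mod_cast hBc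
  have hWc' : (10000 : ℝ) ≤ #W := by exact_mod_cast hWc
  have hlow : (#W : ℝ) ^ 2 * (#A : ℝ) ^ 2 / 250 ≤ ∑ x ∈ Q, ‖G ((k x : ℝ) / M)‖ := by
    have h1 : ∑ x ∈ Q, ‖F (θ x.1 - θ x.2)‖ ^ 2 ≤
        ∑ x ∈ Q, ‖G ((k x : ℝ) / M)‖ + #Q * ((#A : ℝ) ^ 2 / 1000 + #B) := by
      rw [← nsmul_eq_mul, ← Finset.sum_const, ← Finset.sum_add_distrib]
      apply Finset.sum_le_sum
      intro x _
      linarith [hFG (θ x.1 - θ x.2), hGk x]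
    have h2 : (#Q : ℝ) * ((#A : ℝ) ^ 2 / 1000 + #B) ≤
        (#W : ℝ) ^ 2 / 2 * ((#A : ℝ) ^ 2 / 1000 + (#A : ℝ) ^ 2 / 400) := by
      apply mul_le_mul <;> first | positivity | linarith
    have h3 : (#W : ℝ) * (#A : ℝ) ^ 2 ≤ (#W : ℝ) ^ 2 * (#A : ℝ) ^ 2 / 10000 := by
      have : (#W : ℝ) * 10000 ≤ (#W : ℝ) ^ 2 := by nlinarith
      nlinarith [sq_nonneg (#A : ℝ)]
    have h4 : (0 : ℝ) ≤ (#W : ℝ) ^ 2 * (#A : ℝ) ^ 2 := by positivity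
    simp only [hF] at h1
    linarith
  have hinj : Set.InjOn (fun x => (k x : ZMod M)) Q := by
    rintro ⟨p, q⟩ hx ⟨p', q'⟩ hx' hxx
    obtain ⟨hx1, hpq⟩ := mem_filter.1 (mem_coe.1 hx)
    obtain ⟨hx1', hpq'⟩ := mem_filter.1 (mem_coe.1 hx')
    obtain ⟨hp, hq⟩ := mem_product.1 hx1
    obtain ⟨hp', hq'⟩ := mem_product.1 hx1'
    obtain ⟨n, hn⟩ := (ZMod.intCast_eq_intCast_iff_dvd_sub _ _ _).1 hxx.symm
    have e1 := hk_err (p, q)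
    have e2 := hk_err (p', q')
    have hn' : (k (p, q) : ℝ) / M - (k (p', q') : ℝ) / M = n := by
      rw [← sub_div, div_eq_iff hMr.ne']
      have := congrArg (Int.cast (R := ℝ)) hn
      simp only [Int.cast_sub, Int.cast_mul, Int.cast_natCast] at this
      linarith
    have h := eq_of_abs_frac_lt (N := N) (n := n) (hW p hp).1 (hW q hq).1 (hW p' hp').1
      (hW q' hq').1 (hW p hp).2.2.1 (hW q hq).2.2.1 (hW q' hq').2.2.1 (hW q hq).2.1
      (hW q' hq').2.1 hpq hpq' (by
        have h1 : |((r p : ℝ) / p - (r q : ℝ) / q) - ((r p' : ℝ) / p' - (r q' : ℝ) / q') - n| ≤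
            1 / M := by
          rw [← hn']
          have h2 : 1 / (M : ℝ) = 1 / (2 * M) + 1 / (2 * M) := by field_simp; norm_num
          rw [h2]
          rw [abs_le] at e1 e2 ⊢
          simp only [hθ] at e1 e2
          constructor <;> linarith [e1.1, e1.2, e2.1, e2.2]
        calc _ ≤ 1 / (M : ℝ) * N := mul_le_mul_of_nonneg_right h1 hNr.le
          _ = 1 / 4000 := by rw [hM]; push_cast; field_simp
          _ < 1 := by norm_num)
    ext <;> simp [h]
  have hup : ∑ x ∈ Q, ‖G ((k x : ℝ) / M)‖ ^ 4 ≤ M *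
      #{x ∈ (S ×ˢ S) ×ˢ (S ×ˢ S) | ((x.1.1.1 : ℤ) - x.1.1.2) + (x.1.2.1 - x.1.2.2) =
        (x.2.1.1 - x.2.1.2) + (x.2.2.1 - x.2.2.2)} := by
    have h1 : ∀ x, G ((k x : ℝ) / M) =
        ∑ t ∈ S, ZMod.stdAddChar ((((t.1 : ℤ) - t.2 : ℤ) : ZMod M) * (k x : ZMod M)) := by
      intro x
      simp only [hG]
      exact Finset.sum_congr rfl fun t _ => (stdAddChar_intCast_mul _ _).symm
    simp_rw [h1]
    set Φ : ZMod M → ℝ := fun y =>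
      ‖∑ t ∈ S, ZMod.stdAddChar ((((t.1 : ℤ) - t.2 : ℤ) : ZMod M) * y)‖ ^ 4 with hΦ
    calc ∑ x ∈ Q, Φ (k x) = ∑ y ∈ Q.image fun x => (k x : ZMod M), Φ y :=
          (Finset.sum_image hinj).symm
      _ ≤ ∑ y, Φ y := Finset.sum_le_univ_sum_of_nonneg fun y => by positivity
      _ ≤ _ := by
        rw [hΦ, sum_norm_pow_four]
        refine mul_le_mul_of_nonneg_left ?_ hMr.le
        rw [Nat.cast_le]
        apply card_le_card
        intro x hx
        obtain ⟨hx1, hx2⟩ := mem_filter.1 hx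
        refine mem_filter.2 ⟨hx1, ?_⟩
        have hb : ∀ t ∈ S, t.1 ≤ N ∧ t.2 ≤ N := fun t ht => by
          obtain ⟨h1, h2⟩ := mem_product.1 (mem_sdiff.1 ht).1
          exact ⟨hAN _ h1, hAN _ h2⟩
        simp only [mem_product] at hx1
        have b1 := hb _ hx1.1.1
        have b2 := hb _ hx1.1.2
        have b3 := hb _ hx1.2.1
        have b4 := hb _ hx1.2.2
        rw [← Int.cast_add, ← Int.cast_add, ZMod.intCast_eq_intCast_iff_dvd_sub] at hx2
        have := Int.eq_zero_of_abs_lt_dvd hx2 (by rw [abs_lt]; constructor <;> omega)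
        omega
  have hpow := pow_le_pow_left₀ (by positivity) hlow 4
  have hhol := pow_sum_le_card_mul_sum_pow (s := Q) (f := fun x => ‖G ((k x : ℝ) / M)‖)
    (fun _ _ => norm_nonneg _) 3
  set En := (#{x ∈ (S ×ˢ S) ×ˢ (S ×ˢ S) | ((x.1.1.1 : ℤ) - x.1.1.2) + (x.1.2.1 - x.1.2.2) =
        (x.2.1.1 - x.2.1.2) + (x.2.2.1 - x.2.2.2)} : ℝ) with hEn
  have hQ3 : (#Q : ℝ) ^ 3 ≤ ((#W : ℝ) ^ 2 / 2) ^ 3 :=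
    pow_le_pow_left₀ (Nat.cast_nonneg _) (by linarith) 3
  have hfin : (#W : ℝ) ^ 6 * ((#W : ℝ) ^ 2 * (#A : ℝ) ^ 8) ≤
      (#W : ℝ) ^ 6 * (2 * 10 ^ 12 * N * En) := by
    have h1 : ((#W : ℝ) ^ 2 * (#A : ℝ) ^ 2 / 250) ^ 4 ≤ ((#W : ℝ) ^ 2 / 2) ^ 3 * (M * En) :=
      hpow.trans (hhol.trans (mul_le_mul hQ3 hup (Finset.sum_nonneg fun _ _ => by positivity)
        (by positivity)))
    rw [hM] at h1
    push_cast at h1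
    have h2 : 0 ≤ (#W : ℝ) ^ 6 * (N * En) := by positivity
    calc _ = 250 ^ 4 * ((#W : ℝ) ^ 2 * (#A : ℝ) ^ 2 / 250) ^ 4 := by ring
      _ ≤ 250 ^ 4 * (((#W : ℝ) ^ 2 / 2) ^ 3 * (4000 * N * En)) :=
          mul_le_mul_of_nonneg_left h1 (by norm_num)
      _ ≤ _ := by nlinarith
  exact le_of_mul_le_mul_left hfin (by positivity)

theorem exists_coords {A P : Finset ℕ} {α : ℝ} (hα : α ≤ 1 / 2)
    (hP : ∀ p ∈ P, p.Prime ∧ 1 ≤ α * p ∧ InAP (modImage A p) (α * p)) :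
    ∃ j, Coords A P α (fun p => ⌊α * p⌋₊) j := by
  classical
  have h : ∀ p ∈ P, ∃ s t : ZMod p, IsUnit s ∧ ∀ a ∈ A, (s * a + t).val < ⌊α * p⌋₊ := by
    intro p hp
    obtain ⟨hpr, h1, l, x, d, hd, hl, hS⟩ := hP p hp
    have : Fact p.Prime := ⟨hpr⟩
    refine ⟨d⁻¹, -x * d⁻¹, (inv_ne_zero hd).isUnit, fun a ha => ?_⟩
    obtain ⟨i, hi, hia⟩ := mem_image.1 (hS (mem_image_of_mem _ ha))
    rw [mem_range] at hi
    have h2 : d⁻¹ * (a : ZMod p) + -x * d⁻¹ = (i : ZMod p) := by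
      rw [← hia]; field_simp; ring
    have h3 : l ≤ ⌊α * p⌋₊ := Nat.le_floor hl
    rw [h2]
    rw [ZMod.val_natCast]
    exact (Nat.mod_le _ _).trans_lt (by omega)
  choose! s t hst using h
  have hpos : ∀ p ∈ P, (0 : ℝ) < α * p := fun p hp => one_pos.trans_le (hP p hp).2.1
  refine ⟨fun p a => (s p * a + t p).val, fun p hp => (hP p hp).1, fun p hp => (hst p hp).2,
    fun p hp => Nat.floor_pos.2 (hP p hp).2.1, fun p hp => Nat.floor_le (hpos p hp).le, ?_, ?_⟩
  · intro p hp
    have h1 := Nat.floor_le (hpos p hp).le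
    have h2 : (0 : ℝ) ≤ p := Nat.cast_nonneg p
    have h3 : (2 * ⌊α * p⌋₊ : ℝ) ≤ p := by nlinarith
    exact_mod_cast h3
  · intro p hp
    have : NeZero p := ⟨(hP p hp).1.ne_zero⟩
    exact ⟨s p, t p, (hst p hp).1, fun a _ => ZMod.natCast_zmod_val _⟩

theorem sum_union_le {ι : Type*} [DecidableEq ι] (s t : Finset ι) {f : ι → ℝ} (hf : ∀ i, 0 ≤ f i) :
    ∑ i ∈ s ∪ t, f i ≤ ∑ i ∈ s, f i + ∑ i ∈ t, f i := by
  have := Finset.sum_union_inter (s₁ := s) (s₂ := t) (f := f)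
  have h : 0 ≤ ∑ i ∈ s ∩ t, f i := Finset.sum_nonneg fun i _ => hf i
  linarith

theorem log_div_nonneg (p : ℕ) : 0 ≤ Real.log p / p :=
  div_nonneg (Real.log_natCast_nonneg p) (Nat.cast_nonneg p)

/-- Mertens' bounds for the primes of `Ps` in `(K, N ^ β]`, when few primes are missing. -/
theorem sum_log_div_bounds {N : ℕ} (hN : 1 ≤ N) {α β c : ℝ} (hβ : 0 ≤ β) (hβα : β ≤ α)
    {K : ℕ} (hK1 : 1 ≤ K) (hK : Real.log K ≤ 35) {Ps : Finset ℕ} (hPs : ∀ p ∈ Ps, p.Prime)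
    (hexc : ∑ p ∈ (primesUpTo ((N : ℝ) ^ α)).filter (fun p => p ∉ Ps), Real.log p / p <
      c * Real.log N) :
    β * Real.log N - c * Real.log N - 50 ≤
        ∑ p ∈ (Ps.filter (K < ·)).filter (fun p : ℕ => (p : ℝ) ≤ (N : ℝ) ^ β), Real.log p / p ∧
      ∑ p ∈ (Ps.filter (K < ·)).filter (fun p : ℕ => (p : ℝ) ≤ (N : ℝ) ^ β), Real.log p / p ≤
        β * Real.log N + 2 := by
  have hN' : (1 : ℝ) ≤ N := by exact_mod_cast hN
  have hN0 : (0 : ℝ) < N := by linarith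
  have hQ1 : (1 : ℝ) ≤ (N : ℝ) ^ β := Real.one_le_rpow hN' hβ
  set n := ⌊(N : ℝ) ^ β⌋₊ with hn
  have hn1 : 1 ≤ n := Nat.le_floor (by simpa using hQ1)
  have hn0 : (0 : ℝ) < n := by exact_mod_cast hn1
  have hmem : ∀ p : ℕ, p ∈ range (n + 1) ↔ (p : ℝ) ≤ (N : ℝ) ^ β := by
    intro p
    rw [mem_range, Nat.lt_succ_iff, Nat.le_floor_iff (by linarith)]
  have hw := log_div_nonneg
  have hlogQ : Real.log ((N : ℝ) ^ β) = β * Real.log N := Real.log_rpow hN0 β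
  have hlog4 : Real.log 4 < 2 := by
    rw [show (4 : ℝ) = 2 ^ 2 by norm_num, Real.log_pow]
    have := Real.log_two_lt_d9
    push_cast; linarith
  constructor
  · have h1 := le_sum_log_div_prime n hn1
    have h2 : Real.log n ≥ β * Real.log N - Real.log 2 := by
      rw [← hlogQ, ← Real.log_div (by linarith) (by norm_num)]
      apply Real.log_le_log (by linarith)
      have h3 := Nat.lt_floor_add_one ((N : ℝ) ^ β)
      have h4 : (1 : ℝ) ≤ n := by exact_mod_cast hn1
      rw [← hn] at h3
      linarith
    have h3 := sum_log_div_prime_le K hK1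
    have h7 : ∑ p ∈ (range (n + 1)).filter Nat.Prime, Real.log p / p ≤
        ∑ p ∈ (Ps.filter (K < ·)).filter (fun p : ℕ => (p : ℝ) ≤ (N : ℝ) ^ β), Real.log p / p +
        (∑ p ∈ (primesUpTo ((N : ℝ) ^ α)).filter (fun p => p ∉ Ps), Real.log p / p +
        ∑ p ∈ (range (K + 1)).filter Nat.Prime, Real.log p / p) := by
      have hsub : (range (n + 1)).filter Nat.Prime ⊆
          (Ps.filter (K < ·)).filter (fun p : ℕ => (p : ℝ) ≤ (N : ℝ) ^ β) ∪
          ((primesUpTo ((N : ℝ) ^ α)).filter (fun p => p ∉ Ps) ∪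
            (range (K + 1)).filter Nat.Prime) := by
        intro p hp
        obtain ⟨hp1, hp2⟩ := mem_filter.1 hp
        rw [hmem] at hp1
        have hpα : p < ⌊(N : ℝ) ^ α⌋₊ + 1 := Nat.lt_succ_of_le
          (Nat.le_floor (hp1.trans (Real.rpow_le_rpow_of_exponent_le hN' hβα)))
        simp only [mem_union, mem_filter, mem_range, primesUpTo]
        by_cases hpPs : p ∈ Ps
        · rcases le_or_gt p K with h | h
          · exact Or.inr (Or.inr ⟨by omega, hp2⟩)
          · exact Or.inl ⟨⟨hpPs, h⟩, hp1⟩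
        · exact Or.inr (Or.inl ⟨⟨hpα, hp2⟩, hpPs⟩)
      refine (Finset.sum_le_sum_of_subset_of_nonneg hsub fun p _ _ => hw p).trans ?_
      have := sum_union_le ((primesUpTo ((N : ℝ) ^ α)).filter (fun p => p ∉ Ps))
        ((range (K + 1)).filter Nat.Prime) hw
      exact (sum_union_le _ _ hw).trans (by linarith)
    have := Real.log_two_lt_d9
    linarith
  · refine le_trans ?_ ((sum_log_div_prime_le n hn1).trans ?_)
    · apply Finset.sum_le_sum_of_subset_of_nonneg _ fun p _ _ => hw p
      intro p hp
      obtain ⟨hp1, hp2⟩ := mem_filter.1 hp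
      exact mem_filter.2 ⟨(hmem p).2 hp2, hPs p (mem_filter.1 hp1).1⟩
    · rw [← hlogQ]
      have := Real.log_le_log hn0 (Nat.floor_le (by linarith : (0 : ℝ) ≤ (N : ℝ) ^ β))
      linarith

/-- An additive energy of `A ×ˢ A` off the pairs with a popular difference is at most the
popularity threshold times a count of triples of pairs. -/
theorem energy_le {A : Finset ℕ} {B : Finset (ℕ × ℕ)} {Q R : ℝ} (hQ : 0 ≤ Q)
    (hB : ∀ x ∈ (A ×ˢ A) \ B, (#{y ∈ A ×ˢ A | y.1 + x.2 = x.1 + y.2} : ℝ) ≤ Q)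
    (hR : ∀ z : ℤ, (#{x ∈ (A ×ˢ A) ×ˢ (A ×ˢ A) | ∃ a ∈ A, ∃ b ∈ A,
      z + (x.1.1 - x.1.2 - x.2.1 + x.2.2) = (a - b : ℤ)} : ℝ) ≤ R) :
    (#{x ∈ (((A ×ˢ A) \ B) ×ˢ ((A ×ˢ A) \ B)) ×ˢ (((A ×ˢ A) \ B) ×ˢ ((A ×ˢ A) \ B)) |
      ((x.1.1.1 : ℤ) - x.1.1.2) + (x.1.2.1 - x.1.2.2) =
        (x.2.1.1 - x.2.1.2) + (x.2.2.1 - x.2.2.2)} : ℝ) ≤ Q * ((#A : ℝ) ^ 2 * R) := by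
  classical
  set S := {x ∈ (((A ×ˢ A) \ B) ×ˢ ((A ×ˢ A) \ B)) ×ˢ (((A ×ˢ A) \ B) ×ˢ ((A ×ˢ A) \ B)) |
      ((x.1.1.1 : ℤ) - x.1.1.2) + (x.1.2.1 - x.1.2.2) =
        (x.2.1.1 - x.2.1.2) + (x.2.2.1 - x.2.2.2)} with hS
  set T : Finset ((_ : ℕ × ℕ) × ((ℕ × ℕ) × (ℕ × ℕ))) := (A ×ˢ A).sigma fun u =>
    {x ∈ (A ×ˢ A) ×ˢ (A ×ˢ A) | ∃ a ∈ A, ∃ b ∈ A,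
      ((u.1 : ℤ) - u.2) + (x.1.1 - x.1.2 - x.2.1 + x.2.2) = (a - b : ℤ)} with hT
  have hTc : (#T : ℝ) ≤ (#A : ℝ) ^ 2 * R := by
    rw [hT, Finset.card_sigma]
    push_cast
    refine (Finset.sum_le_sum fun u _ => hR _).trans_eq ?_
    rw [Finset.sum_const, Finset.card_product, nsmul_eq_mul]
    push_cast; ring
  have hmap : ∀ x ∈ S, (⟨x.1.1, (x.1.2, x.2.1)⟩ : (_ : ℕ × ℕ) × ((ℕ × ℕ) × (ℕ × ℕ))) ∈ T := by
    intro x hx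
    simp only [hS, mem_filter, mem_product, mem_sdiff] at hx
    simp only [hT, mem_sigma, mem_filter, mem_product]
    obtain ⟨⟨⟨h1, h2⟩, ⟨h3, h4⟩⟩, h5⟩ := hx
    exact ⟨h1.1, ⟨h2.1, h3.1⟩, _, h4.1.1, _, h4.1.2, by linarith⟩
  have hfib : ∀ y ∈ T, #{x ∈ S | (⟨x.1.1, (x.1.2, x.2.1)⟩ :
      (_ : ℕ × ℕ) × ((ℕ × ℕ) × (ℕ × ℕ))) = y} ≤ ⌊Q⌋₊ := by
    intro y _
    rcases Finset.eq_empty_or_nonempty {x ∈ S | (⟨x.1.1, (x.1.2, x.2.1)⟩ :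
      (_ : ℕ × ℕ) × ((ℕ × ℕ) × (ℕ × ℕ))) = y} with h | ⟨w, hw⟩
    · rw [h]; simp
    · obtain ⟨hwS, rfl⟩ := mem_filter.1 hw
      simp only [hS, mem_filter, mem_product] at hwS
      refine Nat.le_floor (le_trans ?_ (hB w.2.2 hwS.1.2.2))
      norm_cast
      refine Finset.card_le_card_of_injOn (fun x => x.2.2) ?_ ?_
      · intro x hx
        simp only [hS, coe_filter, mem_filter, mem_product, mem_sdiff, Set.mem_ofPred_eq,
          Sigma.mk.injEq, heq_eq_eq, Prod.mk.injEq] at hx ⊢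
        obtain ⟨⟨⟨_, ⟨_, h4⟩⟩, h5⟩, h6, h7, h8⟩ := hx
        rw [h6, h7, h8] at h5
        exact ⟨h4.1, by have := hwS.2; omega⟩
      · intro x hx x' hx' hxx
        simp only [coe_filter, Set.mem_ofPred_eq, Sigma.mk.injEq, heq_eq_eq,
          Prod.mk.injEq] at hx hx' hxx
        obtain ⟨-, h1, h2, h3⟩ := hx
        obtain ⟨-, h1', h2', h3'⟩ := hx'
        exact Prod.ext (Prod.ext (h1.trans h1'.symm) (h2.trans h2'.symm))
          (Prod.ext (h3.trans h3'.symm) hxx)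
  have h := Finset.card_le_mul_card_image_of_maps_to hmap ⌊Q⌋₊ hfib
  have h' : (#S : ℝ) ≤ ⌊Q⌋₊ * #T := by exact_mod_cast h
  calc (#S : ℝ) ≤ ⌊Q⌋₊ * #T := h'
    _ ≤ Q * #T := by gcongr; exact Nat.floor_le hQ
    _ ≤ _ := by gcongr

/-- A set `A` confined modulo the large primes of `P`, which are almost all of the primes up to
`N ^ α`. -/
structure Sieved (N : ℕ) (α : ℝ) (A P : Finset ℕ) (j : ℕ → ℕ → ℕ) : Prop where
  subset : A ⊆ Icc 1 N
  coords : Coords A P α (fun p => ⌊α * p⌋₊) j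
  third_le : 1 / 3 ≤ α
  le_half : α ≤ 1 / 2
  large : ∀ p ∈ P, (10 : ℝ) ^ 15 ≤ p
  le_log : (10 : ℝ) ^ 100 ≤ Real.log N
  le_sum : ∀ β, 0 ≤ β → β ≤ α → β * Real.log N - 1 / 10 ^ 60 * Real.log N - 50 ≤
    ∑ p ∈ P.filter (fun p : ℕ => (p : ℝ) ≤ (N : ℝ) ^ β), Real.log p / p
  sum_le : ∀ β, 0 ≤ β → β ≤ α → ∑ p ∈ P.filter (fun p : ℕ => (p : ℝ) ≤ (N : ℝ) ^ β),
    Real.log p / p ≤ β * Real.log N + 2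

namespace Sieved

variable {N : ℕ} {α : ℝ} {A P : Finset ℕ} {j : ℕ → ℕ → ℕ}

theorem one_lt (h : Sieved N α A P j) : (1 : ℝ) < N := by
  by_contra! hN
  have h1 := Real.log_nonpos (Nat.cast_nonneg N) hN
  have h2 := h.le_log
  norm_num at h2
  linarith

theorem mul_le_rpow (h : Sieved N α A P j) {x : ℝ} (hx : 0 ≤ x) : 10 ^ 100 * x ≤ (N : ℝ) ^ x := by
  rw [Real.rpow_def_of_pos (by linarith [h.one_lt])]
  have h1 := Real.add_one_le_exp (Real.log N * x)
  have h2 := mul_le_mul_of_nonneg_right h.le_log hx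
  linarith

theorem floor_bounds (h : Sieved N α A P j) {p : ℕ} (hp : p ∈ P) :
    3 * (10 : ℝ) ^ 14 ≤ (⌊α * p⌋₊ : ℝ) ∧ p ≤ 3 * ⌊α * p⌋₊ + 3 := by
  have h1 := Nat.lt_floor_add_one (α * p)
  have h2 := h.large p hp
  have h3 : 1 / 3 * (p : ℝ) ≤ α * p := by gcongr; exact h.third_le
  constructor
  · linarith
  · have : (p : ℝ) ≤ 3 * ⌊α * p⌋₊ + 3 := by linarith
    exact_mod_cast this

theorem equidist (h : Sieved N α A P j) {δ : ℝ} (hδ : 0 < δ) (hδ1 : δ ^ 2 ≤ 1 / 10)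
    (hδ2 : 2 / 10 ^ 60 ≤ δ ^ 2) {P' : Finset ℕ}
    (hP' : P' ⊆ P.filter (fun p : ℕ => (p : ℝ) ≤ (N : ℝ) ^ (α - δ ^ 2))) :
    Equidist P' (fun p => Real.log p / p) A (fun p => range ⌊α * p⌋₊) j (δ * Real.log N)
      ((N : ℝ) ^ (α - δ ^ 2) * Real.log N) := by
  have hα := h.third_le
  have hα2 := h.le_half
  have hℓ := h.le_log
  have hN := h.one_lt
  have hw := h.le_sum (α - δ ^ 2) (by linarith) (by linarith)
  have hw2 := h.sum_le (α - δ ^ 2) (by linarith) (by linarith)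
  set W := ∑ p ∈ P.filter (fun p : ℕ => (p : ℝ) ≤ (N : ℝ) ^ (α - δ ^ 2)), Real.log p / p with hW
  have hW0 : 0 ≤ W := Finset.sum_nonneg fun p _ => log_div_nonneg p
  set ℓ := Real.log N with hℓd
  have hℓ0 : 0 < ℓ := lt_of_lt_of_le (by norm_num) hℓ
  have hδℓ : 2 * 10 ^ 40 ≤ δ ^ 2 * ℓ := by
    calc (2 : ℝ) * 10 ^ 40 = 2 / 10 ^ 60 * 10 ^ 100 := by norm_num
      _ ≤ _ := by gcongr
  have hcℓ : 2 / 10 ^ 60 * ℓ ≤ δ ^ 2 * ℓ := by gcongr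
  have hαℓ : α * ℓ ≤ 1 / 2 * ℓ := by gcongr
  norm_num at hδℓ hcℓ hw
  have hQ : (0 : ℝ) < (N : ℝ) ^ (α - δ ^ 2) := by positivity
  refine Equidist.of_larger_sieve h.subset hQ (α := α) (fun p hp => ?_) (by linarith) hP' ?_ ?_ ?_
    (by positivity) ?_ ?_
  · exact ⟨h.coords.prime p (mem_filter.1 hp).1, (mem_filter.1 hp).2⟩
  · exact fun p hp a ha b hb => h.coords.modEq (mem_filter.1 hp).1 ha hb
  · exact fun p hp => h.coords.lt p (mem_filter.1 hp).1
  · exact fun p hp => ⟨h.coords.pos p (mem_filter.1 hp).1, h.coords.le p (mem_filter.1 hp).1⟩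
  · calc W * (α * (ℓ + 2) - W) ≤ W * (2 * δ ^ 2 * ℓ) := by
          gcongr; linarith
      _ ≤ (1 / 2 * ℓ) * (2 * δ ^ 2 * ℓ) := by
          gcongr; linarith
      _ = _ := by ring
  · have : W ≤ ℓ := by linarith
    gcongr

/-- Few pairs of elements of `A` have a popular difference. -/
theorem card_popular_le (h : Sieved N α A P j) (hc : (N : ℝ) ^ (α - 1 / 10 ^ 60) < #A) :
    400 * #{x ∈ A ×ˢ A | (N : ℝ) ^ (α / 2 + 1 / 10 ^ 13) <
      #{y ∈ A ×ˢ A | y.1 + x.2 = x.1 + y.2}} ≤ #A ^ 2 := by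
  have hα := h.third_le
  have hα2 := h.le_half
  have hℓ := h.le_log
  have hN := h.one_lt
  set Q := (N : ℝ) ^ (α / 2 + 1 / 10 ^ 13) with hQ
  have hw := h.le_sum (α / 2 + 1 / 10 ^ 13) (by positivity) (by norm_num; linarith)
  have hw2 := h.sum_le (α / 2 + 1 / 10 ^ 13) (by positivity) (by norm_num; linarith)
  have hsub : P.filter (fun p : ℕ => (p : ℝ) ≤ Q) ⊆
      P.filter (fun p : ℕ => (p : ℝ) ≤ (N : ℝ) ^ (α - (1 / 10 ^ 28) ^ 2)) := by
    intro p hp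
    obtain ⟨hp1, hp2⟩ := mem_filter.1 hp
    refine mem_filter.2 ⟨hp1, hp2.trans (Real.rpow_le_rpow_of_exponent_le hN.le ?_)⟩
    norm_num; linarith
  have hE := h.equidist (δ := 1 / 10 ^ 28) (by norm_num) (by norm_num) (by norm_num) hsub
  have key := card_popular_mul_le h.subset (by positivity : (0 : ℝ) ≤ Q)
    (fun p hp => (mem_filter.1 hp).2) (h.coords.mono (filter_subset _ _)) hE (by linarith)
    (τ := 5 / 10 ^ 14) (by norm_num) (by norm_num) (fun p hp => by
      have := (h.floor_bounds (mem_filter.1 hp).1).1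
      linarith)
  set W := ∑ p ∈ P.filter (fun p : ℕ => (p : ℝ) ≤ Q), Real.log p / p with hW
  set ℓ := Real.log N with hℓd
  have hℓ0 : 0 < ℓ := lt_of_lt_of_le (by norm_num) hℓ
  set B := {x ∈ A ×ˢ A | Q < #{y ∈ A ×ˢ A | y.1 + x.2 = x.1 + y.2}} with hB
  have hαℓ : α * ℓ ≤ 1 / 2 * ℓ := by gcongr
  have hαℓ0 : 1 / 3 * ℓ ≤ α * ℓ := by gcongr
  have hbr : 7 / 10 ^ 27 * ℓ ≤ W * (2 * (5 / 10 ^ 14) - 3 * (5 / 10 ^ 14) ^ 2) -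
      5 / 10 ^ 14 * α * (ℓ + 2) - 2 * (1 / 10 ^ 28 * ℓ) := by
    norm_num at hw hw2 hℓ ⊢
    linarith
  set F := (N : ℝ) ^ (α - (1 / 10 ^ 28) ^ 2) with hF
  have hF0 : 0 < F := by positivity
  have hFA : 10 ^ 30 * F ≤ #A := by
    refine le_trans ?_ hc.le
    have h1 := h.mul_le_rpow (x := (1 / 10 ^ 28) ^ 2 - 1 / 10 ^ 60) (by norm_num)
    rw [show α - 1 / 10 ^ 60 = (1 / 10 ^ 28) ^ 2 - 1 / 10 ^ 60 + (α - (1 / 10 ^ 28) ^ 2) by ring,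
      Real.rpow_add (by linarith)]
    refine mul_le_mul_of_nonneg_right (le_trans ?_ h1) hF0.le
    norm_num
  have h1 : (#B : ℝ) * (7 / 10 ^ 27 * ℓ) ≤ 2 * (F * ℓ) * #A :=
    (mul_le_mul_of_nonneg_left hbr (Nat.cast_nonneg _)).trans key
  have h2 : (#B : ℝ) * (7 / 10 ^ 27) ≤ 2 * F * #A := by
    refine le_of_mul_le_mul_right ?_ hℓ0
    linarith
  have h3 : 10 ^ 30 * F * #A ≤ #A * #A := by gcongr
  have h4 : (400 * #B : ℝ) ≤ (#A : ℝ) ^ 2 := by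
    norm_num at h2 h3 ⊢
    linarith
  exact_mod_cast h4

/-- Many primes of `P` are close to `N ^ (1 / 4)`. -/
theorem exists_window (h : Sieved N α A P j) : ∃ W ⊆ P, (∀ p ∈ W, p ^ 4 ≤ N) ∧
    1 / 10 ^ 14 * (N : ℝ) ^ (1 / 4 - 1 / 10 ^ 13 : ℝ) ≤ #W := by
  have hα := h.third_le
  have hℓ := h.le_log
  have hN := h.one_lt
  have hw := h.le_sum (1 / 4) (by norm_num) (by linarith)
  have hw2 := h.sum_le (1 / 4 - 1 / 10 ^ 13) (by norm_num) (by norm_num; linarith)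
  set M := (N : ℝ) ^ (1 / 4 - 1 / 10 ^ 13 : ℝ) with hM
  have hM0 : 0 < M := by positivity
  set W := (P.filter (fun p : ℕ => (p : ℝ) ≤ (N : ℝ) ^ (1 / 4 : ℝ))) \
    P.filter (fun p : ℕ => (p : ℝ) ≤ M) with hW
  have hsplit : ∑ p ∈ P.filter (fun p : ℕ => (p : ℝ) ≤ (N : ℝ) ^ (1 / 4 : ℝ)), Real.log p / p ≤
      ∑ p ∈ W, Real.log p / p + ∑ p ∈ P.filter (fun p : ℕ => (p : ℝ) ≤ M), Real.log p / p := by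
    refine le_trans ?_ (sum_union_le _ _ log_div_nonneg)
    refine Finset.sum_le_sum_of_subset_of_nonneg ?_ fun p _ _ => log_div_nonneg p
    rw [hW, sdiff_union_self_eq_union]
    exact subset_union_left
  have hmem : ∀ p ∈ W, p ∈ P ∧ (p : ℝ) ≤ (N : ℝ) ^ (1 / 4 : ℝ) ∧ M < p := by
    intro p hp
    simp only [hW, mem_sdiff, mem_filter, not_and, not_le] at hp
    exact ⟨hp.1.1, hp.1.2, hp.2 hp.1.1⟩
  set ℓ := Real.log N with hℓd
  have hℓ0 : 0 < ℓ := lt_of_lt_of_le (by norm_num) hℓ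
  have hWle : ∑ p ∈ W, Real.log p / p ≤ #W * (ℓ / M) := by
    rw [← nsmul_eq_mul, ← Finset.sum_const]
    refine Finset.sum_le_sum fun p hp => ?_
    obtain ⟨-, h1, h2⟩ := hmem p hp
    have h3 : (0 : ℝ) < p := hM0.trans h2
    have h4 : (p : ℝ) ≤ N := h1.trans (Real.rpow_le_self_of_one_le hN.le (by norm_num))
    have h5 : Real.log p ≤ ℓ := Real.log_le_log h3 h4
    gcongr
  refine ⟨W, fun p hp => (hmem p hp).1, fun p hp => ?_, ?_⟩
  · have h1 := (hmem p hp).2.1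
    have h2 : (p : ℝ) ^ 4 ≤ ((N : ℝ) ^ (1 / 4 : ℝ)) ^ 4 := by gcongr
    rw [← Real.rpow_natCast ((N : ℝ) ^ (1 / 4 : ℝ)), ← Real.rpow_mul (by linarith)] at h2
    norm_num at h2
    exact_mod_cast h2
  · have h1 : 1 / 10 ^ 14 * ℓ ≤ #W * (ℓ / M) := by
      refine le_trans ?_ hWle
      norm_num at hw hw2 hℓ ⊢
      linarith
    rw [mul_div_assoc', le_div_iff₀ hM0] at h1
    refine le_of_mul_le_mul_right ?_ hℓ0
    linarith

/-- Few triples of pairs give a difference lying in a translate of `A - A`. -/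
theorem card_quadruples_le (h : Sieved N α A P j) (hα3 : α ≤ 2 / 5) (z : ℤ) :
    (#{x ∈ (A ×ˢ A) ×ˢ (A ×ˢ A) | ∃ a ∈ A, ∃ b ∈ A,
      z + (x.1.1 - x.1.2 - x.2.1 + x.2.2) = (a - b : ℤ)} : ℝ) ≤
      4 * 10 ^ 5 * (N : ℝ) ^ (α - (1 / 10 ^ 6) ^ 2) * (#A : ℝ) ^ 3 := by
  have hα := h.third_le
  have hℓ := h.le_log
  have hE := h.equidist (δ := 1 / 10 ^ 6) (by norm_num) (by norm_num) (by norm_num) subset_rfl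
  have hw := h.le_sum (α - (1 / 10 ^ 6) ^ 2) (by norm_num; linarith) (by norm_num)
  have key := card_quadruples_mul_le (h.coords.mono (filter_subset _ _)) hE (fun p hp => ?_) z
  · set X := #{x ∈ (A ×ˢ A) ×ˢ (A ×ˢ A) | ∃ a ∈ A, ∃ b ∈ A,
      z + (x.1.1 - x.1.2 - x.2.1 + x.2.2) = (a - b : ℤ)} with hX
    set ℓ := Real.log N with hℓd
    have hℓ0 : 0 < ℓ := lt_of_lt_of_le (by norm_num) hℓ
    have hαℓ0 : 1 / 3 * ℓ ≤ α * ℓ := by gcongr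
    set F := (N : ℝ) ^ (α - (1 / 10 ^ 6) ^ 2) with hF
    set W := ∑ p ∈ P.filter (fun p : ℕ => (p : ℝ) ≤ F), Real.log p / p with hW
    have hbr : 1 / 10 ^ 5 * ℓ ≤ W / 20000 - 4 * (1 / 10 ^ 6 * ℓ) := by
      norm_num at hw hℓ ⊢
      linarith
    have h1 := (mul_le_mul_of_nonneg_left hbr (Nat.cast_nonneg X)).trans key
    refine le_of_mul_le_mul_right ?_ hℓ0
    linarith
  · obtain ⟨hp, -⟩ := mem_filter.1 hp
    obtain ⟨h1, h2⟩ := h.floor_bounds hp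
    have h3 := h.coords.le p hp
    have h4 : α * p ≤ 2 / 5 * p := by gcongr
    refine ⟨?_, h2, ?_⟩
    · have : (1000 : ℝ) ≤ (⌊α * p⌋₊ : ℝ) := le_trans (by norm_num) h1
      exact_mod_cast this
    · have : (5 * ⌊α * p⌋₊ : ℝ) ≤ 2 * p := by linarith
      exact_mod_cast this

/-- Comparison of the lower and upper bounds for the energy. -/
theorem energy_bound (h : Sieved N α A P j) (hc : (N : ℝ) ^ (α - 1 / 10 ^ 60) < #A) {R : ℝ}
    (hR : ∀ z : ℤ, (#{x ∈ (A ×ˢ A) ×ˢ (A ×ˢ A) | ∃ a ∈ A, ∃ b ∈ A,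
      z + (x.1.1 - x.1.2 - x.2.1 + x.2.2) = (a - b : ℤ)} : ℝ) ≤ R) :
    (N : ℝ) ^ (1 / 2 - 2 / 10 ^ 13 : ℝ) * (#A : ℝ) ^ 6 ≤
      2 * 10 ^ 40 * ((N : ℝ) * (N : ℝ) ^ (α / 2 + 1 / 10 ^ 13) * R) := by
  have hN := h.one_lt
  obtain ⟨W, hWP, hW4, hWc⟩ := h.exists_window
  have hlarge : ∀ p ∈ W, ∃ r : ℕ, ¬p ∣ r ∧
      (#A : ℝ) / 3 ≤ ‖∑ a ∈ A, e (a * ((r : ℝ) / p))‖ := by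
    intro p hp
    refine h.coords.exists_large_coeff (hWP hp) ?_
    rintro rfl
    have := h.large 2 (hWP hp)
    norm_num at this
  choose! r hr using hlarge
  have hW10 : 10000 ≤ #W := by
    have h1 := h.mul_le_rpow (x := 1 / 4 - 1 / 10 ^ 13) (by norm_num)
    have : (10000 : ℝ) ≤ #W := by
      refine le_trans ?_ ((mul_le_mul_of_nonneg_left h1 (by norm_num)).trans hWc)
      norm_num
    exact_mod_cast this
  set Q := (N : ℝ) ^ (α / 2 + 1 / 10 ^ 13) with hQ
  set B := {x ∈ A ×ˢ A | Q < #{y ∈ A ×ˢ A | y.1 + x.2 = x.1 + y.2}} with hB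
  have hlow := le_energy (r := r) (by exact_mod_cast (by linarith : (0 : ℝ) < N)) h.subset
    (fun p hp => ⟨h.coords.prime p (hWP hp), hW4 p hp, hr p hp⟩) hW10
    (filter_subset _ _ : B ⊆ A ×ˢ A) (h.card_popular_le hc)
  have hup := energy_le (B := B) (by positivity : 0 ≤ Q) (fun x hx => by
    obtain ⟨h1, h2⟩ := mem_sdiff.1 hx
    by_contra! h3
    exact h2 (mem_filter.2 ⟨h1, h3⟩)) hR
  set M := (N : ℝ) ^ (1 / 4 - 1 / 10 ^ 13 : ℝ) with hM
  have hM0 : 0 < M := by positivity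
  have hMM : (N : ℝ) ^ (1 / 2 - 2 / 10 ^ 13 : ℝ) = M ^ 2 := by
    rw [hM, sq, ← Real.rpow_add (by linarith)]
    norm_num
  have hA : (0 : ℝ) < #A := lt_of_le_of_lt (by positivity) hc
  rw [hMM]
  have h1 : (1 / 10 ^ 14 * M) ^ 2 ≤ (#W : ℝ) ^ 2 := by gcongr
  have h2 := mul_le_mul_of_nonneg_right h1 (by positivity : 0 ≤ (#A : ℝ) ^ 8)
  have h3 := mul_le_mul_of_nonneg_left hup (by positivity : (0 : ℝ) ≤ 2 * 10 ^ 12 * N)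
  have h4 := (h2.trans hlow).trans h3
  refine le_of_mul_le_mul_right ?_ (by positivity : 0 < (#A : ℝ) ^ 2)
  ring_nf at h4 ⊢
  linarith

theorem card_le (h : Sieved N α A P j) : (#A : ℝ) ≤ (N : ℝ) ^ (α - 1 / 10 ^ 60) := by
  by_contra! hc
  have hα := h.third_le
  have hN := h.one_lt
  have hN0 : (0 : ℝ) < N := by linarith
  set F := (N : ℝ) ^ (α - 1 / 10 ^ 60) with hF
  have hF0 : 0 < F := by positivity
  have hFk : ∀ k : ℕ, F ^ k = (N : ℝ) ^ ((α - 1 / 10 ^ 60) * k) := fun k => by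
    rw [Real.rpow_mul hN0.le, Real.rpow_natCast]
  have hA : (0 : ℝ) < #A := hF0.trans hc
  have hpow : ∀ x : ℝ, 0 < (N : ℝ) ^ x := fun x => by positivity
  have hQ := hpow (α / 2 + 1 / 10 ^ 13)
  rcases le_or_gt α (2 / 5) with hα3 | hα3
  · have h1 := h.energy_bound hc (h.card_quadruples_le hα3)
    have h2 : (N : ℝ) ^ (1 / 2 - 2 / 10 ^ 13 : ℝ) * F ^ 3 ≤ 8 * 10 ^ 45 *
        ((N : ℝ) * (N : ℝ) ^ (α / 2 + 1 / 10 ^ 13) * (N : ℝ) ^ (α - (1 / 10 ^ 6) ^ 2)) := by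
      have h3 : (N : ℝ) ^ (1 / 2 - 2 / 10 ^ 13 : ℝ) * F ^ 3 ≤
          (N : ℝ) ^ (1 / 2 - 2 / 10 ^ 13 : ℝ) * (#A : ℝ) ^ 3 := by gcongr
      refine h3.trans (le_of_mul_le_mul_right ?_ (by positivity : 0 < (#A : ℝ) ^ 3))
      ring_nf at h1 ⊢
      linarith
    set x := 3 / 2 * α - 1 / 2 + (1 / 10 ^ 6) ^ 2 - 3 / 10 ^ 13 - 3 / 10 ^ 60 with hx
    have hx0 : 1 / 10 ^ 13 ≤ x := by rw [hx]; norm_num; linarith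
    have h4 : (N : ℝ) ^ (1 / 2 - 2 / 10 ^ 13 : ℝ) * F ^ 3 = (N : ℝ) ^ x *
        ((N : ℝ) * (N : ℝ) ^ (α / 2 + 1 / 10 ^ 13) * (N : ℝ) ^ (α - (1 / 10 ^ 6) ^ 2)) := by
      nth_rewrite 3 [← Real.rpow_one (N : ℝ)]
      rw [hFk]
      simp only [← Real.rpow_add hN0]
      congr 1
      rw [hx]; push_cast; ring
    rw [h4] at h2
    have h5 := le_of_mul_le_mul_right h2 (mul_pos (mul_pos hN0 hQ) (hpow _))
    have h6 := h.mul_le_rpow (x := x) (le_trans (by norm_num) hx0)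
    norm_num at h5 h6 hx0
    linarith
  · have h1 := h.energy_bound hc (R := (#A : ℝ) ^ 4) fun z => by
      have := Finset.card_filter_le ((A ×ˢ A) ×ˢ (A ×ˢ A)) fun x => ∃ a ∈ A, ∃ b ∈ A,
        z + (x.1.1 - x.1.2 - x.2.1 + x.2.2) = (a - b : ℤ)
      rw [Finset.card_product, Finset.card_product] at this
      calc _ ≤ ((#A * #A * (#A * #A) : ℕ) : ℝ) := by exact_mod_cast this
        _ = _ := by push_cast; ring
    have h2 : (N : ℝ) ^ (1 / 2 - 2 / 10 ^ 13 : ℝ) * F ^ 2 ≤ 2 * 10 ^ 40 *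
        ((N : ℝ) * (N : ℝ) ^ (α / 2 + 1 / 10 ^ 13)) := by
      have h3 : (N : ℝ) ^ (1 / 2 - 2 / 10 ^ 13 : ℝ) * F ^ 2 ≤
          (N : ℝ) ^ (1 / 2 - 2 / 10 ^ 13 : ℝ) * (#A : ℝ) ^ 2 := by gcongr
      refine h3.trans (le_of_mul_le_mul_right ?_ (by positivity : 0 < (#A : ℝ) ^ 4))
      ring_nf at h1 ⊢
      linarith
    set x := 3 / 2 * α - 1 / 2 - 3 / 10 ^ 13 - 2 / 10 ^ 60 with hx
    have hx0 : 1 / 100 ≤ x := by rw [hx]; norm_num; linarith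
    have h4 : (N : ℝ) ^ (1 / 2 - 2 / 10 ^ 13 : ℝ) * F ^ 2 = (N : ℝ) ^ x *
        ((N : ℝ) * (N : ℝ) ^ (α / 2 + 1 / 10 ^ 13)) := by
      nth_rewrite 3 [← Real.rpow_one (N : ℝ)]
      rw [hFk]
      simp only [← Real.rpow_add hN0]
      congr 1
      rw [hx]; push_cast; ring
    rw [h4] at h2
    have h5 := le_of_mul_le_mul_right h2 (mul_pos hN0 hQ)
    have h6 := h.mul_le_rpow (x := x) (le_trans (by norm_num) hx0)
    norm_num at h5 h6 hx0
    linarith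

end Sieved

end SieveAP

theorem sieve_ap_exceptional :
    ∃ (c C : ℝ), c > 0 ∧ C > 0 ∧ ∃ N₀ : ℕ, ∀ N : ℕ, N ≥ N₀ →
      ∀ α : ℝ, 1/3 ≤ α → α ≤ 1/2 →
        ∀ A : Finset ℕ, A ⊆ Finset.Icc 1 N →
          ∀ Ps : Finset ℕ, (∀ p ∈ Ps, p.Prime ∧ (p : ℝ) ≤ (N : ℝ) ^ α) →
            (∑ p ∈ (primesUpTo ((N : ℝ) ^ α)).filter (fun p => p ∉ Ps),
                Real.log p / p) < c * Real.log N →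
            (∀ p ∈ Ps, InAP (modImage A p) (α * p)) →
            (A.card : ℝ) ≤ C * (N : ℝ) ^ (α - c) := by
  refine ⟨1 / 10 ^ 60, 1, by positivity, one_pos, ⌈Real.exp (10 ^ 100)⌉₊,
    fun N hN α hα hα2 A hA Ps hPs hexc hAP => ?_⟩
  have hexp : Real.exp (10 ^ 100) ≤ N := (Nat.le_ceil _).trans (by exact_mod_cast hN)
  have hℓ : (10 : ℝ) ^ 100 ≤ Real.log N :=
    (Real.le_log_iff_exp_le ((Real.exp_pos _).trans_le hexp)).2 hexp
  have hN1 : 1 ≤ N := by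
    have : (0 : ℝ) < N := (Real.exp_pos _).trans_le hexp
    exact_mod_cast this
  obtain ⟨K, hK⟩ : ∃ K : ℕ, (K : ℝ) = 10 ^ 15 := ⟨10 ^ 15, by norm_num⟩
  have hK1 : 1 ≤ K := by
    have : (1 : ℝ) ≤ K := by rw [hK]; norm_num
    exact_mod_cast this
  have hKlog : Real.log K ≤ 35 := by
    have h1 : Real.log K ≤ Real.log ((2 : ℝ) ^ 50) :=
      Real.log_le_log (by rw [hK]; norm_num) (by rw [hK]; norm_num)
    have := Real.log_two_lt_d9
    rw [Real.log_pow] at h1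
    push_cast at h1
    linarith
  have hlarge : ∀ p ∈ Ps.filter (K < ·), (10 : ℝ) ^ 15 ≤ p := by
    intro p hp
    rw [← hK]
    exact_mod_cast (Finset.mem_filter.1 hp).2.le
  obtain ⟨j, hj⟩ := SieveAP.exists_coords (A := A) (P := Ps.filter (K < ·)) hα2 fun p hp => by
    have hp' := (Finset.mem_filter.1 hp).1
    have h1 := hlarge p hp
    have h2 : 1 / 3 * (p : ℝ) ≤ α * p := by gcongr
    exact ⟨(hPs p hp').1, by linarith, hAP p hp'⟩
  have hsum := fun β (hβ : 0 ≤ β) (hβα : β ≤ α) =>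
    SieveAP.sum_log_div_bounds hN1 hβ hβα hK1 hKlog (fun p hp => (hPs p hp).1) hexc
  have hS : SieveAP.Sieved N α A (Ps.filter (K < ·)) j :=
    ⟨hA, hj, hα, hα2, hlarge, hℓ, fun β h1 h2 => (hsum β h1 h2).1, fun β h1 h2 => (hsum β h1 h2).2⟩
  rw [one_mul]
  exact hS.card_le
end
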